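/- Let K ⊆ ℝ be any self-similar set, i.e., the attractor of an arbitrary iterated function system of affine contractions on ℝ (no separation condition such as the open set condition is assumed). Then dim_H(VWA ∩ K) = dim_H(K), where VWA is the set of very well approximable numbers. -/

import Mathlib

open MeasureTheory Set

/-- An iterated function system on ℝ: finitely many affine contractions
`x ↦ c i * x + b i` with contraction ratios `c i ∈ (0,1)`. -/
structure IFS where
  n : ℕ
  npos : 0 < n
  c : Fin n → ℝ
  b : Fin n → ℝ
  c_pos : ∀ i, 0 < c i
  c_lt_one : ∀ i, c i < 1

namespace IFS

/-- The `i`-th map of the IFS. -/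
noncomputable def map (F : IFS) (i : Fin F.n) : ℝ → ℝ := fun x => F.c i * x + F.b i

/-- `F` satisfies the open set condition witnessed by the open set `U`. -/
def OSCWith (F : IFS) (U : Set ℝ) : Prop :=
  U.Nonempty ∧ IsOpen U ∧ Bornology.IsBounded U ∧
    (⋃ i, F.map i '' U) ⊆ U ∧
    Pairwise fun i j => Disjoint (F.map i '' U) (F.map j '' U)

/-- The open set condition. -/
def OSC (F : IFS) : Prop := ∃ U, F.OSCWith U

/-- `K` is the attractor (self-similar set) of `F`. -/
def IsAttractor (F : IFS) (K : Set ℝ) : Prop :=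
  K.Nonempty ∧ IsCompact K ∧ K = ⋃ i, F.map i '' K

/-- Composition `f_α = f_{i₁} ∘ ⋯ ∘ f_{i_k}` of the maps along a word `α`. -/
noncomputable def wordMap (F : IFS) : List (Fin F.n) → ℝ → ℝ
  | [] => id
  | i :: w => F.map i ∘ F.wordMap w

/-- Contraction ratio `c_α` of `f_α`. -/
noncomputable def wordC (F : IFS) (w : List (Fin F.n)) : ℝ := (w.map F.c).prod

end IFS

/-- The set `W(ψ)` of `ψ`-well approximable real numbers: those `x` with
`|q·x − p| < ψ q` for infinitely many pairs `(p, q) ∈ ℤ × ℕ`, `q ≥ 1`. -/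
def wellApprox (ψ : ℕ → ℝ) : Set ℝ :=
  {x : ℝ | {pq : ℤ × ℕ | 0 < pq.2 ∧ |(pq.2 : ℝ) * x - (pq.1 : ℝ)| < ψ pq.2}.Infinite}

/-- `ψ_v (q) = q^{-v}`. -/
noncomputable def psiv (v : ℝ) : ℕ → ℝ := fun q => (q : ℝ) ^ (-v)

/-- The set of very well approximable numbers: `VWA = ⋃_{v > 1} W(ψ_v)`. -/
noncomputable def VWA : Set ℝ := ⋃ v ∈ Set.Ioi (1 : ℝ), wellApprox (psiv v)

/-- The (topological) support of a Borel measure on ℝ. -/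
def msupport (μ : Measure ℝ) : Set ℝ :=
  {x | ∀ U : Set ℝ, IsOpen U → x ∈ U → 0 < μ U}

/-- `μ` is the self-similar measure of `F` with exponent `s`: a compactly supported
Borel probability measure with `μ = ∑ i, (c i ^ s) • (F.map i)_* μ`. -/
def selfSimilarMeasure (F : IFS) (s : ℝ) (μ : Measure ℝ) : Prop :=
  IsProbabilityMeasure μ ∧ IsCompact (msupport μ) ∧
    μ = ∑ i, ENNReal.ofReal (F.c i ^ s) • Measure.map (F.map i) μ

/-- The set `A_m(ψ)`: points within `ψ(2^m)/q` of a reduced fraction `p/q` with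
`2^m ≤ q < 2^{m+1}`. -/
def Aset (ψ : ℕ → ℝ) (m : ℕ) : Set ℝ :=
  {x | ∃ p : ℤ, ∃ q : ℕ, Int.gcd p q = 1 ∧ 2 ^ m ≤ q ∧ q < 2 ^ (m + 1) ∧
    |(q : ℝ) * x - (p : ℝ)| < ψ (2 ^ m)}

/-- The set `D_m(ψ)`: points within `ψ(2^m)/q` of a reduced fraction `p/q` with
`2^{m-1} ≤ q < 2^m`. -/
def Dset (ψ : ℕ → ℝ) (m : ℕ) : Set ℝ :=
  {x | ∃ p : ℤ, ∃ q : ℕ, Int.gcd p q = 1 ∧ 2 ^ (m - 1) ≤ q ∧ q < 2 ^ m ∧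
    |(q : ℝ) * x - (p : ℝ)| < ψ (2 ^ m)}

/-- Index set of the family of balls `𝒟_m`: primitive pairs `(p,q)` with
`2^{m-1} ≤ q < 2^m`. -/
def Didx (m : ℕ) : Set (ℤ × ℕ) :=
  {pq | Int.gcd pq.1 pq.2 = 1 ∧ 2 ^ (m - 1) ≤ pq.2 ∧ pq.2 < 2 ^ m}

/-- The ball `B(p/q, ψ(2^m)/q)` of the families `𝒟_m(ψ)` and `𝒜_m(ψ)`. -/
noncomputable def ballOf (ψ : ℕ → ℝ) (m : ℕ) (pq : ℤ × ℕ) : Set ℝ :=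
  Metric.ball ((pq.1 : ℝ) / (pq.2 : ℝ)) (ψ (2 ^ m) / (pq.2 : ℝ))

abbrev SL2R := Matrix.SpecialLinearGroup (Fin 2) ℝ
abbrev SL2Z := Matrix.SpecialLinearGroup (Fin 2) ℤ

/-- The inclusion of `SL(2, ℤ)` into `SL(2, ℝ)`. -/
noncomputable def intEmb : SL2Z →* SL2R :=
  Matrix.SpecialLinearGroup.map (Int.castRingHom ℝ)

namespace SL2R

theorem mul00 (a b : SL2R) : (a * b) 0 0 = a 0 0 * b 0 0 + a 0 1 * b 1 0 := by
  simp [Matrix.mul_apply, Fin.sum_univ_two]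
theorem mul01 (a b : SL2R) : (a * b) 0 1 = a 0 0 * b 0 1 + a 0 1 * b 1 1 := by
  simp [Matrix.mul_apply, Fin.sum_univ_two]
theorem mul10 (a b : SL2R) : (a * b) 1 0 = a 1 0 * b 0 0 + a 1 1 * b 1 0 := by
  simp [Matrix.mul_apply, Fin.sum_univ_two]
theorem mul11 (a b : SL2R) : (a * b) 1 1 = a 1 0 * b 0 1 + a 1 1 * b 1 1 := by
  simp [Matrix.mul_apply, Fin.sum_univ_two]
theorem inv00 (a : SL2R) : a⁻¹ 0 0 = a 1 1 := by
  simp [Matrix.SpecialLinearGroup.coe_inv, Matrix.adjugate_fin_two]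
theorem inv01 (a : SL2R) : a⁻¹ 0 1 = -a 0 1 := by
  simp [Matrix.SpecialLinearGroup.coe_inv, Matrix.adjugate_fin_two]
theorem inv10 (a : SL2R) : a⁻¹ 1 0 = -a 1 0 := by
  simp [Matrix.SpecialLinearGroup.coe_inv, Matrix.adjugate_fin_two]
theorem inv11 (a : SL2R) : a⁻¹ 1 1 = a 0 0 := by
  simp [Matrix.SpecialLinearGroup.coe_inv, Matrix.adjugate_fin_two]

theorem det_eq (a : SL2R) : a 0 0 * a 1 1 - a 0 1 * a 1 0 = 1 := by
  have := a.det_coe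
  rwa [Matrix.det_fin_two] at this

end SL2R

theorem SL2Z_det_eq (a : SL2Z) : a 0 0 * a 1 1 - a 0 1 * a 1 0 = 1 := by
  have := a.det_coe
  rwa [Matrix.det_fin_two] at this

theorem intEmb_apply (γ : SL2Z) (i j : Fin 2) : intEmb γ i j = (γ i j : ℝ) := by
  simp [intEmb]

/-- The upper triangular matrix `diag(eˣ, e⁻ˣ) · u₋ₛ`. -/
noncomputable def upT (x s : ℝ) : SL2R :=
  ⟨!![Real.exp x, -(Real.exp x * s); 0, Real.exp (-x)], by
    rw [Matrix.det_fin_two_of, ← Real.exp_add]; simp⟩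

namespace upT
variable (x s : ℝ)
@[simp] theorem e00 : upT x s 0 0 = Real.exp x := rfl
@[simp] theorem e01 : upT x s 0 1 = -(Real.exp x * s) := rfl
@[simp] theorem e10 : upT x s 1 0 = 0 := rfl
@[simp] theorem e11 : upT x s 1 1 = Real.exp (-x) := rfl
end upT

theorem SL2R_ext {a b : SL2R} (h0 : a 0 0 = b 0 0) (h1 : a 0 1 = b 0 1) (h2 : a 1 0 = b 1 0)
    (h3 : a 1 1 = b 1 1) : a = b := by
  ext i j; fin_cases i <;> fin_cases j <;> assumption

theorem upT_mul (x s x' s' : ℝ) :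
    upT x' s' * upT x s = upT (x' + x) (s + Real.exp (-(2 * x)) * s') := by
  have h1 : Real.exp (x' + x) = Real.exp x' * Real.exp x := Real.exp_add _ _
  have h2 : Real.exp (-(2 * x)) = Real.exp (-x) * Real.exp (-x) := by
    rw [← Real.exp_add]; ring_nf
  have h3 : Real.exp x * Real.exp (-x) = 1 := by rw [← Real.exp_add]; simp
  apply SL2R_ext
  · rw [SL2R.mul00]; simp [h1]
  · rw [SL2R.mul01]; simp only [upT.e00, upT.e01, upT.e11, h1, h2]
    linear_combination (-Real.exp x' * s' * Real.exp (-x)) * (-h3)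
  · rw [SL2R.mul10]; simp
  · rw [SL2R.mul11]; simp [← Real.exp_add]; ring_nf

theorem upT_conj (x s : ℝ) (h : SL2R) :
    (upT x s * h * (upT x s)⁻¹) 0 0 = h 0 0 - s * h 1 0 ∧
    (upT x s * h * (upT x s)⁻¹) 0 1 =
      Real.exp (2 * x) * (h 0 1 + s * (h 0 0 - h 1 1) - s ^ 2 * h 1 0) ∧
    (upT x s * h * (upT x s)⁻¹) 1 0 = Real.exp (-(2 * x)) * h 1 0 ∧
    (upT x s * h * (upT x s)⁻¹) 1 1 = h 1 1 + s * h 1 0 := by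
  have h2 : Real.exp (-(2 * x)) = Real.exp (-x) * Real.exp (-x) := by
    rw [← Real.exp_add]; ring_nf
  have h2' : Real.exp (2 * x) = Real.exp x * Real.exp x := by
    rw [← Real.exp_add]; ring_nf
  have h3 : Real.exp x * Real.exp (-x) = 1 := by rw [← Real.exp_add]; simp
  simp only [SL2R.mul00, SL2R.mul01, SL2R.mul10, SL2R.mul11, SL2R.inv00, SL2R.inv01, SL2R.inv10,
    SL2R.inv11, upT.e00, upT.e01, upT.e10, upT.e11, h2, h2']
  refine ⟨?_, ?_, ?_, ?_⟩
  · linear_combination (h 0 0 - s * h 1 0) * h3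
  · ring
  · ring
  · linear_combination (h 1 1 + s * h 1 0) * h3

/-- The point `∑ εᵢ λ⁻ⁱ` coded by a binary word. -/
noncomputable def codeSum (lam : ℝ) : List Bool → ℝ
  | [] => 0
  | e :: w => (if e then 1 else 0) + codeSum lam w / lam

/-- The matrix of a word; `a = log λ / 2`. -/
noncomputable def wordMat (lam : ℝ) (w : List Bool) : SL2R :=
  upT (w.length * (Real.log lam / 2)) (codeSum lam w)

theorem codeSum_append (lam : ℝ) (w v : List Bool) :
    codeSum lam (w ++ v) = codeSum lam w + codeSum lam v / lam ^ w.length := by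
  induction w with
  | nil => simp [codeSum]
  | cons e w ih => simp [codeSum, ih, pow_succ]; ring

theorem exp_word {lam : ℝ} (hl : 0 < lam) (n : ℕ) :
    Real.exp (2 * (n * (Real.log lam / 2))) = lam ^ n := by
  rw [show 2 * ((n : ℝ) * (Real.log lam / 2)) = n * Real.log lam by ring, Real.exp_nat_mul,
    Real.exp_log hl]

theorem wordMat_append {lam : ℝ} (hl : 0 < lam) (w v : List Bool) :
    wordMat lam (w ++ v) = wordMat lam v * wordMat lam w := by
  rw [wordMat, wordMat, wordMat, upT_mul, Real.exp_neg, exp_word hl, codeSum_append]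
  congr 1
  · push_cast [List.length_append]; ring
  · ring

theorem codeSum_nonneg {lam : ℝ} (hl : 2 ≤ lam) (w : List Bool) : 0 ≤ codeSum lam w := by
  induction w with
  | nil => simp [codeSum]
  | cons e w ih =>
    have : 0 ≤ codeSum lam w / lam := by positivity
    cases e <;> simp [codeSum] <;> linarith

theorem codeSum_le {lam : ℝ} (hl : 2 ≤ lam) (w : List Bool) : codeSum lam w ≤ 2 := by
  induction w with
  | nil => simp [codeSum]
  | cons e w ih =>
    have : codeSum lam w / lam ≤ 1 := by
      rw [div_le_one (by linarith)]; linarith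
    cases e <;> simp [codeSum] <;> linarith

theorem codeSum_replicate_false (lam : ℝ) (n : ℕ) :
    codeSum lam (List.replicate n false) = 0 := by
  induction n with
  | zero => simp [codeSum]
  | succ n ih => simp [List.replicate_succ, codeSum, ih]

/-- Distinct words of the same length code points that are `λ^{1-n}/2`-separated. -/
theorem codeSum_sep {lam : ℝ} (hl : 8 ≤ lam) :
    ∀ (w v : List Bool), w.length = v.length → w ≠ v →
      lam / 2 ≤ lam ^ w.length * |codeSum lam w - codeSum lam v| := by
  intro w
  induction w with
  | nil => intro v h1 h2; cases v with | nil => exact absurd rfl h2 | cons _ _ => simp at h1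
  | cons e w ih =>
    intro v h1 h2
    cases v with
    | nil => simp at h1
    | cons e' v =>
      have hlen : w.length = v.length := by simpa using h1
      have hl0 : 0 < lam := by linarith
      by_cases hee : e = e'
      · subst hee
        have hne : w ≠ v := fun h => h2 (by rw [h])
        have := ih v hlen hne
        rw [codeSum, codeSum, List.length_cons, pow_succ]
        rw [show ((if e = true then (1:ℝ) else 0) + codeSum lam w / lam -
          ((if e = true then (1:ℝ) else 0) + codeSum lam v / lam)) =
          (codeSum lam w - codeSum lam v) / lam by ring, abs_div, abs_of_pos hl0]
        rw [show lam ^ w.length * lam * (|codeSum lam w - codeSum lam v| / lam) =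
          lam ^ w.length * |codeSum lam w - codeSum lam v| by field_simp]
        exact this
      · have a1 := codeSum_nonneg (by linarith : (2:ℝ) ≤ lam) w
        have a2 := codeSum_le (by linarith : (2:ℝ) ≤ lam) w
        have a3 := codeSum_nonneg (by linarith : (2:ℝ) ≤ lam) v
        have a4 := codeSum_le (by linarith : (2:ℝ) ≤ lam) v
        have b1 : |codeSum lam w / lam - codeSum lam v / lam| ≤ 1 / 2 := by
          rw [← sub_div, abs_div, abs_of_pos hl0, div_le_iff₀ hl0, abs_le]
          constructor <;> linarith
        rw [abs_le] at b1
        have key : 1 / 2 ≤ |codeSum lam (e :: w) - codeSum lam (e' :: v)| := by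
          rw [codeSum, codeSum]
          cases e <;> cases e' <;> simp at hee ⊢
          · rw [abs_sub_comm]
            refine le_trans ?_ (le_abs_self _); linarith
          · refine le_trans ?_ (le_abs_self _); linarith
        have : lam ≤ lam ^ (e :: w).length := by
          rw [List.length_cons]
          exact le_self_pow₀ (by linarith) (by omega)
        nlinarith

/-- All nonzero vectors of the lattice `g ℤ²` have sup norm larger than `ε`. -/
def SysGT (ε : ℝ) (g : SL2R) : Prop :=
  ∀ p q : ℤ, (p ≠ 0 ∨ q ≠ 0) → ε < |g 0 0 * p + g 0 1 * q| ∨ ε < |g 1 0 * p + g 1 1 * q|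

/-- No word of length at most `L` brings `g ℤ²` to depth `ε` in the cusp. -/
def NoExc (lam : ℝ) (L : ℕ) (ε : ℝ) (g : SL2R) : Prop :=
  ∀ w : List Bool, w.length ≤ L → SysGT ε (wordMat lam w * g)

theorem SysGT.mul_int {ε : ℝ} {g : SL2R} (h : SysGT ε g) (γ : SL2Z) :
    SysGT ε (g * intEmb γ) := by
  intro p q hpq
  have hd := SL2Z_det_eq γ
  have := h (γ 0 0 * p + γ 0 1 * q) (γ 1 0 * p + γ 1 1 * q) (by
    by_contra hcon
    push Not at hcon
    obtain ⟨h1, h2⟩ := hcon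
    have e1 : p = 0 := by linear_combination γ 1 1 * h1 - γ 0 1 * h2 - p * hd
    have e2 : q = 0 := by linear_combination γ 0 0 * h2 - γ 1 0 * h1 - q * hd
    rcases hpq with h | h <;> contradiction)
  simp only [SL2R.mul00, SL2R.mul01, SL2R.mul10, SL2R.mul11, intEmb_apply]
  push_cast at this
  convert this using 3 <;> ring

theorem reduced_basis_bound {a b c d ε : ℝ} (h0 : 0 < ε) (h1 : ε ≤ 1)
    (hdet : a * d - b * c = 1) (hse : ε ^ 2 < a ^ 2 + c ^ 2)
    (hre : |a * b + c * d| ≤ 1 / 2 * (a ^ 2 + c ^ 2))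
    (hn : 1 ≤ (-(a * b + c * d) / (a ^ 2 + c ^ 2)) ^ 2 + (1 / (a ^ 2 + c ^ 2)) ^ 2) :
    a ^ 2 + c ^ 2 ≤ (2 / ε) ^ 2 ∧ b ^ 2 + d ^ 2 ≤ (2 / ε) ^ 2 := by
  have hac : 0 < a ^ 2 + c ^ 2 := lt_trans (by positivity) hse
  have hs_t : (a * b + c * d) ^ 2 + 1 = (a ^ 2 + c ^ 2) * (b ^ 2 + d ^ 2) := by
    linear_combination (-(a*d-b*c) - 1) * hdet
  generalize a * b + c * d = t at *
  generalize a ^ 2 + c ^ 2 = s at *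
  have ht2 : t ^ 2 ≤ s ^ 2 / 4 := by
    rw [abs_le] at hre; nlinarith
  have hs2 : s ^ 2 ≤ 2 := by
    have : 1 ≤ (t ^ 2 + 1) / s ^ 2 := by
      convert hn using 1; field_simp
    rw [le_div_iff₀ (by positivity)] at this
    nlinarith
  have hs2' : s ≤ 2 := by nlinarith
  have h5 : ε ^ 2 ≤ 1 := by nlinarith
  constructor
  · rw [div_pow, le_div_iff₀ (by positivity)]
    nlinarith
  · have e3 : b ^ 2 + d ^ 2 = (t ^ 2 + 1) / s := by rw [hs_t]; field_simp
    rw [e3, div_le_iff₀ hac, div_pow, div_mul_eq_mul_div, le_div_iff₀ (by positivity)]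
    have h6 : t ^ 2 ≤ s / 2 := by nlinarith
    have h7 : t ^ 2 * ε ^ 2 ≤ s / 2 * 1 := by gcongr
    nlinarith

open UpperHalfPlane in
theorem SysGT.exists_reduced {ε : ℝ} (h0 : 0 < ε) (h1 : ε ≤ 1) {g : SL2R} (h : SysGT ε g) :
    ∃ γ : SL2Z, ∀ i j, |(g * intEmb γ) i j| ≤ 2 / ε := by
  obtain ⟨γ, hγ⟩ := ModularGroup.exists_smul_mem_fd ((g⁻¹ : SL2R) • (UpperHalfPlane.I))
  refine ⟨γ⁻¹, ?_⟩
  set G : SL2R := g * intEmb γ⁻¹ with hG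
  have hS : SysGT ε G := h.mul_int γ⁻¹
  have e1 : γ • ((g⁻¹ : SL2R) • (UpperHalfPlane.I)) = (G⁻¹ : SL2R) • UpperHalfPlane.I := by
    rw [hG, mul_inv_rev, map_inv, inv_inv, mul_smul]
    rfl
  rw [e1] at hγ
  obtain ⟨hn, hre⟩ := hγ
  set z := (G⁻¹ : SL2R) • UpperHalfPlane.I with hz
  have hdet := SL2R.det_eq G
  set a := G 0 0 with ha
  set b := G 0 1
  set c := G 1 0 with hc
  set d := G 1 1
  have hac : 0 < a ^ 2 + c ^ 2 := by
    by_contra hcon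
    have h1 : a = 0 := by nlinarith [sq_nonneg a, sq_nonneg c]
    have h2 : c = 0 := by nlinarith [sq_nonneg a, sq_nonneg c]
    rw [h1, h2] at hdet; simp at hdet
  have hzc : (z : ℂ) = (d * Complex.I - b) / (-c * Complex.I + a) := by
    rw [hz, UpperHalfPlane.specialLinearGroup_apply]
    simp only [SL2R.inv00, SL2R.inv01, SL2R.inv10, SL2R.inv11]
    simp [a, b, c, d]
    ring
  have hne : (-c * Complex.I + a : ℂ) ≠ 0 := by
    intro h
    have h1 := congrArg Complex.re h
    have h2 := congrArg Complex.im h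
    simp at h1 h2
    rw [h1, h2] at hac; simp at hac
  have hzc2 : (z : ℂ) = ((-(a * b + c * d) / (a ^ 2 + c ^ 2) : ℝ) : ℂ)
      + ((1 / (a ^ 2 + c ^ 2) : ℝ) : ℂ) * Complex.I := by
    rw [hzc, div_eq_iff hne]
    have hac' : ((a : ℂ) ^ 2 + (c : ℂ) ^ 2) ≠ 0 := by exact_mod_cast hac.ne'
    have hdet' : (a : ℂ) * d - b * c = 1 := by exact_mod_cast hdet
    push_cast
    field_simp
    linear_combination (Complex.I * a + c) * hdet' + c * Complex.I_sq
  have him : z.im = 1 / (a ^ 2 + c ^ 2) := by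
    rw [← UpperHalfPlane.coe_im, hzc2, Complex.add_im, Complex.ofReal_im, Complex.im_ofReal_mul,
      Complex.I_im]; ring
  have hre' : z.re = -(a * b + c * d) / (a ^ 2 + c ^ 2) := by
    rw [← UpperHalfPlane.coe_re, hzc2, Complex.add_re, Complex.ofReal_re, Complex.re_ofReal_mul,
      Complex.I_re]; ring
  have hn' : 1 ≤ z.re ^ 2 + z.im ^ 2 := by
    rw [Complex.normSq_apply] at hn
    simpa [sq] using hn
  rw [hre'] at hre hn'
  rw [him] at hn'
  rw [abs_div, abs_of_pos hac, abs_neg, div_le_iff₀ hac] at hre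
  have hse : ε ^ 2 < a ^ 2 + c ^ 2 := by
    rcases hS 1 0 (Or.inl one_ne_zero) with h | h
    · simp only [Int.cast_one, Int.cast_zero, mul_one, mul_zero, add_zero] at h
      have : ε ^ 2 < |G 0 0| ^ 2 := by gcongr
      rw [sq_abs] at this; rw [ha]; linarith [sq_nonneg c]
    · simp only [Int.cast_one, Int.cast_zero, mul_one, mul_zero, add_zero] at h
      have : ε ^ 2 < |G 1 0| ^ 2 := by gcongr
      rw [sq_abs] at this; rw [hc]; linarith [sq_nonneg a]
  obtain ⟨hac2, hbd⟩ := reduced_basis_bound h0 h1 hdet hse hre hn'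
  have hpos : 0 ≤ 2 / ε := by positivity
  intro i j
  apply abs_le_of_sq_le_sq _ hpos
  fin_cases i <;> fin_cases j <;> simp only [Fin.mk_zero, Fin.mk_one]
  · show a ^ 2 ≤ _; linarith [sq_nonneg c]
  · show b ^ 2 ≤ _; linarith [sq_nonneg d]
  · show c ^ 2 ≤ _; linarith [sq_nonneg a]
  · show d ^ 2 ≤ _; linarith [sq_nonneg b]

theorem exists_lattice_near {B : ℝ} {g : SL2R} (hB : ∀ i j, |g i j| ≤ B) (x y : ℝ) :
    ∃ p q : ℤ, |g 0 0 * p + g 0 1 * q - x| ≤ B ∧ |g 1 0 * p + g 1 1 * q - y| ≤ B := by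
  have hd := SL2R.det_eq g
  set u := g 1 1 * x - g 0 1 * y with hu
  set v := g 0 0 * y - g 1 0 * x with hv
  refine ⟨round u, round v, ?_⟩
  have h1 := abs_sub_round u
  have h2 := abs_sub_round v
  have hB0 : 0 ≤ B := (abs_nonneg _).trans (hB 0 0)
  have key : ∀ s t z : ℝ, |s| ≤ B → |t| ≤ B → z = s * u + t * v →
      |s * round u + t * round v - z| ≤ B := by
    intro s t z hs ht hz
    have e : s * round u + t * round v - z = -(s * (u - round u)) - t * (v - round v) := by
      rw [hz]; ring
    rw [e]
    have a1 : |s * (u - round u)| ≤ B * (1 / 2) := by rw [abs_mul]; gcongr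
    have a2 : |t * (v - round v)| ≤ B * (1 / 2) := by rw [abs_mul]; gcongr
    rw [abs_le] at *
    constructor <;> linarith
  refine ⟨key _ _ _ (hB 0 0) (hB 0 1) ?_, key _ _ _ (hB 1 0) (hB 1 1) ?_⟩
  · rw [hu, hv]; linear_combination (-x) * hd
  · rw [hu, hv]; linear_combination (-y) * hd

/-- A lattice without short vectors contains a vector of controlled size whose
horocycle time of vanishing lies in `[1, 2]`. -/
theorem SysGT.exists_vector {ε : ℝ} (h0 : 0 < ε) (h1 : ε ≤ 1) {g : SL2R} (h : SysGT ε g) :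
    ∃ p q : ℤ, ∃ t : ℝ, 1 ≤ t ∧ t ≤ 2 ∧ 0 < g 1 0 * p + g 1 1 * q ∧
      g 1 0 * p + g 1 1 * q ≤ 32 / ε ∧
      g 0 0 * p + g 0 1 * q = -(t * (g 1 0 * p + g 1 1 * q)) := by
  obtain ⟨γ, hγ⟩ := h.exists_reduced h0 h1
  set B := 2 / ε with hB
  have hB0 : 0 < B := by positivity
  obtain ⟨p, q, hx, hy⟩ := exists_lattice_near hγ (-(15 * B)) (10 * B)
  simp only [SL2R.mul00, SL2R.mul01, SL2R.mul10, SL2R.mul11, intEmb_apply] at hx hy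
  refine ⟨γ 0 0 * p + γ 0 1 * q, γ 1 0 * p + γ 1 1 * q, ?_⟩
  push_cast
  set X := g 0 0 * (γ 0 0 * p + γ 0 1 * q : ℝ) + g 0 1 * (γ 1 0 * p + γ 1 1 * q) with hX
  set Y := g 1 0 * (γ 0 0 * p + γ 0 1 * q : ℝ) + g 1 1 * (γ 1 0 * p + γ 1 1 * q) with hY
  have hx' : |X + 15 * B| ≤ B := by convert hx using 2; rw [hX]; ring
  have hy' : |Y - 10 * B| ≤ B := by convert hy using 2; rw [hY]; ring
  rw [abs_le] at hx' hy'
  have hY0 : 0 < Y := by linarith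
  refine ⟨-X / Y, ?_, ?_, hY0, ?_, ?_⟩
  · rw [le_div_iff₀ hY0]; linarith
  · rw [div_le_iff₀ hY0]; linarith
  · have : 32 / ε = 16 * B := by rw [hB]; ring
    rw [this]; linarith
  · field_simp

theorem int_parabolic {a b c d : ℤ} (hdet : a * d - b * c = 1) (htr : a + d = 2)
    (hne : ¬(a = 1 ∧ b = 0 ∧ c = 0 ∧ d = 1)) :
    ∃ k m n : ℤ, k ≠ 0 ∧ (m ≠ 0 ∨ n ≠ 0) ∧ a = 1 - k * m * n ∧ b = k * m ^ 2 ∧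
      c = -(k * n ^ 2) ∧ d = 1 + k * m * n := by
  have ha : (1 - a) ^ 2 = -(b * c) := by
    have : d = 2 - a := by linarith
    subst this; linarith
  obtain hbc | hbc := eq_or_ne (Int.gcd b c) 0
  · rw [Int.gcd_eq_zero_iff] at hbc
    obtain ⟨rfl, rfl⟩ := hbc
    have : (1 - a) = 0 := by
      have : (1 - a) ^ 2 = 0 := by rw [ha]; ring
      exact pow_eq_zero_iff (two_ne_zero) |>.mp this
    exact absurd ⟨by linarith, rfl, rfl, by linarith⟩ hne
  · set r : ℤ := (Int.gcd b c : ℤ) with hr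
    have hr0 : r ≠ 0 := by rw [hr]; exact_mod_cast hbc
    obtain ⟨b', hb'⟩ : r ∣ b := Int.gcd_dvd_left ..
    obtain ⟨c', hc'⟩ : r ∣ c := Int.gcd_dvd_right ..
    have hcop : Int.gcd b' c' = 1 := by
      have h1 : Int.gcd b c = Int.gcd b c * Int.gcd b' c' := by
        conv_lhs => rw [hb', hc', Int.gcd_mul_left, hr, Int.natAbs_natCast]
      have : 0 < Int.gcd b c := Nat.pos_of_ne_zero hbc
      nlinarith
    have hra : r ∣ (1 - a) := by
      rw [← Int.pow_dvd_pow_iff (two_ne_zero)]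
      rw [ha, hb', hc']
      exact ⟨-(b' * c'), by ring⟩
    obtain ⟨e, he⟩ := hra
    have hsq : b' * (-c') = e ^ 2 := by
      have : r ^ 2 * (b' * (-c')) = r ^ 2 * e ^ 2 := by
        rw [he, hb', hc'] at ha; linarith
      exact mul_left_cancel₀ (pow_ne_zero 2 hr0) this
    have hcop2 : Int.gcd b' (-c') = 1 := by rw [Int.gcd_neg]; exact hcop
    obtain ⟨m, hm⟩ := Int.sq_of_gcd_eq_one hcop2 hsq
    obtain ⟨n, hn⟩ := Int.sq_of_gcd_eq_one (by rwa [Int.gcd_comm]) (by rw [mul_comm]; exact hsq)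
    have hmn : m ≠ 0 ∨ n ≠ 0 := by
      by_contra hcon
      push Not at hcon
      obtain ⟨rfl, rfl⟩ := hcon
      have h1 : b' = 0 := by simpa using hm
      have h2 : c' = 0 := by simpa using hn
      subst h1 h2; simp at hcop
    -- choose signs
    have main : ∃ σ : ℤ, (σ = 1 ∨ σ = -1) ∧ b' = σ * m ^ 2 ∧ -c' = σ * n ^ 2 := by
      have he2 := sq_nonneg e
      rcases hm with hm | hm <;> rcases hn with hn | hn
      · exact ⟨1, Or.inl rfl, by linarith, by linarith⟩
      · have h0 : m ^ 2 * n ^ 2 ≤ 0 := by rw [hm, hn] at hsq; linarith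
        have h1 : m * n = 0 := by
          have : (m * n) ^ 2 ≤ 0 := by rw [mul_pow]; exact h0
          nlinarith [sq_nonneg (m * n), pow_eq_zero_iff (M₀ := ℤ) (a := m * n) two_ne_zero]
        rcases mul_eq_zero.mp h1 with h1 | h1
        · subst h1; exact ⟨-1, Or.inr rfl, by simp [hm], by rw [hn]; ring⟩
        · subst h1; exact ⟨1, Or.inl rfl, by rw [hm]; ring, by simp [hn]⟩
      · have h0 : m ^ 2 * n ^ 2 ≤ 0 := by rw [hm, hn] at hsq; linarith
        have h1 : m * n = 0 := by
          have : (m * n) ^ 2 ≤ 0 := by rw [mul_pow]; exact h0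
          nlinarith [sq_nonneg (m * n), pow_eq_zero_iff (M₀ := ℤ) (a := m * n) two_ne_zero]
        rcases mul_eq_zero.mp h1 with h1 | h1
        · subst h1; exact ⟨1, Or.inl rfl, by simp [hm], by rw [hn]; ring⟩
        · subst h1; exact ⟨-1, Or.inr rfl, by rw [hm]; ring, by simp [hn]⟩
      · exact ⟨-1, Or.inr rfl, by linarith, by linarith⟩
    obtain ⟨σ, hσ, hb2, hc2⟩ := main
    have hσ2 : σ ^ 2 = 1 := by rcases hσ with h | h <;> rw [h] <;> norm_num
    have hemn : e ^ 2 = (m * n) ^ 2 := by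
      rw [← hsq, hb2, hc2]; linear_combination (m ^ 2 * n ^ 2) * hσ2
    -- the sign of `n` is adjusted
    obtain ⟨n', hn', hen⟩ : ∃ n' : ℤ, (n' = n ∨ n' = -n) ∧ e = σ * m * n' := by
      rcases sq_eq_sq_iff_eq_or_eq_neg.mp hemn with h | h <;> rcases hσ with h' | h'
      · exact ⟨n, Or.inl rfl, by rw [h, h']; ring⟩
      · exact ⟨-n, Or.inr rfl, by rw [h, h']; ring⟩
      · exact ⟨-n, Or.inr rfl, by rw [h, h']; ring⟩
      · exact ⟨n, Or.inl rfl, by rw [h, h']; ring⟩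
    have hnn : n' ^ 2 = n ^ 2 := by rcases hn' with h | h <;> rw [h]; ring
    refine ⟨r * σ, m, n', ?_, ?_, ?_, ?_, ?_, ?_⟩
    · apply mul_ne_zero hr0; rintro rfl; norm_num at hσ
    · rcases hmn with h | h
      · exact Or.inl h
      · right; rcases hn' with h' | h' <;> rw [h'] <;> simpa using h
    · linear_combination (-1) * he - r * hen
    · rw [hb', hb2]; ring
    · rw [hc', hnn]; linear_combination (-r) * hc2
    · linear_combination htr + he + r * hen

theorem wordMat_eq_conj {lam : ℝ} (hl : 0 < lam) (w : List Bool) :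
    wordMat lam w = upT 0 (lam ^ w.length * codeSum lam w) *
      upT (w.length * (Real.log lam / 2)) 0 := by
  rw [upT_mul, Real.exp_neg, exp_word hl, wordMat]
  have : lam ^ w.length ≠ 0 := by positivity
  congr 1
  · ring
  · field_simp; ring

set_option maxHeartbeats 3200000 in
/-- Two distinct returns of the same length cannot be too close in the stable direction. -/
theorem one_le_of_close_returns {lam ε : ℝ} (h8 : 8 ≤ lam) (hε0 : 0 < ε) {n : ℕ} {P h : SL2R}
    (hP : SysGT ε P) (hε : 16 ≤ ε ^ 2 * lam ^ n) (hε1 : ε ≤ 1) {w w' : List Bool}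
    (hw : w.length = n) (hw' : w'.length = n) (hne : w ≠ w') {γ γ' : SL2Z}
    (hh : h * (wordMat lam w' * (upT (n * (Real.log lam / 2)) 0 * P) * intEmb γ') =
      wordMat lam w * (upT (n * (Real.log lam / 2)) 0 * P) * intEmb γ)
    (h00 : |h 0 0 - 1| ≤ 1 / 16) (h01 : |h 0 1| ≤ 1 / 16) (h11 : |h 1 1 - 1| ≤ 1 / 16) :
    1 ≤ lam ^ (3 * n) * |h 1 0| := by
  have hl0 : 0 < lam := by linarith
  set x := (n * (Real.log lam / 2)) with hx
  set S := lam ^ n * codeSum lam w with hS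
  set S' := lam ^ n * codeSum lam w' with hS'
  have hΛ1 : (16 : ℝ) ≤ lam ^ n := by
    have : ε ^ 2 ≤ 1 := by nlinarith
    have : 0 ≤ lam ^ n := by positivity
    nlinarith
  set Λ := lam ^ n with hΛ
  have hΛ3 : lam ^ (3 * n) = Λ ^ 3 := by rw [hΛ, ← pow_mul, mul_comm]
  have hS0 : 0 ≤ S ∧ S ≤ 2 * Λ := by
    have := codeSum_nonneg (by linarith : 2 ≤ lam) w
    have := codeSum_le (by linarith : 2 ≤ lam) w
    constructor
    · positivity
    · nlinarith
  have hS0' : 0 ≤ S' ∧ S' ≤ 2 * Λ := by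
    have := codeSum_nonneg (by linarith : 2 ≤ lam) w'
    have := codeSum_le (by linarith : 2 ≤ lam) w'
    constructor
    · positivity
    · nlinarith
  have hsep : 4 ≤ |S - S'| := by
    have := codeSum_sep h8 w w' (by rw [hw, hw']) hne
    rw [hw] at this
    rw [hS, hS', ← mul_sub, abs_mul, abs_of_pos (by positivity : 0 < Λ)]
    linarith
  by_contra hcon
  push Not at hcon
  rw [hΛ3] at hcon
  have hc1 : Λ ^ 3 * |h 1 0| ≤ 1 := hcon.le
  have hΛ0 : 0 < Λ := by positivity
  have exΛ : ∀ w : List Bool, w.length = n → lam ^ w.length = Λ := by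
    rintro w rfl; rfl
  have hr : |h 1 0| ≤ 1 / Λ ^ 3 := by rw [le_div_iff₀ (by positivity)]; linarith
  set Y : SL2R := upT x 0 * (upT x 0 * P) with hY
  set M : SL2R := upT 0 (-S) * h * upT 0 S' with hM
  set δ : SL2Z := γ * γ'⁻¹ with hδ
  have hMY : M = Y * intEmb δ * Y⁻¹ := by
    have e0 : upT 0 (-S) * upT 0 S = 1 := by
      rw [upT_mul]; apply SL2R_ext <;> simp
    have e1 : upT 0 (-S) * (wordMat lam w * (upT x 0 * P) * intEmb γ) = Y * intEmb γ := by
      rw [wordMat_eq_conj hl0 w, hw, ← hΛ, ← hS, ← hx, hY]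
      calc _ = (upT 0 (-S) * upT 0 S) * (upT x 0 * (upT x 0 * P) * intEmb γ) := by
            simp only [mul_assoc]
        _ = _ := by rw [e0, one_mul]
    rw [← hh, wordMat_eq_conj hl0 w', hw', ← hΛ, ← hS', ← hx] at e1
    have e2 : M * (Y * intEmb γ') = Y * intEmb γ := by
      rw [← e1, hM, hY]; simp only [mul_assoc]
    have e3 : M = Y * intEmb γ * (Y * intEmb γ')⁻¹ := eq_mul_inv_of_mul_eq e2
    rw [e3, hδ, map_mul, map_inv, mul_inv_rev]
    simp only [mul_assoc]
  clear_value M Y δ x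
  have hYd := SL2R.det_eq Y
  have m00 : M 0 0 = h 0 0 + S * h 1 0 := by
    simp [hM, SL2R.mul00, SL2R.mul01, SL2R.mul10]
  have m01 : M 0 1 = h 0 1 + S * h 1 1 - S' * (h 0 0 + S * h 1 0) := by
    simp [hM, SL2R.mul00, SL2R.mul01, SL2R.mul10, SL2R.mul11]; ring
  have m10 : M 1 0 = h 1 0 := by
    simp [hM, SL2R.mul00, SL2R.mul01, SL2R.mul10, SL2R.mul11]
  have m11 : M 1 1 = h 1 1 - S' * h 1 0 := by
    simp [hM, SL2R.mul00, SL2R.mul01, SL2R.mul10, SL2R.mul11]; ring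
  have n01 : M 0 1 = -((Y 0 0 * δ 0 0 + Y 0 1 * δ 1 0) * Y 0 1) +
      (Y 0 0 * δ 0 1 + Y 0 1 * δ 1 1) * Y 0 0 := by
    simp [hMY, SL2R.mul00, SL2R.mul01, SL2R.mul10, SL2R.mul11, SL2R.inv01, SL2R.inv11,
      intEmb_apply]
  have n10 : M 1 0 = (Y 1 0 * δ 0 0 + Y 1 1 * δ 1 0) * Y 1 1 -
      (Y 1 0 * δ 0 1 + Y 1 1 * δ 1 1) * Y 1 0 := by
    simp [hMY, SL2R.mul00, SL2R.mul01, SL2R.mul10, SL2R.mul11, SL2R.inv00, SL2R.inv10,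
      intEmb_apply]; ring
  have ntr : M 0 0 + M 1 1 = δ 0 0 + δ 1 1 := by
    simp only [hMY, SL2R.mul00, SL2R.mul01, SL2R.mul10, SL2R.mul11, SL2R.inv00, SL2R.inv10,
      SL2R.inv01, SL2R.inv11, intEmb_apply]
    linear_combination ((δ 0 0 : ℝ) + δ 1 1) * hYd
  have hΛ2 : 2 / Λ ^ 2 ≤ 1 / 8 := by
    have := mul_le_mul hΛ1 hΛ1 (by norm_num) hΛ0.le
    rw [div_le_div_iff₀ (by positivity) (by norm_num), pow_two]
    linarith
  have hu : |S * h 1 0| ≤ 1 / 8 := by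
    rw [abs_mul, abs_of_nonneg hS0.1]
    calc S * |h 1 0| ≤ 2 * Λ * (1 / Λ ^ 3) := by gcongr; exact hS0.2
      _ = 2 / Λ ^ 2 := by field_simp
      _ ≤ 1 / 8 := hΛ2
  have hu' : |S' * h 1 0| ≤ 1 / 8 := by
    rw [abs_mul, abs_of_nonneg hS0'.1]
    calc S' * |h 1 0| ≤ 2 * Λ * (1 / Λ ^ 3) := by gcongr; exact hS0'.2
      _ = 2 / Λ ^ 2 := by field_simp
      _ ≤ 1 / 8 := hΛ2
  have htr : δ 0 0 + δ 1 1 = 2 := by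
    have h1 : |((δ 0 0 + δ 1 1 - 2 : ℤ) : ℝ)| < 1 := by
      push_cast
      rw [← ntr, m00, m11]
      rw [abs_le] at hu hu' h00 h11
      rw [abs_lt]; constructor <;> linarith
    have h2 : |δ 0 0 + δ 1 1 - 2| < 1 := by exact_mod_cast h1
    rw [Int.abs_lt_one_iff] at h2
    linarith
  by_cases hid : δ 0 0 = 1 ∧ δ 0 1 = 0 ∧ δ 1 0 = 0 ∧ δ 1 1 = 1
  · obtain ⟨d1, d2, d3, d4⟩ := hid
    rw [d1, d2, d3, d4] at n01 n10
    have z10 : h 1 0 = 0 := by rw [← m10, n10]; push_cast; ring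
    have z01 : M 0 1 = 0 := by rw [n01]; push_cast; ring
    rw [m01, z10] at z01
    have hM00 : M 0 0 = 1 := by
      simp only [hMY, SL2R.mul00, SL2R.mul01, SL2R.mul10, SL2R.mul11, SL2R.inv00, SL2R.inv10,
        SL2R.inv01, SL2R.inv11, intEmb_apply, d1, d2, d3, d4]
      push_cast; linear_combination hYd
    have hM11 : M 1 1 = 1 := by
      simp only [hMY, SL2R.mul00, SL2R.mul01, SL2R.mul10, SL2R.mul11, SL2R.inv00, SL2R.inv10,
        SL2R.inv01, SL2R.inv11, intEmb_apply, d1, d2, d3, d4]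
      push_cast; linear_combination hYd
    rw [m00, z10] at hM00
    rw [m11, z10] at hM11
    have f0 : h 0 0 = 1 := by linarith
    have f1 : h 1 1 = 1 := by linarith
    rw [f0, f1] at z01
    have : S - S' = -h 0 1 := by linarith
    rw [this, abs_neg] at hsep
    linarith
  · obtain ⟨k, m, l, hk, hml, d1, d2, d3, d4⟩ := int_parabolic (SL2Z_det_eq δ) htr hid
    rw [d1, d2, d3, d4] at n01 n10
    push_cast at n01 n10
    have n01' : M 0 1 = k * (Y 0 0 * m + Y 0 1 * l) ^ 2 := by rw [n01]; ring
    have n10' : M 1 0 = -(k * (Y 1 0 * m + Y 1 1 * l) ^ 2) := by rw [n10]; ring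
    have hk1 : (1 : ℝ) ≤ |(k : ℝ)| := by
      have : 1 ≤ |k| := Int.one_le_abs hk
      exact_mod_cast this
    have hX : (Y 0 0 * m + Y 0 1 * l) ^ 2 ≤ 16 * Λ := by
      have b1 : |M 0 1| ≤ 16 * Λ := by
        rw [m01]
        have b2 : |S' * (h 0 0 + S * h 1 0)| ≤ 2 * Λ * 2 := by
          rw [abs_mul, abs_of_nonneg hS0'.1]
          gcongr
          · exact hS0'.2
          · simp only [abs_le] at h00 h01 h11 hu hu' ⊢; constructor <;> linarith
        have b3 : |S * h 1 1| ≤ 2 * Λ * 2 := by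
          rw [abs_mul, abs_of_nonneg hS0.1]
          gcongr
          · exact hS0.2
          · simp only [abs_le] at h00 h01 h11 hu hu' ⊢; constructor <;> linarith
        simp only [abs_le] at h00 h01 h11 hu hu' b2 b3 ⊢; constructor <;> linarith
      have b4 : |M 0 1| = |(k : ℝ)| * (Y 0 0 * m + Y 0 1 * l) ^ 2 := by
        rw [n01', abs_mul, abs_of_nonneg (sq_nonneg (Y 0 0 * (m:ℝ) + Y 0 1 * l))]
      exact (le_mul_of_one_le_left (sq_nonneg _) hk1).trans (b4.symm.le.trans b1)
    have hYY : (Y 1 0 * m + Y 1 1 * l) ^ 2 ≤ 1 / Λ ^ 3 := by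
      have b4 : |h 1 0| = |(k : ℝ)| * (Y 1 0 * m + Y 1 1 * l) ^ 2 := by
        rw [← m10, n10', abs_neg, abs_mul,
          abs_of_nonneg (sq_nonneg (Y 1 0 * (m:ℝ) + Y 1 1 * l))]
      exact (le_mul_of_one_le_left (sq_nonneg _) hk1).trans (b4.symm.le.trans hr)
    have hex : Real.exp x * Real.exp x = Λ := by
      rw [← Real.exp_add, ← two_mul, hx, exp_word hl0]
    have hex' : Real.exp (-x) * Real.exp (-x) = 1 / Λ := by
      rw [← hex, Real.exp_neg]; field_simp
    have y00 : ∀ j, Y 0 j = Λ * P 0 j := by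
      intro j; fin_cases j <;>
        simp [hY, SL2R.mul00, SL2R.mul01, SL2R.mul10, SL2R.mul11, ← hex] <;> ring
    have y10 : ∀ j, Y 1 j = 1 / Λ * P 1 j := by
      intro j; fin_cases j <;>
        simp only [hY, SL2R.mul00, SL2R.mul01, SL2R.mul10, SL2R.mul11, ← hex', Fin.mk_zero,
          Fin.mk_one, upT.e10, upT.e11] <;> ring
    rw [y00, y00] at hX
    rw [y10, y10] at hYY
    have hX2 : (P 0 0 * m + P 0 1 * l) ^ 2 ≤ ε ^ 2 := by
      have : Λ ^ 2 * (P 0 0 * m + P 0 1 * l) ^ 2 ≤ 16 * Λ := by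
        calc _ = (Λ * P 0 0 * m + Λ * P 0 1 * l) ^ 2 := by ring
          _ ≤ _ := hX
      have h3 : Λ * (P 0 0 * m + P 0 1 * l) ^ 2 ≤ 16 :=
        le_of_mul_le_mul_left (by linarith) hΛ0
      exact le_of_mul_le_mul_left (by linarith) hΛ0
    have hY2 : (P 1 0 * m + P 1 1 * l) ^ 2 ≤ ε ^ 2 := by
      have h3 : (P 1 0 * m + P 1 1 * l) ^ 2 = Λ ^ 2 * (1 / Λ * P 1 0 * m + 1 / Λ * P 1 1 * l) ^ 2 := by
        field_simp
      have h4 : Λ ^ 2 * (1 / Λ * P 1 0 * m + 1 / Λ * P 1 1 * l) ^ 2 ≤ Λ ^ 2 * (1 / Λ ^ 3) := by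
        gcongr
      have h5 : Λ ^ 2 * (1 / Λ ^ 3) = 1 / Λ := by field_simp
      rw [h3]
      refine h4.trans (h5.le.trans ?_)
      rw [div_le_iff₀ hΛ0]; linarith
    rcases hP m l hml with h | h
    · exact absurd (abs_le_of_sq_le_sq hX2 hε0.le) (not_le.mpr h)
    · exact absurd (abs_le_of_sq_le_sq hY2 hε0.le) (not_le.mpr h)

theorem abs_mul_le_mul {a b A B : ℝ} (ha : |a| ≤ A) (hb : |b| ≤ B) : |a * b| ≤ A * B := by
  rw [abs_mul]
  exact mul_le_mul ha hb (abs_nonneg _) ((abs_nonneg _).trans ha)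

/-- `h` is `e`-close, entrywise, to the unipotent matrix `!![1, t; 0, 1]`. -/
structure NearU (h : SL2R) (t e : ℝ) : Prop where
  h00 : |h 0 0 - 1| ≤ e
  h01 : |h 0 1 - t| ≤ e
  h10 : |h 1 0| ≤ e
  h11 : |h 1 1 - 1| ≤ e

theorem NearU.mono {h : SL2R} {t e e' : ℝ} (hh : NearU h t e) (he : e ≤ e') : NearU h t e' :=
  ⟨hh.h00.trans he, hh.h01.trans he, hh.h10.trans he, hh.h11.trans he⟩

theorem NearU.mul_inv {h k : SL2R} {t s e : ℝ} (hh : NearU h t e) (hk : NearU k s e)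
    (ht : |t| ≤ 2) (hs : |s| ≤ 2) (he : e ≤ 1) : NearU (h * k⁻¹) (t - s) (8 * e) := by
  have e0 : 0 ≤ e := (abs_nonneg _).trans hh.h00
  have ee : e * e ≤ e := by nlinarith
  obtain ⟨a1, a2, a3, a4⟩ := hh
  obtain ⟨b1, b2, b3, b4⟩ := hk
  have c1 := abs_mul_le_mul a1 b4
  have c2 := abs_mul_le_mul a2 b3
  have c2' := abs_mul_le_mul ht b3
  have c3 := abs_mul_le_mul a1 b2
  have c3' := abs_mul_le_mul a1 hs
  have c4 := abs_mul_le_mul a2 b1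
  have c4' := abs_mul_le_mul ht b1
  have c5 := abs_mul_le_mul a3 b4
  have c6 := abs_mul_le_mul a4 b3
  have c7 := abs_mul_le_mul a3 b2
  have c7' := abs_mul_le_mul a3 hs
  have c8 := abs_mul_le_mul a4 b1
  rw [abs_le] at *
  constructor <;>
    simp only [SL2R.mul00, SL2R.mul01, SL2R.mul10, SL2R.mul11, SL2R.inv00, SL2R.inv10,
      SL2R.inv01, SL2R.inv11, abs_le] <;> constructor <;> linarith

/-- A finite family of points of a semigroup orbit of `g ℤ²` lying on one horocycle piece through
`Z`, up to an error `err`. -/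
structure IsFam (lam : ℝ) (g : SL2R) (N : ℕ) (err : ℝ) {ι : Type} (t : ι → ℝ) (Z : SL2R) :
    Prop where
  bound : ∀ i, |t i| ≤ 2
  orbit : ∀ i, ∃ (w : List Bool) (γ : SL2Z) (h : SL2R), w.length ≤ N ∧
    wordMat lam w * g * intEmb γ = h * Z ∧ NearU h (t i) err

theorem wordMat_append_replicate {lam : ℝ} (hl : 0 < lam) (w : List Bool) (n : ℕ) :
    wordMat lam (w ++ List.replicate n false) = upT (n * (Real.log lam / 2)) 0 * wordMat lam w := by
  rw [wordMat_append hl]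
  congr 1
  rw [wordMat, codeSum_replicate_false, List.length_replicate]

theorem exp_half_sq {lam : ℝ} (hl : 0 < lam) (n : ℕ) :
    Real.exp (n * (Real.log lam / 2)) ^ 2 = lam ^ n := by
  rw [← exp_word hl, ← Real.exp_nat_mul]; norm_cast

theorem exists_pow_mem {lam X : ℝ} (hl : 1 < lam) (hX : 1 ≤ X) :
    ∃ k : ℕ, X ≤ lam ^ k ∧ lam ^ k ≤ lam * X := by
  obtain ⟨k, h1, h2⟩ := exists_nat_pow_near hX hl
  exact ⟨k + 1, h2.le, by rw [pow_succ']; gcongr⟩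

set_option maxHeartbeats 1600000 in
/-- Near each member of a family there is a point which stays away from the whole family. -/
theorem IsFam.exists_gap {lam ε err R : ℝ} {L N L' : ℕ} {g Z : SL2R} {ι : Type} {t : ι → ℝ}
    (h8 : 8 ≤ lam) (hε0 : 0 < ε) (hε1 : ε ≤ 1) (hno : NoExc lam L ε g)
    (hfam : IsFam lam g N err t Z) (hR : 1 ≤ R)
    (hL' : R * 2 ^ 12 * lam ^ 2 ≤ ε ^ 4 * 2 ^ L') (hL : N + L' ≤ L)
    (herr : err ≤ ε ^ 4 / (2 ^ 18 * lam ^ 2 * R)) (i₀ : ι) :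
    ∃ x, |x - t i₀| ≤ 2 / R ∧ ∀ i, ε ^ 4 / (2 ^ 12 * lam ^ 2 * R) < |t i - x| := by
  have hl0 : 0 < lam := by linarith
  have hl1 : 1 < lam := by linarith
  have hε4 : ε ^ 4 ≤ 1 := pow_le_one₀ hε0.le hε1
  obtain ⟨k, hk1, hk2⟩ := exists_pow_mem hl1 hR
  obtain ⟨m, hm1, hm2⟩ := exists_pow_mem hl1 (X := 2 ^ 12 / ε ^ 4)
    (by rw [le_div_iff₀ (by positivity)]; linarith)
  have hkm : k + m ≤ L' := by
    have h1 : lam ^ (k + m) ≤ 2 ^ L' := by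
      rw [pow_add]
      calc lam ^ k * lam ^ m ≤ (lam * R) * (lam * (2 ^ 12 / ε ^ 4)) := by gcongr
        _ = R * 2 ^ 12 * lam ^ 2 / ε ^ 4 := by ring
        _ ≤ 2 ^ L' := by rw [div_le_iff₀ (by positivity)]; linarith
    have h2 : (2 : ℝ) ^ (k + m) ≤ 2 ^ L' := le_trans (by gcongr; linarith) h1
    exact (pow_le_pow_iff_right₀ (by norm_num)).mp h2
  obtain ⟨w₀, γ₀, h₀, hw₀, e₀, n₀⟩ := hfam.orbit i₀
  have e0 : 0 ≤ err := (abs_nonneg _).trans n₀.h00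
  set U : SL2R := upT (k * (Real.log lam / 2)) 0 with hU
  have hP : SysGT ε (U * (wordMat lam w₀ * g * intEmb γ₀)) := by
    have := (hno (w₀ ++ List.replicate k false) (by simp; omega)).mul_int γ₀
    rw [wordMat_append_replicate hl0] at this
    simpa only [mul_assoc] using this
  obtain ⟨p, q, tt, ht1, ht2, hv0, hv1, hv⟩ := hP.exists_vector hε0 hε1
  set P := U * (wordMat lam w₀ * g * intEmb γ₀) with hPdef
  have hΛ : 0 < lam ^ k := by positivity
  have hΛm : 0 < lam ^ m := by positivity
  refine ⟨t i₀ + tt / lam ^ k, ?_, ?_⟩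
  · rw [add_sub_cancel_left, abs_of_nonneg (by positivity)]
    gcongr
  intro i
  by_contra hcon
  push Not at hcon
  obtain ⟨w, γ, h, hw, e, nh⟩ := hfam.orbit i
  have herr1 : err ≤ 1 / 64 := by
    refine herr.trans ?_
    rw [div_le_div_iff₀ (by positivity) (by norm_num)]
    have h1 : 1 ≤ lam ^ 2 * R := one_le_mul_of_one_le_of_one_le (one_le_pow₀ hl1.le) hR
    have h2 : ε ^ 4 ≤ 1 := pow_le_one₀ hε0.le hε1
    linarith
  have hn := nh.mul_inv n₀ (hfam.bound i) (hfam.bound i₀) (by linarith)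
  set H := h * h₀⁻¹ with hH
  set y1 := H 0 0 * -(tt * (P 1 0 * p + P 1 1 * q)) + lam ^ k * H 0 1 * (P 1 0 * p + P 1 1 * q)
    with hy1
  set y2 := (lam ^ k)⁻¹ * H 1 0 * -(tt * (P 1 0 * p + P 1 1 * q)) + H 1 1 * (P 1 0 * p + P 1 1 * q)
    with hy2
  have hlat : upT (m * (Real.log lam / 2)) 0 * (U * (wordMat lam w * g * intEmb γ)) =
      upT (m * (Real.log lam / 2)) 0 * ((U * H * U⁻¹) * P) := by
    rw [hPdef, e, e₀, hH]
    group
  have hS : SysGT ε (upT (m * (Real.log lam / 2)) 0 * ((U * H * U⁻¹) * P)) := by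
    rw [← hlat]
    have := (hno (w ++ List.replicate k false ++ List.replicate m false)
      (by simp; omega)).mul_int γ
    rw [wordMat_append_replicate hl0, wordMat_append_replicate hl0] at this
    simpa only [mul_assoc] using this
  have hpq : p ≠ 0 ∨ q ≠ 0 := by
    by_contra hc
    push Not at hc
    rw [hc.1, hc.2] at hv0
    simp at hv0
  obtain ⟨u1, u2, u3, u4⟩ := upT_conj (k * (Real.log lam / 2)) 0 H
  rw [← hU] at u1 u2 u3 u4
  rw [exp_word hl0] at u2
  rw [Real.exp_neg, exp_word hl0] at u3
  have q1 : (upT (m * (Real.log lam / 2)) 0 * ((U * H * U⁻¹) * P)) 0 0 * p +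
      (upT (m * (Real.log lam / 2)) 0 * ((U * H * U⁻¹) * P)) 0 1 * q =
      Real.exp (m * (Real.log lam / 2)) * y1 := by
    rw [hy1, ← hv]
    simp only [SL2R.mul00 (upT _ _), SL2R.mul01 (upT _ _), SL2R.mul00 (U * H * U⁻¹),
      SL2R.mul01 (U * H * U⁻¹), u1, u2, upT.e00, upT.e01]
    ring
  have q2 : (upT (m * (Real.log lam / 2)) 0 * ((U * H * U⁻¹) * P)) 1 0 * p +
      (upT (m * (Real.log lam / 2)) 0 * ((U * H * U⁻¹) * P)) 1 1 * q =
      (Real.exp (m * (Real.log lam / 2)))⁻¹ * y2 := by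
    rw [hy2, ← hv, ← Real.exp_neg]
    simp only [SL2R.mul10 (upT _ _), SL2R.mul11 (upT _ _), SL2R.mul10 (U * H * U⁻¹),
      SL2R.mul11 (U * H * U⁻¹), u3, u4, upT.e10, upT.e11]
    ring
  have hS' := hS p q hpq
  rw [q1, q2] at hS'
  have hμ := exp_half_sq hl0 m
  have hμ0 := Real.exp_pos (m * (Real.log lam / 2))
  set μ := Real.exp (m * (Real.log lam / 2)) with hμdef
  set v := P 1 0 * p + P 1 1 * q with hvdef
  clear_value P H μ v
  have hμl : 64 / ε ^ 2 ≤ μ := by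
    rw [← sq_le_sq₀ (by positivity) hμ0.le, hμ]
    refine le_trans (le_of_eq ?_) hm1
    rw [div_pow]; ring
  have hμu : μ ≤ lam * (64 / ε ^ 2) := by
    rw [← sq_le_sq₀ hμ0.le (by positivity), hμ]
    refine hm2.trans ?_
    rw [mul_pow, div_pow]
    calc lam * (2 ^ 12 / ε ^ 4) ≤ lam ^ 2 * (2 ^ 12 / ε ^ 4) := by gcongr; exact le_self_pow₀ hl1.le two_ne_zero
      _ = _ := by ring
  obtain ⟨n1, n2, n3, n4⟩ := hn
  rcases hS' with hS' | hS'
  · apply absurd hS'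
    rw [not_lt, abs_mul, abs_of_pos hμ0]
    set r := ε ^ 4 / (2 ^ 12 * lam ^ 2 * R) with hr
    have herr' : err ≤ r / 64 := by
      refine herr.trans (le_of_eq ?_); rw [hr]; field_simp; norm_num
    have hb : |y1| ≤ 32 / ε * (lam * R * (2 * r)) := by
      have : y1 = v * (lam ^ k * (t i - (t i₀ + tt / lam ^ k)) + lam ^ k * (H 0 1 - (t i - t i₀)) -
          tt * (H 0 0 - 1)) := by
        rw [hy1]; field_simp; ring
      rw [this, abs_mul, abs_of_pos hv0]
      gcongr
      have d1 : |lam ^ k * (t i - (t i₀ + tt / lam ^ k))| ≤ lam ^ k * r := by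
        rw [abs_mul, abs_of_pos hΛ]; gcongr
      have d2 : |lam ^ k * (H 0 1 - (t i - t i₀))| ≤ lam ^ k * (8 * err) := by
        rw [abs_mul, abs_of_pos hΛ]; gcongr
      have d3 : |tt * (H 0 0 - 1)| ≤ lam ^ k * (16 * err) := by
        calc |tt * (H 0 0 - 1)| ≤ 2 * (8 * err) :=
              abs_mul_le_mul (by rw [abs_of_nonneg (by linarith)]; exact ht2) n1
          _ = 1 * (16 * err) := by ring
          _ ≤ _ := by gcongr; linarith
      have d4 : lam ^ k * (2 * r) ≤ lam * R * (2 * r) := by gcongr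
      have d5 : lam ^ k * err ≤ lam ^ k * (r / 64) := by gcongr
      have d6 : 0 ≤ lam ^ k * r := by positivity
      rw [abs_le] at *
      constructor <;> linarith
    calc μ * |y1| ≤ lam * (64 / ε ^ 2) * (32 / ε * (lam * R * (2 * r))) := by gcongr
      _ = ε := by rw [hr]; field_simp; norm_num
  · apply absurd hS'
    rw [not_lt, abs_mul, abs_of_pos (by positivity)]
    have hb : |y2| ≤ 2 * (32 / ε) := by
      have hk' : (lam ^ k)⁻¹ ≤ 1 := inv_le_one_of_one_le₀ (hR.trans hk1)
      have : y2 = v * (H 1 1 - (lam ^ k)⁻¹ * (tt * H 1 0)) := by rw [hy2]; ring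
      rw [this, abs_mul, abs_of_pos hv0, mul_comm (2 : ℝ)]
      gcongr
      have d1 : |(lam ^ k)⁻¹ * (tt * H 1 0)| ≤ 1 * (2 * (8 * err)) := by
        apply abs_mul_le_mul
        · rw [abs_of_pos (by positivity)]; exact hk'
        · exact abs_mul_le_mul (by rw [abs_of_nonneg (by linarith)]; exact ht2) n3
      rw [abs_le] at *
      constructor <;> linarith
    calc μ⁻¹ * |y2| ≤ (64 / ε ^ 2)⁻¹ * (2 * (32 / ε)) := by gcongr
      _ = ε := by field_simp; norm_num

/-- All binary words of length `n`. -/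
def binWords (n : ℕ) : Finset (List Bool) :=
  (Finset.univ : Finset (Fin n → Bool)).map ⟨List.ofFn, List.ofFn_injective⟩

theorem mem_binWords {n : ℕ} {w : List Bool} : w ∈ binWords n ↔ w.length = n := by
  simp only [binWords, Finset.mem_map, Finset.mem_univ, true_and, Function.Embedding.coeFn_mk]
  constructor
  · rintro ⟨f, rfl⟩; simp
  · rintro rfl
    exact ⟨fun i => w.get i, List.ofFn_get w⟩

theorem card_binWords (n : ℕ) : (binWords n).card = 2 ^ n := by
  simp [binWords]

theorem abs_sub_lt_of_floor_eq {x y s : ℝ} (hs : 0 < s) (h : ⌊x / s⌋ = ⌊y / s⌋) :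
    |x - y| ≤ s := by
  have := Int.abs_sub_lt_one_of_floor_eq_floor h
  rw [← sub_div, abs_div, abs_of_pos hs, div_lt_one hs] at this
  exact this.le

theorem exists_close_returns {lam ε η : ℝ} (h8 : 8 ≤ lam) (hε0 : 0 < ε) (hε1 : ε ≤ 1)
    (hη0 : 0 < η) (hη1 : η ≤ 1 / 16) {n b : ℕ} {P : SL2R} (hP : SysGT ε P)
    (hε : 16 ≤ ε ^ 2 * lam ^ n)
    (hw : ∀ w : List Bool, w.length = n →
      SysGT ε (wordMat lam w * (upT (n * (Real.log lam / 2)) 0 * P)))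
    (hb : 32 / (η * ε ^ 2) ≤ b) :
    ∃ (W : Finset (List Bool)) (M : List Bool → SL2R), 2 ^ n ≤ b ^ 4 * W.card ∧
      (∀ w ∈ W, w.length = n ∧ ∃ γ : SL2Z,
        M w = wordMat lam w * (upT (n * (Real.log lam / 2)) 0 * P) * intEmb γ) ∧
      ∀ w ∈ W, ∀ w' ∈ W, NearU (M w * (M w')⁻¹) 0 η ∧
        (w ≠ w' → 1 ≤ lam ^ (3 * n) * |(M w * (M w')⁻¹) 1 0|) := by
  classical
  have hred : ∀ w : List Bool, ∃ M : SL2R, w.length = n →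
      ((∃ γ : SL2Z, M = wordMat lam w * (upT (n * (Real.log lam / 2)) 0 * P) * intEmb γ) ∧
      ∀ i j, |M i j| ≤ 2 / ε) := by
    intro w
    by_cases h : w.length = n
    · obtain ⟨γ, hγ⟩ := (hw w h).exists_reduced hε0 hε1
      exact ⟨_, fun _ => ⟨⟨γ, rfl⟩, hγ⟩⟩
    · exact ⟨1, fun h' => absurd h' h⟩
  choose M hM using hred
  set s := η * ε / 4 with hs
  have hs0 : 0 < s := by positivity
  set K : ℤ := ⌈8 / (η * ε ^ 2)⌉ with hK
  have hK1 : 8 / (η * ε ^ 2) ≤ K := Int.le_ceil _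
  have hK0 : 0 ≤ K := by
    have : (0 : ℝ) ≤ K := le_trans (by positivity) hK1
    exact_mod_cast this
  let f : List Bool → (Fin 2 × Fin 2 → ℤ) := fun w ij => ⌊M w ij.1 ij.2 / s⌋
  let T : Finset (Fin 2 × Fin 2 → ℤ) := Fintype.piFinset fun _ => Finset.Icc (-K) K
  have hmaps : ∀ w ∈ binWords n, f w ∈ T := by
    intro w hwn
    rw [Fintype.mem_piFinset]
    intro ij
    have h1 := (hM w (mem_binWords.mp hwn)).2 ij.1 ij.2
    have h2 : |M w ij.1 ij.2 / s| ≤ 8 / (η * ε ^ 2) := by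
      rw [abs_div, abs_of_pos hs0, div_le_iff₀ hs0]
      refine h1.trans (le_of_eq ?_)
      rw [hs]; field_simp; norm_num
    rw [abs_le] at h2
    rw [Finset.mem_Icc]
    constructor
    · rw [Int.le_floor]; push_cast; linarith
    · have : ((⌊M w ij.1 ij.2 / s⌋ : ℤ) : ℝ) ≤ K := (Int.floor_le _).trans (h2.2.trans hK1)
      exact_mod_cast this
  have hT : T.card ≤ b ^ 4 := by
    have : T.card = (2 * K + 1).toNat ^ 4 := by
      simp only [T, Fintype.card_piFinset, Int.card_Icc, Finset.prod_const, Finset.card_univ,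
        Fintype.card_prod, Fintype.card_fin]
      congr 2; ring
    rw [this]
    gcongr
    have hk : (K : ℝ) ≤ 8 / (η * ε ^ 2) + 1 := (Int.ceil_lt_add_one _).le
    have h1 : (1 : ℝ) ≤ 1 / (η * ε ^ 2) := by
      rw [le_div_iff₀ (by positivity)]
      have : ε ^ 2 ≤ 1 := pow_le_one₀ hε0.le hε1
      nlinarith
    have e1 : 8 / (η * ε ^ 2) = 8 * (1 / (η * ε ^ 2)) := by ring
    have e2 : 32 / (η * ε ^ 2) = 32 * (1 / (η * ε ^ 2)) := by ring
    rw [e1] at hk; rw [e2] at hb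
    have : ((2 * K + 1 : ℤ) : ℝ) ≤ ((b : ℤ) : ℝ) := by push_cast; linarith
    have := Int.cast_le.mp this
    omega
  have hTn : T.Nonempty := ⟨_, hmaps _ (mem_binWords.mpr (List.length_replicate (n := n) (a := false)))⟩
  obtain ⟨y, hyT, hy⟩ := Finset.exists_max_image T
    (fun y => ((binWords n).filter (fun w => f w = y)).card) hTn
  refine ⟨(binWords n).filter (fun w => f w = y), M, ?_, ?_, ?_⟩
  · rw [← card_binWords n]
    refine (Finset.card_le_mul_card_image_of_maps_to hmaps _ (fun z hz => hy z hz)).trans ?_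
    rw [mul_comm]
    gcongr
  · intro w hwW
    rw [Finset.mem_filter, mem_binWords] at hwW
    exact ⟨hwW.1, (hM w hwW.1).1⟩
  intro w hwW w' hwW'
  rw [Finset.mem_filter, mem_binWords] at hwW hwW'
  obtain ⟨⟨γ, hγ⟩, hB⟩ := hM w hwW.1
  obtain ⟨⟨γ', hγ'⟩, hB'⟩ := hM w' hwW'.1
  have hclose : ∀ i j, |M w i j - M w' i j| ≤ s := fun i j =>
    abs_sub_lt_of_floor_eq hs0 (congrFun (hwW.2.trans hwW'.2.symm) (i, j))
  have hpr : ∀ i j i' j', |(M w i j - M w' i j) * M w' i' j'| ≤ η / 2 := by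
    intro i j i' j'
    refine (abs_mul_le_mul (hclose i j) (hB' i' j')).trans (le_of_eq ?_)
    rw [hs]; field_simp; norm_num
  have hd := SL2R.det_eq (M w')
  have hN : NearU (M w * (M w')⁻¹) 0 η := by
    constructor
    · have p1 := hpr 0 0 1 1
      have p2 := hpr 0 1 1 0
      simp only [SL2R.mul00, SL2R.inv00, SL2R.inv10, abs_le] at *
      constructor <;> linarith
    · have p1 := hpr 0 0 0 1
      have p2 := hpr 0 1 0 0
      simp only [SL2R.mul01, SL2R.inv01, SL2R.inv11, abs_le] at *
      constructor <;> linarith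
    · have p1 := hpr 1 0 1 1
      have p2 := hpr 1 1 1 0
      simp only [SL2R.mul10, SL2R.inv00, SL2R.inv10, abs_le] at *
      constructor <;> linarith
    · have p1 := hpr 1 0 0 1
      have p2 := hpr 1 1 0 0
      simp only [SL2R.mul11, SL2R.inv01, SL2R.inv11, abs_le] at *
      constructor <;> linarith
  refine ⟨hN, fun hne => ?_⟩
  refine one_le_of_close_returns h8 hε0 hP hε hε1 hwW.1 hwW'.1 hne (γ := γ) (γ' := γ') ?_
    (hN.h00.trans hη1) ?_ (hN.h11.trans hη1)
  · rw [← hγ, ← hγ', inv_mul_cancel_right]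
  · have := hN.h01
    rw [sub_zero] at this
    exact this.trans hη1

theorem exists_branching {α β : Type} [DecidableEq β] (S : Finset α) (φ : ℕ → α → β)
    {j₀ J c B : ℕ} (hJ : j₀ ≤ J) (h0 : (S.image (φ j₀)).card ≤ c)
    (h1 : c * B ^ (J - j₀) < (S.image (φ J)).card) :
    ∃ j, j₀ ≤ j ∧ j < J ∧ ∃ y, B < ((S.filter (fun i => φ j i = y)).image (φ (j + 1))).card := by
  by_contra hcon
  push Not at hcon
  have key : ∀ k, j₀ + k ≤ J → (S.image (φ (j₀ + k))).card ≤ c * B ^ k := by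
    intro k
    induction k with
    | zero => intro _; simpa using h0
    | succ k ih =>
      intro hk
      have : S.image (φ (j₀ + (k + 1))) ⊆ (S.image (φ (j₀ + k))).biUnion
          (fun y => (S.filter (fun i => φ (j₀ + k) i = y)).image (φ (j₀ + k + 1))) := by
        intro z hz
        obtain ⟨i, hi, rfl⟩ := Finset.mem_image.mp hz
        rw [Finset.mem_biUnion]
        exact ⟨_, Finset.mem_image_of_mem _ hi,
          Finset.mem_image.mpr ⟨i, Finset.mem_filter.mpr ⟨hi, rfl⟩, rfl⟩⟩
      refine (Finset.card_le_card this).trans ?_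
      refine (Finset.card_biUnion_le_card_mul _ _ B
        (fun y _ => hcon _ (by omega) (by omega) y)).trans ?_
      rw [pow_succ, ← mul_assoc]
      gcongr
      exact ih (by omega)
  have := key (J - j₀) (by omega)
  rw [Nat.add_sub_cancel' hJ] at this
  omega

theorem exists_large_fiber_of_pairs {α β : Type} [DecidableEq β] (F : Finset α) (f g : α → β)
    {b : ℕ} (h : b * b < (F.image (fun i => (f i, g i))).card) :
    b < (F.image g).card ∨ ∃ y, b < ((F.filter (fun i => g i = y)).image f).card := by
  by_contra hcon
  push Not at hcon
  obtain ⟨h1, h2⟩ := hcon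
  have : F.image (fun i => (f i, g i)) ⊆ (F.image g).biUnion
      (fun y => ((F.filter (fun i => g i = y)).image f).image (fun x => (x, y))) := by
    intro z hz
    obtain ⟨i, hi, rfl⟩ := Finset.mem_image.mp hz
    rw [Finset.mem_biUnion]
    exact ⟨_, Finset.mem_image_of_mem _ hi, Finset.mem_image_of_mem _
      (Finset.mem_image.mpr ⟨i, Finset.mem_filter.mpr ⟨hi, rfl⟩, rfl⟩)⟩
  have h3 := (Finset.card_le_card this).trans (Finset.card_biUnion_le_card_mul _ _ b
        (fun y _ => Finset.card_image_le.trans (h2 y)))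
  have : (F.image g).card * b ≤ b * b := by gcongr
  omega

theorem exists_sparse_subset {α : Type} (F : Finset α) (f : α → ℤ) {b : ℕ}
    (h : b < (F.image f).card) :
    ∃ I ⊆ F, b < 8 * I.card ∧ ∀ i ∈ I, ∀ i' ∈ I, i ≠ i' → 8 ≤ |f i - f i'| := by
  classical
  obtain ⟨r, hr⟩ : ∃ r ∈ Finset.Ico (0 : ℤ) 8,
      b < 8 * ((F.image f).filter (fun z => z % 8 = r)).card := by
    by_contra hcon
    push Not at hcon
    have h1 : ∀ z ∈ F.image f, z % 8 ∈ Finset.Ico (0 : ℤ) 8 := by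
      intro z _
      rw [Finset.mem_Ico]
      exact ⟨Int.emod_nonneg _ (by norm_num), Int.emod_lt_of_pos _ (by norm_num)⟩
    have h2 := Finset.card_eq_sum_card_fiberwise h1
    have h3 : 8 * (F.image f).card ≤ 8 * b := by
      rw [h2, Finset.mul_sum]
      refine (Finset.sum_le_sum hcon).trans ?_
      simp
    omega
  have hsec : ∀ z : ℤ, ∃ i : α, z ∈ F.image f → i ∈ F ∧ f i = z := by
    intro z
    by_cases hz : z ∈ F.image f
    · obtain ⟨i, hi⟩ := Finset.mem_image.mp hz
      exact ⟨i, fun _ => hi⟩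
    · obtain ⟨z', hz'⟩ : (F.image f).Nonempty := Finset.card_pos.mp (by omega)
      obtain ⟨i, _⟩ := Finset.mem_image.mp hz'
      exact ⟨i, fun h => absurd h hz⟩
  choose sec hsec using hsec
  set G := (F.image f).filter (fun z => z % 8 = r) with hG
  have hGm : ∀ z ∈ G, z ∈ F.image f ∧ z % 8 = r := fun z hz => Finset.mem_filter.mp hz
  refine ⟨G.image sec, ?_, ?_, ?_⟩
  · intro i hi
    obtain ⟨z, hz, rfl⟩ := Finset.mem_image.mp hi
    exact (hsec z (hGm z hz).1).1
  · rw [Finset.card_image_of_injOn]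
    · exact hr.2
    · intro z hz z' hz' he
      rw [← (hsec z (hGm z hz).1).2, ← (hsec z' (hGm z' hz').1).2, he]
  · intro i hi i' hi' hne
    obtain ⟨z, hz, rfl⟩ := Finset.mem_image.mp hi
    obtain ⟨z', hz', rfl⟩ := Finset.mem_image.mp hi'
    have hzz : z ≠ z' := fun h => hne (by rw [h])
    rw [(hsec z (hGm z hz).1).2, (hsec z' (hGm z' hz').1).2]
    have e1 := (hGm z hz).2
    have e2 := (hGm z' hz').2
    rw [le_abs]
    omega

theorem le_abs_sub_of_floor {x y s : ℝ} (hs : 0 < s) (h : 8 ≤ |⌊x / s⌋ - ⌊y / s⌋|) :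
    7 * s ≤ |x - y| := by
  have e : |x - y| = s * |x / s - y / s| := by
    rw [← sub_div, abs_div, abs_of_pos hs]; field_simp
  rw [e, mul_comm]
  gcongr
  have h' : (8 : ℝ) ≤ |(⌊x / s⌋ : ℝ) - ⌊y / s⌋| := by exact_mod_cast h
  have a1 := Int.floor_le (x / s)
  have a2 := Int.lt_floor_add_one (x / s)
  have a3 := Int.floor_le (y / s)
  have a4 := Int.lt_floor_add_one (y / s)
  rw [le_abs] at *
  rcases h' with h' | h'
  · left; linarith
  · right; linarith

/-- Linearisation of `h₀₀` at the identity. -/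
theorem abs_diag_defect_le {h : SL2R} {η ρ : ℝ} (hη : η ≤ 1 / 16) (hρ : ρ ≤ η)
    (h01 : |h 0 1| ≤ η) (h10 : |h 1 0| ≤ 2 * ρ) (h11 : |h 1 1 - 1| ≤ 2 * ρ) :
    |h 0 0 - 1 + (h 1 1 - 1)| ≤ 7 * (η * ρ) := by
  have hd := SL2R.det_eq h
  have ρ0 : 0 ≤ ρ := by linarith [abs_nonneg (h 1 0)]
  have e1 := abs_mul_le_mul h01 h10
  have e2 := abs_mul_le_mul h11 h11
  have e3 : (h 0 0 - 1 + (h 1 1 - 1)) * h 1 1 = h 0 1 * h 1 0 + (h 1 1 - 1) * (h 1 1 - 1) := by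
    linear_combination hd
  have e4 : 7 / 8 ≤ |h 1 1| := by
    rw [le_abs]; left
    have := (abs_le.mp h11).1
    linarith
  have e5 : |h 0 0 - 1 + (h 1 1 - 1)| * |h 1 1| ≤ 6 * (η * ρ) := by
    rw [← abs_mul, e3]
    refine (abs_add_le _ _).trans ?_
    have : ρ * ρ ≤ η * ρ := by gcongr
    linarith
  have e6 : |h 0 0 - 1 + (h 1 1 - 1)| * (7 / 8) ≤ |h 0 0 - 1 + (h 1 1 - 1)| * |h 1 1| := by
    gcongr
  have : 0 ≤ η * ρ := mul_nonneg (by linarith) ρ0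
  linarith

theorem exists_separated_slopes {S : Finset (List Bool)} {M : List Bool → SL2R} {Q j₀ J b : ℕ}
    {η δ : ℝ} (hη : η = (2 ^ (j₀ * Q))⁻¹) (hη1 : η ≤ 1 / 16) (hη2 : 2 ^ Q * η ≤ 1 / 64)
    (hJ : j₀ ≤ J)
    (hnear : ∀ w ∈ S, ∀ w' ∈ S, NearU (M w * (M w')⁻¹) 0 η)
    (hsep : ∀ w ∈ S, ∀ w' ∈ S, w ≠ w' → δ ≤ |(M w * (M w')⁻¹) 1 0|)
    (hδ : 2 * (2 ^ (J * Q) : ℝ)⁻¹ < δ) (hcard : 9 * (b * b) ^ (J - j₀) < S.card) :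
    ∃ j, j₀ ≤ j ∧ j < J ∧ ∃ I ⊆ S, ∃ i₀ ∈ I, ∃ s : ℝ, (s = 0 ∨ s = 1) ∧ b < 8 * I.card ∧
      (∀ i ∈ I, |(M i * (M i₀)⁻¹) 0 0 - 1| ≤ 4 * (2 ^ (j * Q))⁻¹ ∧
        |(M i * (M i₀)⁻¹) 1 1 - 1| ≤ 4 * (2 ^ (j * Q))⁻¹ ∧
        |(M i * (M i₀)⁻¹) 1 0| ≤ 4 * (2 ^ (j * Q))⁻¹) ∧
      ∀ i ∈ I, ∀ i' ∈ I, i ≠ i' → (2 ^ ((j + 1) * Q))⁻¹ ≤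
        |((M i * (M i₀)⁻¹) 0 0 - (M i * (M i₀)⁻¹) 1 1 - 2 * s * (M i * (M i₀)⁻¹) 1 0) -
        ((M i' * (M i₀)⁻¹) 0 0 - (M i' * (M i₀)⁻¹) 1 1 - 2 * s * (M i' * (M i₀)⁻¹) 1 0)| := by
  classical
  have hη0 : 0 < η := by rw [hη]; positivity
  obtain ⟨w₀, hw₀⟩ : S.Nonempty := Finset.card_pos.mp (by omega)
  set H : List Bool → SL2R := fun w => M w * (M w₀)⁻¹ with hH
  have hrel : ∀ w w', M w * (M w')⁻¹ = H w * (H w')⁻¹ := by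
    intro w w'; simp [hH]
  have hHn : ∀ w ∈ S, NearU (H w) 0 η := fun w hw => hnear w hw w₀ hw₀
  set ρ : ℕ → ℝ := fun j => (2 ^ (j * Q))⁻¹ with hρ
  have hρ0 : ∀ j, 0 < ρ j := fun j => by simp only [hρ]; positivity
  let φ : ℕ → List Bool → ℤ × ℤ := fun j w => (⌊H w 1 0 / ρ j⌋, ⌊(H w 1 1 - 1) / ρ j⌋)
  have hφ : ∀ j w w', φ j w = φ j w' →
      |H w 1 0 - H w' 1 0| ≤ ρ j ∧ |H w 1 1 - H w' 1 1| ≤ ρ j := by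
    intro j w w' h
    have h1 := abs_sub_lt_of_floor_eq (hρ0 j) (congrArg Prod.fst h)
    have h2 := abs_sub_lt_of_floor_eq (hρ0 j) (congrArg Prod.snd h)
    refine ⟨h1, ?_⟩
    simpa using h2
  have hc0 : (S.image (φ j₀)).card ≤ 9 := by
    have : S.image (φ j₀) ⊆ (Finset.Icc (-1 : ℤ) 1) ×ˢ (Finset.Icc (-1 : ℤ) 1) := by
      intro z hz
      obtain ⟨w, hw, rfl⟩ := Finset.mem_image.mp hz
      have key : ∀ x : ℝ, |x| ≤ η → ⌊x / ρ j₀⌋ ∈ Finset.Icc (-1 : ℤ) 1 := by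
        intro x hx
        have : |x / ρ j₀| ≤ 1 := by
          rw [abs_div, abs_of_pos (hρ0 _), div_le_one (hρ0 _)]
          simp only [hρ, ← hη]; exact hx
        rw [abs_le] at this
        rw [Finset.mem_Icc]
        constructor
        · rw [Int.le_floor]; push_cast; linarith
        · rw [← Int.lt_add_one_iff, Int.floor_lt]; push_cast; linarith
      exact Finset.mem_product.mpr ⟨key _ (hHn w hw).h10, key _ (hHn w hw).h11⟩
    refine (Finset.card_le_card this).trans ?_
    simp
  have hcJ : (S.image (φ J)).card = S.card := by
    apply Finset.card_image_of_injOn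
    intro w hw w' hw' he
    by_contra hne
    obtain ⟨h1, h2⟩ := hφ J w w' he
    have h3 := hsep w hw w' hw' hne
    rw [hrel, SL2R.mul10, SL2R.inv00, SL2R.inv10] at h3
    obtain ⟨-, -, n3, n4⟩ := hHn w' hw'
    have p1 := abs_mul_le_mul h1 n4
    have p2 := abs_mul_le_mul h2 n3
    have : H w 1 0 * H w' 1 1 + H w 1 1 * -H w' 1 0 = (H w 1 0 - H w' 1 0) +
      (H w 1 0 - H w' 1 0) * (H w' 1 1 - 1) - (H w 1 1 - H w' 1 1) * H w' 1 0 := by ring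
    have hs : ρ J * η ≤ ρ J * (1 / 16) := by have := hρ0 J; gcongr
    have hδ' : 2 * ρ J < δ := hδ
    have h4 : |H w 1 0 * H w' 1 1 + H w 1 1 * -H w' 1 0| ≤ 2 * ρ J := by
      have := hρ0 J
      rw [abs_le] at *
      constructor <;> linarith
    linarith
  obtain ⟨j, hj1, hj2, y, hy⟩ := exists_branching S φ hJ hc0 (by rw [hcJ]; exact hcard)
  refine ⟨j, hj1, hj2, ?_⟩
  set F := S.filter (fun i => φ j i = y) with hF
  have hFS : ∀ i ∈ F, i ∈ S := fun i hi => (Finset.mem_filter.mp hi).1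
  have hFd : ∀ i ∈ F, ∀ i' ∈ F, |H i 1 0 - H i' 1 0| ≤ ρ j ∧ |H i 1 1 - H i' 1 1| ≤ ρ j :=
    fun i hi i' hi' => hφ j i i'
      ((Finset.mem_filter.mp hi).2.trans (Finset.mem_filter.mp hi').2.symm)
  have hρη : ρ j ≤ η := by
    simp only [hρ, hη]
    gcongr
    norm_num
  set r := ρ (j + 1) with hr
  have hr0 : 0 < r := hρ0 _
  have hrρ : ρ j = 2 ^ Q * r := by
    simp only [hr, hρ, add_mul, one_mul, pow_add]
    field_simp
  have hηρ : η * ρ j ≤ 1 / 64 * r := by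
    rw [hrρ, ← mul_assoc, mul_comm η]; gcongr
  have hηr : η * r ≤ 1 / 16 * r := by gcongr
  have hbase : ∀ i₀ ∈ F, ∀ i ∈ F, |(M i * (M i₀)⁻¹) 1 0| ≤ 2 * ρ j ∧
      |(M i * (M i₀)⁻¹) 1 1 - 1| ≤ 2 * ρ j ∧
      |(M i * (M i₀)⁻¹) 0 0 - 1 + ((M i * (M i₀)⁻¹) 1 1 - 1)| ≤ 7 * (η * ρ j) := by
    intro i₀ hi₀ i hi
    obtain ⟨d1, d2⟩ := hFd i hi i₀ hi₀
    obtain ⟨n1, n2, n3, n4⟩ := hHn i₀ (hFS _ hi₀)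
    rw [sub_zero] at n2
    have hd := SL2R.det_eq (H i₀)
    have p1 := abs_mul_le_mul d1 n4
    have p2 := abs_mul_le_mul d2 n3
    have p3 := abs_mul_le_mul d2 n1
    have p4 := abs_mul_le_mul d1 n2
    have q1 : ρ j * η ≤ ρ j * (1 / 16) := by have := hρ0 j; gcongr
    have q2 := hρ0 j
    have g1 : |(M i * (M i₀)⁻¹) 1 0| ≤ 2 * ρ j := by
      rw [hrel, SL2R.mul10, SL2R.inv00, SL2R.inv10]
      simp only [abs_le] at *
      constructor <;> linarith
    have g2 : |(M i * (M i₀)⁻¹) 1 1 - 1| ≤ 2 * ρ j := by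
      rw [hrel, SL2R.mul11, SL2R.inv01, SL2R.inv11]
      simp only [abs_le] at *
      constructor <;> linarith
    have n := (hnear i (hFS _ hi) i₀ (hFS _ hi₀)).h01
    rw [sub_zero] at n
    exact ⟨g1, g2, abs_diag_defect_le hη1 hρη n g1 g2⟩
  have hbase' : ∀ i₀ ∈ F, ∀ i ∈ F, |(M i * (M i₀)⁻¹) 0 0 - 1| ≤ 4 * (2 ^ (j * Q))⁻¹ ∧
        |(M i * (M i₀)⁻¹) 1 1 - 1| ≤ 4 * (2 ^ (j * Q))⁻¹ ∧
        |(M i * (M i₀)⁻¹) 1 0| ≤ 4 * (2 ^ (j * Q))⁻¹ := by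
    intro i₀ hi₀ i hi
    obtain ⟨g1, g2, g3⟩ := hbase i₀ hi₀ i hi
    have q1 : η * ρ j ≤ 1 / 16 * ρ j := by have := hρ0 j; gcongr
    have q2 := hρ0 j
    have e : ρ j = (2 ^ (j * Q))⁻¹ := rfl
    rw [← e]
    simp only [abs_le] at *
    refine ⟨⟨?_, ?_⟩, ⟨?_, ?_⟩, ⟨?_, ?_⟩⟩ <;> linarith
  have hdiff : ∀ i₀ ∈ F, ∀ i ∈ F, ∀ i' ∈ F, ∀ s : ℝ, (s = 0 ∨ s = 1) →
      |(H i 1 1 - H i' 1 1) + s * (H i 1 0 - H i' 1 0)| ≥ 6 * r → r ≤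
        |((M i * (M i₀)⁻¹) 0 0 - (M i * (M i₀)⁻¹) 1 1 - 2 * s * (M i * (M i₀)⁻¹) 1 0) -
        ((M i' * (M i₀)⁻¹) 0 0 - (M i' * (M i₀)⁻¹) 1 1 - 2 * s * (M i' * (M i₀)⁻¹) 1 0)| := by
    intro i₀ hi₀ i hi i' hi' s hs h6
    obtain ⟨-, -, g3⟩ := hbase i₀ hi₀ i hi
    obtain ⟨-, -, g3'⟩ := hbase i₀ hi₀ i' hi'
    obtain ⟨d1, d2⟩ := hFd i hi i' hi'
    obtain ⟨n1, n2, n3, n4⟩ := hHn i₀ (hFS _ hi₀)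
    rw [sub_zero] at n2
    have p1 := abs_mul_le_mul d1 n4
    have p2 := abs_mul_le_mul d2 n3
    have p3 := abs_mul_le_mul d2 n1
    have p4 := abs_mul_le_mul d1 n2
    rw [hrel, hrel] at *
    simp only [SL2R.mul10, SL2R.mul11, SL2R.inv00, SL2R.inv10, SL2R.inv01, SL2R.inv11] at *
    generalize (H i * (H i₀)⁻¹) 0 0 = A at *
    generalize (H i' * (H i₀)⁻¹) 0 0 = A' at *
    simp only [abs_le] at g3 g3' p1 p2 p3 p4
    rw [ge_iff_le, le_abs] at h6
    rw [le_abs]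
    rcases hs with rfl | rfl <;> rcases h6 with h6 | h6
    · right; linarith
    · left; linarith
    · right; linarith
    · left; linarith
  rcases exists_large_fiber_of_pairs F (fun i => ⌊H i 1 0 / ρ (j + 1)⌋)
    (fun i => ⌊(H i 1 1 - 1) / ρ (j + 1)⌋) hy with hb | ⟨z, hz⟩
  · obtain ⟨I, hIF, hIb, hI⟩ := exists_sparse_subset F _ hb
    obtain ⟨i₀, hi₀⟩ : I.Nonempty := Finset.card_pos.mp (by omega)
    refine ⟨I, fun i hi => hFS i (hIF hi), i₀, hi₀, 0, Or.inl rfl, hIb,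
      fun i hi => hbase' i₀ (hIF hi₀) i (hIF hi), fun i hi i' hi' hne => ?_⟩
    refine hdiff i₀ (hIF hi₀) i (hIF hi) i' (hIF hi') 0 (Or.inl rfl) ?_
    have h7 := le_abs_sub_of_floor hr0 (hI i hi i' hi' hne)
    rw [zero_mul, add_zero]
    rw [sub_sub_sub_cancel_right] at h7
    linarith
  · obtain ⟨I, hIF, hIb, hI⟩ := exists_sparse_subset _ _ hz
    obtain ⟨i₀, hi₀⟩ : I.Nonempty := Finset.card_pos.mp (by omega)
    have hIF' : ∀ i ∈ I, i ∈ F := fun i hi => (Finset.mem_filter.mp (hIF hi)).1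
    refine ⟨I, fun i hi => hFS i (hIF' i hi), i₀, hi₀, 1, Or.inr rfl, hIb,
      fun i hi => hbase' i₀ (hIF' _ hi₀) i (hIF' _ hi), fun i hi i' hi' hne => ?_⟩
    have h7 := le_abs_sub_of_floor hr0 (hI i hi i' hi' hne)
    have h8 := abs_sub_lt_of_floor_eq hr0 ((Finset.mem_filter.mp (hIF hi)).2.trans
      (Finset.mem_filter.mp (hIF hi')).2.symm)
    rw [sub_sub_sub_cancel_right] at h8
    refine hdiff i₀ (hIF' _ hi₀) i (hIF' _ hi) i' (hIF' _ hi') 1 (Or.inr rfl) ?_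
    rw [one_mul]
    rw [abs_le] at h8
    rw [ge_iff_le, le_abs]
    rw [le_abs] at h7
    rcases h7 with h7 | h7
    · left; linarith
    · right; linarith

/-- Weight equal to `1` near integers and to `κ` elsewhere. -/
noncomputable def nearWeight (κ d x : ℝ) : ℝ := if |x - round x| ≤ d then 1 else κ

/-- Product of the weights of `x / lam ^ j`, `j < m`. -/
noncomputable def nearProd (lam κ d : ℝ) (m : ℕ) (x : ℝ) : ℝ :=
  ∏ j ∈ Finset.range m, nearWeight κ d (x / lam ^ j)

theorem nearWeight_nonneg {κ d x : ℝ} (hκ : 0 ≤ κ) : 0 ≤ nearWeight κ d x := by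
  unfold nearWeight; split_ifs <;> linarith

theorem nearProd_nonneg {lam κ d : ℝ} (hκ : 0 ≤ κ) (m : ℕ) (x : ℝ) :
    0 ≤ nearProd lam κ d m x :=
  Finset.prod_nonneg fun _ _ => nearWeight_nonneg hκ

theorem nearProd_succ (lam κ d : ℝ) (m : ℕ) (x : ℝ) :
    nearProd lam κ d (m + 1) x = nearProd lam κ d m x * nearWeight κ d (x / lam ^ m) :=
  Finset.prod_range_succ _ _

/-- The part of `Y` lying, after rescaling by `lam ^ m`, within `δ` of `N`. -/
noncomputable def nearPart (lam : ℝ) (Y : Finset ℝ) (m : ℕ) (N : ℤ) (δ : ℝ) : Finset ℝ :=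
  Y.filter fun x => |x / lam ^ m - N| ≤ δ

theorem card_le_of_separated {Y : Finset ℝ} (hY : ∀ x ∈ Y, ∀ y ∈ Y, x ≠ y → 1 ≤ |x - y|) (a : ℝ)
    {k : ℕ} (h : ∀ x ∈ Y, a ≤ x ∧ x < a + k) : Y.card ≤ k := by
  have hmaps : ∀ x ∈ Y, ⌊x - a⌋ ∈ Finset.Ico (0 : ℤ) k := by
    intro x hx
    obtain ⟨h1, h2⟩ := h x hx
    rw [Finset.mem_Ico, Int.le_floor, Int.floor_lt]
    push_cast
    constructor <;> linarith
  have := Finset.card_le_card_of_injOn (fun x => ⌊x - a⌋) hmaps (by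
    intro x hx y hy he
    by_contra hne
    have h1 := Int.abs_sub_lt_one_of_floor_eq_floor he
    rw [sub_sub_sub_cancel_right] at h1
    linarith [hY x hx y hy hne])
  simpa using this

theorem card_Icc_ceil_floor_le {a b : ℝ} (h : a ≤ b) :
    ((Finset.Icc ⌈a⌉ ⌊b⌋).card : ℝ) ≤ b - a + 1 := by
  rw [Int.card_Icc]
  have h1 := Int.le_ceil a
  have h2 := Int.floor_le b
  have : ((⌊b⌋ + 1 - ⌈a⌉).toNat : ℝ) = max ((⌊b⌋ + 1 - ⌈a⌉ : ℤ) : ℝ) 0 := by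
    have := Int.toNat_eq_max (⌊b⌋ + 1 - ⌈a⌉)
    have h3 : (((⌊b⌋ + 1 - ⌈a⌉).toNat : ℤ) : ℝ) = ((max (⌊b⌋ + 1 - ⌈a⌉) 0 : ℤ) : ℝ) := by
      rw [this]
    rw [Int.cast_natCast] at h3
    rw [h3, Int.cast_max, Int.cast_zero]
  rw [this]
  apply max_le
  · push_cast; linarith
  · linarith

set_option maxHeartbeats 3200000 in
theorem sum_nearProd_le {lam κ ρ : ℝ} (h8 : 8 ≤ lam) {Y : Finset ℝ}
    (hY : ∀ x ∈ Y, ∀ y ∈ Y, x ≠ y → 1 ≤ |x - y|) (hκ : 0 ≤ κ) (hκ1 : κ * (2 * (lam + 2)) ≤ 1)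
    (hρ : 1 + κ * (lam + 2) * (2 * (lam + 2)) ≤ ρ) (m : ℕ) : ∀ N : ℤ,
    (∑ x ∈ nearPart lam Y m N (1 / 2), nearProd lam κ (1 / (4 * (lam + 1))) m x ≤
        2 * (lam + 2) * ρ ^ m) ∧
      ∑ x ∈ nearPart lam Y m N (1 / (4 * (lam + 1))), nearProd lam κ (1 / (4 * (lam + 1))) m x ≤
        ρ ^ m := by
  set d := 1 / (4 * (lam + 1)) with hd
  have hd0 : 0 < d := by rw [hd]; positivity
  have hd1 : d ≤ 1 / 36 := by
    rw [hd]; apply one_div_le_one_div_of_le <;> linarith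
  have hdl : (lam + 1) * d = 1 / 4 := by rw [hd]; field_simp
  have hl0 : 0 < lam := by linarith
  have hρ1 : 1 ≤ ρ := by
    have : 0 ≤ κ * (lam + 2) * (2 * (lam + 2)) := by positivity
    linarith
  induction m with
  | zero =>
    intro N
    have hsub : ∀ δ, ∀ x ∈ nearPart lam Y 0 N δ, x ∈ Y ∧ |x - N| ≤ δ := by
      intro δ x hx
      rw [nearPart, Finset.mem_filter] at hx
      simpa using hx
    have hc : ∀ (δ : ℝ) (k : ℕ), 2 * δ < k → ((nearPart lam Y 0 N δ).card : ℝ) ≤ k := by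
      intro δ k hk
      have := card_le_of_separated (Y := nearPart lam Y 0 N δ)
        (fun x hx y hy => hY x (hsub δ x hx).1 y (hsub δ y hy).1) (N - δ) (k := k) (by
          intro x hx
          have := abs_le.mp (hsub δ x hx).2
          constructor <;> linarith)
      exact_mod_cast this
    simp only [nearProd, Finset.range_zero, Finset.prod_empty, Finset.sum_const, nsmul_eq_mul,
      mul_one, pow_zero]
    constructor
    · refine (hc (1 / 2) 2 (by norm_num)).trans ?_
      push_cast; linarith
    · refine (hc d 1 (by push_cast; linarith)).trans ?_
      simp
  | succ m ih =>
    intro N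
    set a := lam * N - (lam + 1) / 2 with ha
    set b := lam * N + (lam + 1) / 2 with hb
    set T := Finset.Icc ⌈a⌉ ⌊b⌋ with hT
    have hTc : (T.card : ℝ) ≤ lam + 2 := by
      refine (card_Icc_ceil_floor_le (by linarith)).trans ?_
      linarith
    have hz : ∀ δ, ∀ x ∈ nearPart lam Y (m + 1) N δ,
        x ∈ Y ∧ |x / lam ^ m - lam * N| ≤ lam * δ := by
      intro δ x hx
      rw [nearPart, Finset.mem_filter] at hx
      refine ⟨hx.1, ?_⟩
      have : x / lam ^ m - lam * N = lam * (x / lam ^ (m + 1) - N) := by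
        rw [pow_succ]; field_simp
      rw [this, abs_mul, abs_of_pos hl0]
      exact mul_le_mul_of_nonneg_left hx.2 hl0.le
    have hmaps : ∀ δ ≤ 1 / 2, ∀ x ∈ nearPart lam Y (m + 1) N δ, round (x / lam ^ m) ∈ T := by
      intro δ hδ x hx
      have h1 := abs_le.mp (hz δ x hx).2
      have h2 := abs_le.mp (abs_sub_round (x / lam ^ m))
      have h3 : lam * δ ≤ lam * (1 / 2) := by gcongr
      rw [hT, Finset.mem_Icc, Int.ceil_le, Int.le_floor]
      constructor <;> linarith
    have hfib : ∀ δ, ∀ n : ℤ,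
        ∑ x ∈ (nearPart lam Y (m + 1) N δ).filter (fun x => round (x / lam ^ m) = n),
          nearProd lam κ d (m + 1) x ≤
        (∑ x ∈ (nearPart lam Y m n d).filter (fun x => x ∈ nearPart lam Y (m + 1) N δ),
          nearProd lam κ d m x) + κ * (2 * (lam + 2) * ρ ^ m) := by
      intro δ n
      calc _ ≤ ∑ x ∈ (nearPart lam Y (m + 1) N δ).filter (fun x => round (x / lam ^ m) = n),
            ((if |x / lam ^ m - n| ≤ d then nearProd lam κ d m x else 0) +
              κ * nearProd lam κ d m x) := by
            apply Finset.sum_le_sum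
            intro x hx
            have hr := (Finset.mem_filter.mp hx).2
            have hp := nearProd_nonneg (lam := lam) (d := d) hκ m x
            rw [nearProd_succ, nearWeight, hr]
            split_ifs
            · nlinarith
            · linarith
        _ ≤ _ := by
            rw [Finset.sum_add_distrib, ← Finset.mul_sum, ← Finset.sum_filter]
            apply add_le_add
            · apply Finset.sum_le_sum_of_subset_of_nonneg
              · intro x hx
                simp only [Finset.mem_filter, nearPart] at hx ⊢
                tauto
              · intro x _ _; exact nearProd_nonneg hκ m x
            · apply mul_le_mul_of_nonneg_left _ hκ
              refine le_trans ?_ (ih n).1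
              apply Finset.sum_le_sum_of_subset_of_nonneg
              · intro x hx
                simp only [Finset.mem_filter, nearPart] at hx ⊢
                refine ⟨hx.1.1, ?_⟩
                rw [← hx.2]
                exact abs_sub_round _
              · intro x _ _; exact nearProd_nonneg hκ m x
    have hρm : 0 < ρ ^ m := by positivity
    have hsub : ∀ δ, ∀ n : ℤ,
        (∑ x ∈ (nearPart lam Y m n d).filter (fun x => x ∈ nearPart lam Y (m + 1) N δ),
          nearProd lam κ d m x) ≤ ρ ^ m := by
      intro δ n
      refine le_trans ?_ (ih n).2
      apply Finset.sum_le_sum_of_subset_of_nonneg (Finset.filter_subset _ _)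
      intro x _ _; exact nearProd_nonneg hκ m x
    constructor
    · rw [← Finset.sum_fiberwise_of_maps_to (hmaps (1 / 2) le_rfl)]
      calc _ ≤ ∑ n ∈ T, (ρ ^ m + κ * (2 * (lam + 2) * ρ ^ m)) :=
            Finset.sum_le_sum fun n _ => (hfib _ n).trans (by gcongr; exact hsub _ n)
        _ = T.card * (ρ ^ m * (1 + κ * (2 * (lam + 2)))) := by
            rw [Finset.sum_const, nsmul_eq_mul]; ring
        _ ≤ (lam + 2) * (ρ ^ m * (1 + 1)) := by gcongr
        _ = 2 * (lam + 2) * (ρ ^ m * 1) := by ring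
        _ ≤ 2 * (lam + 2) * ρ ^ (m + 1) := by rw [pow_succ]; gcongr
    · rw [← Finset.sum_fiberwise_of_maps_to (hmaps d (by linarith))]
      have hone : ∑ n ∈ T, (∑ x ∈ (nearPart lam Y m n d).filter
          (fun x => x ∈ nearPart lam Y (m + 1) N d), nearProd lam κ d m x) ≤ ρ ^ m := by
        have hnn : ∀ n : ℤ, (∃ x, x ∈ (nearPart lam Y m n d).filter
            (fun x => x ∈ nearPart lam Y (m + 1) N d)) → |(n : ℝ) - lam * N| ≤ 1 / 4 := by
          rintro n ⟨x, hx⟩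
          rw [Finset.mem_filter] at hx
          have h1 := abs_le.mp (hz d x hx.2).2
          have h2 := abs_le.mp (Finset.mem_filter.mp hx.1).2
          rw [abs_le]; constructor <;> linarith
        by_cases hex : ∃ n₀ ∈ T, ∃ x, x ∈ (nearPart lam Y m n₀ d).filter
            (fun x => x ∈ nearPart lam Y (m + 1) N d)
        · obtain ⟨n₀, hn₀, hx₀⟩ := hex
          rw [Finset.sum_eq_single_of_mem n₀ hn₀]
          · exact hsub d n₀
          · intro n _ hne
            rw [Finset.sum_eq_zero]
            intro x hx
            exfalso
            have h1 := abs_le.mp (hnn n ⟨x, hx⟩)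
            have h2 := abs_le.mp (hnn n₀ hx₀)
            apply hne
            have h3 : |((n - n₀ : ℤ) : ℝ)| < 1 := by
              push_cast; rw [abs_lt]; constructor <;> linarith
            have h4 : |n - n₀| < 1 := by exact_mod_cast h3
            rw [Int.abs_lt_one_iff] at h4
            omega
        · push Not at hex
          rw [Finset.sum_eq_zero]
          · exact hρm.le
          · intro n hn
            exact Finset.sum_eq_zero fun x hx => absurd hx (hex n hn x)
      calc _ ≤ ∑ n ∈ T, ((∑ x ∈ (nearPart lam Y m n d).filter
              (fun x => x ∈ nearPart lam Y (m + 1) N d), nearProd lam κ d m x) +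
              κ * (2 * (lam + 2) * ρ ^ m)) := Finset.sum_le_sum fun n _ => hfib _ n
        _ ≤ ρ ^ m + T.card * (κ * (2 * (lam + 2) * ρ ^ m)) := by
            rw [Finset.sum_add_distrib, Finset.sum_const, nsmul_eq_mul]
            gcongr
        _ ≤ ρ ^ m + (lam + 2) * (κ * (2 * (lam + 2) * ρ ^ m)) := by gcongr
        _ = ρ ^ m * (1 + κ * (lam + 2) * (2 * (lam + 2))) := by ring
        _ ≤ ρ ^ (m + 1) := by rw [pow_succ]; gcongr

theorem abs_cos_pi_mul_le {d x : ℝ} (hd : 0 ≤ d) (hx : d < |x - round x|) :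
    |Real.cos (Real.pi * x)| ≤ Real.cos (Real.pi * d) := by
  have h1 : |Real.cos (Real.pi * x)| = Real.cos (Real.pi * |x - round x|) := by
    have h2 : Real.pi * x = Real.pi * (x - round x) + (round x : ℤ) * Real.pi := by ring
    rw [h2, Real.cos_add_int_mul_pi, abs_mul, abs_zpow, abs_neg, abs_one, one_zpow, one_mul]
    have h3 : Real.pi * |x - round x| = |Real.pi * (x - round x)| := by
      rw [abs_mul, abs_of_pos Real.pi_pos]
    rw [h3, Real.cos_abs]
    apply abs_of_nonneg
    apply Real.cos_nonneg_of_neg_pi_div_two_le_of_le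
    · have := abs_le.mp (abs_sub_round x); nlinarith [Real.pi_pos]
    · have := abs_le.mp (abs_sub_round x); nlinarith [Real.pi_pos]
  rw [h1]
  have hp := Real.pi_pos
  have := abs_sub_round x
  apply Real.cos_le_cos_of_nonneg_of_le_pi
  · positivity
  · nlinarith
  · gcongr

set_option maxHeartbeats 3200000 in
/-- An Erdős–Kahane type estimate, uniform over well separated frequencies. -/
theorem exists_sum_prod_cos_le {lam : ℝ} (h8 : 8 ≤ lam) {T : ℕ} (hT : 0 < T) :
    ∃ (G : ℕ) (C : ℝ), 0 < G ∧ 0 ≤ C ∧ ∀ (m k l : ℕ), m ≤ T * k → G * l ≤ m →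
      ∀ Y : Finset ℝ, (∀ x ∈ Y, ∀ y ∈ Y, x ≠ y → 1 ≤ |x - y|) → (∀ x ∈ Y, |x| ≤ lam ^ m) →
      ∑ x ∈ Y, ∏ j ∈ Finset.range m, |Real.cos (Real.pi * (x / lam ^ j))| ≤
        Y.card * (2 ^ l)⁻¹ + C * 2 ^ k := by
  have hl0 : 0 < lam := by linarith
  set ρ : ℝ := 2 ^ (1 / (2 * T : ℝ)) with hρdef
  have hρT : ρ ^ (2 * T) = 2 := by
    rw [hρdef, ← Real.rpow_natCast, ← Real.rpow_mul (by norm_num)]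
    push_cast
    rw [one_div_mul_cancel (by positivity), Real.rpow_one]
  have hρ1 : 1 < ρ := by
    rw [hρdef]; apply Real.one_lt_rpow (by norm_num) (by positivity)
  obtain ⟨κ, hκ0, hκ1, hκ2⟩ : ∃ κ : ℝ, 0 < κ ∧ κ * (2 * (lam + 2)) ≤ 1 ∧
      1 + κ * (lam + 2) * (2 * (lam + 2)) ≤ ρ := by
    refine ⟨min (1 / (2 * (lam + 2))) ((ρ - 1) / ((lam + 2) * (2 * (lam + 2)))), ?_, ?_, ?_⟩
    · apply lt_min
      · positivity
      · apply div_pos <;> [linarith; positivity]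
    · rw [← le_div_iff₀ (by positivity)]; exact min_le_left _ _
    · have := min_le_right (1 / (2 * (lam + 2))) ((ρ - 1) / ((lam + 2) * (2 * (lam + 2))))
      rw [le_div_iff₀ (by positivity)] at this
      linarith
  have hκlt : κ ≤ 1 := by nlinarith
  set d := 1 / (4 * (lam + 1)) with hd
  have hd0 : 0 < d := by rw [hd]; positivity
  have hd1 : d ≤ 1 / 36 := by
    rw [hd]; apply one_div_le_one_div_of_le <;> linarith
  set θ := Real.cos (Real.pi * d) with hθ
  have hp := Real.pi_pos
  have hθ1 : θ < 1 := by
    rw [hθ, ← Real.cos_zero]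
    apply Real.cos_lt_cos_of_nonneg_of_le_pi le_rfl
    · nlinarith
    · positivity
  have hθ0 : 0 ≤ θ := by
    apply Real.cos_nonneg_of_neg_pi_div_two_le_of_le <;> nlinarith
  obtain ⟨b, hb⟩ := pow_unbounded_of_one_lt ((κ⁻¹) ^ (2 * T)) (by norm_num : (1 : ℝ) < 2)
  obtain ⟨g, hg⟩ := exists_pow_lt_of_lt_one (by norm_num : (0 : ℝ) < 1 / 2) hθ1
  refine ⟨(b + 1) * (g + 1), 3 * (2 * (lam + 2)), by positivity, by positivity, ?_⟩
  intro m k l hmk hml Y hY hYm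
  let bad : ℝ → Finset ℕ := fun x =>
    (Finset.range m).filter (fun j => d < |x / lam ^ j - round (x / lam ^ j)|)
  have hcos : ∀ x, ∏ j ∈ Finset.range m, |Real.cos (Real.pi * (x / lam ^ j))| ≤
      θ ^ (bad x).card := by
    intro x
    calc _ ≤ ∏ j ∈ Finset.range m,
          (if d < |x / lam ^ j - round (x / lam ^ j)| then θ else 1) := by
          apply Finset.prod_le_prod
          · intros; positivity
          · intro j _
            split_ifs with h
            · exact abs_cos_pi_mul_le hd0.le h
            · exact Real.abs_cos_le_one _
      _ = _ := by
          rw [Finset.prod_ite, Finset.prod_const, Finset.prod_const_one, mul_one]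
  have hW : ∀ x, nearProd lam κ d m x = κ ^ (bad x).card := by
    intro x
    calc _ = ∏ j ∈ Finset.range m,
          (if d < |x / lam ^ j - round (x / lam ^ j)| then κ else 1) := by
          apply Finset.prod_congr rfl
          intro j _
          rw [nearWeight]
          split_ifs <;> first | rfl | (exfalso; linarith)
      _ = _ := by
          rw [Finset.prod_ite, Finset.prod_const, Finset.prod_const_one, mul_one]
  have hWsum : ∑ x ∈ Y, nearProd lam κ d m x ≤ 3 * (2 * (lam + 2)) * ρ ^ m := by
    have hmaps : ∀ x ∈ Y, round (x / lam ^ m) ∈ Finset.Icc (-1 : ℤ) 1 := by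
      intro x hx
      have h1 : |x / lam ^ m| ≤ 1 := by
        rw [abs_div, abs_of_pos (by positivity : 0 < lam ^ m), div_le_one (by positivity)]
        exact hYm x hx
      have h2 := abs_le.mp (abs_sub_round (x / lam ^ m))
      rw [abs_le] at h1
      have e1 : ((-2 : ℤ) : ℝ) < round (x / lam ^ m) := by push_cast; linarith
      have e2 : (round (x / lam ^ m) : ℝ) < ((2 : ℤ) : ℝ) := by push_cast; linarith
      have e1' := Int.cast_lt.mp e1
      have e2' := Int.cast_lt.mp e2
      rw [Finset.mem_Icc]; omega
    rw [← Finset.sum_fiberwise_of_maps_to hmaps]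
    calc _ ≤ ∑ n ∈ Finset.Icc (-1 : ℤ) 1, 2 * (lam + 2) * ρ ^ m := by
          apply Finset.sum_le_sum
          intro n _
          refine le_trans ?_ (sum_nearProd_le h8 hY hκ0.le hκ1 hκ2 m n).1
          apply Finset.sum_le_sum_of_subset_of_nonneg
          · intro x hx
            rw [Finset.mem_filter] at hx
            rw [nearPart, Finset.mem_filter, ← hx.2]
            exact ⟨hx.1, abs_sub_round _⟩
          · intro x _ _; exact nearProd_nonneg hκ0.le m x
      _ = _ := by rw [Finset.sum_const]; simp; ring
  have hterm : ∀ x ∈ Y, ∏ j ∈ Finset.range m, |Real.cos (Real.pi * (x / lam ^ j))| ≤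
      (2 ^ l)⁻¹ + 2 ^ k / ρ ^ m * nearProd lam κ d m x := by
    intro x _
    refine (hcos x).trans ?_
    by_cases hbx : m ≤ (b + 1) * (bad x).card
    · have h1 : (g + 1) * l ≤ (bad x).card := by
        have : (b + 1) * ((g + 1) * l) ≤ (b + 1) * (bad x).card := by
          rw [← mul_assoc]; omega
        exact Nat.le_of_mul_le_mul_left this (by positivity)
      have h2 : θ ^ (bad x).card ≤ (2 ^ l)⁻¹ := by
        calc θ ^ (bad x).card ≤ θ ^ ((g + 1) * l) := pow_le_pow_of_le_one hθ0 hθ1.le h1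
          _ = (θ ^ (g + 1)) ^ l := pow_mul _ _ _
          _ ≤ (1 / 2) ^ l := by
              gcongr
              exact (pow_le_pow_of_le_one hθ0 hθ1.le (Nat.le_succ g)).trans hg.le
          _ = _ := by rw [one_div, inv_pow]
      have := nearProd_nonneg (lam := lam) (d := d) hκ0.le m x
      have : 0 ≤ 2 ^ k / ρ ^ m * nearProd lam κ d m x := by positivity
      linarith
    · push Not at hbx
      have h1 : (κ⁻¹) ^ (bad x).card * ρ ^ m ≤ 2 ^ k := by
        rw [← pow_le_pow_iff_left₀ (by positivity) (by positivity) (by positivity : 2 * T ≠ 0)]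
        rw [mul_pow, ← pow_mul, ← pow_mul, mul_comm m, pow_mul ρ, hρT, mul_comm (bad x).card,
          pow_mul κ⁻¹]
        calc ((κ⁻¹) ^ (2 * T)) ^ (bad x).card * 2 ^ m ≤ (2 ^ (b + 1)) ^ (bad x).card * 2 ^ m := by
              gcongr
              refine hb.le.trans ?_
              gcongr
              · norm_num
              · omega
          _ = 2 ^ ((b + 1) * (bad x).card + m) := by rw [← pow_mul, ← pow_add]
          _ ≤ 2 ^ (k * (2 * T)) := by
              gcongr
              · norm_num
              · have : k * (2 * T) = T * k + T * k := by ring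
                omega
          _ = _ := pow_mul _ _ _
      rw [hW]
      have h2 : 1 ≤ 2 ^ k / ρ ^ m * κ ^ (bad x).card := by
        rw [div_mul_eq_mul_div, le_div_iff₀ (by positivity), one_mul]
        rw [inv_pow, inv_mul_le_iff₀ (by positivity)] at h1
        linarith
      have h3 : θ ^ (bad x).card ≤ 1 := pow_le_one₀ hθ0 hθ1.le
      have : (0 : ℝ) ≤ (2 ^ l)⁻¹ := by positivity
      linarith
  calc _ ≤ ∑ x ∈ Y, ((2 ^ l)⁻¹ + 2 ^ k / ρ ^ m * nearProd lam κ d m x) := Finset.sum_le_sum hterm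
    _ = Y.card * (2 ^ l)⁻¹ + 2 ^ k / ρ ^ m * ∑ x ∈ Y, nearProd lam κ d m x := by
        rw [Finset.sum_add_distrib, Finset.sum_const, nsmul_eq_mul, Finset.mul_sum]
    _ ≤ Y.card * (2 ^ l)⁻¹ + 2 ^ k / ρ ^ m * (3 * (2 * (lam + 2)) * ρ ^ m) := by gcongr
    _ = _ := by field_simp

theorem integral_exp_mul_cos {b : ℝ} (hb : 0 < b) (u : ℝ) :
    ∫ ξ : ℝ, Real.exp (-b * ξ ^ 2) * Real.cos (2 * Real.pi * ξ * u) =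
      Real.sqrt (Real.pi / b) * Real.exp (-(Real.pi ^ 2 / b) * u ^ 2) := by
  set c : ℝ := Real.pi * u / b with hc
  have h := GaussianFourier.integral_cexp_neg_mul_sq_add_real_mul_I (b := (b : ℂ)) (by simpa) c
  have hint := GaussianFourier.integrable_cexp_neg_mul_sq_add_real_mul_I (b := (b : ℂ)) (by simpa) c
  have h2 := congrArg Complex.re h
  have h3 := integral_re hint
  simp only [RCLike.re_eq_complex_re] at h3
  rw [← h3] at h2
  have hre : ∀ x : ℝ, (Complex.exp (-(b : ℂ) * (x + c * Complex.I) ^ 2)).re =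
      Real.exp (b * c ^ 2) * (Real.exp (-b * x ^ 2) * Real.cos (2 * Real.pi * x * u)) := by
    intro x
    have : -(b : ℂ) * (x + c * Complex.I) ^ 2 =
        ((b * c ^ 2 - b * x ^ 2 : ℝ) : ℂ) + ((-(2 * b * c * x) : ℝ) : ℂ) * Complex.I := by
      push_cast
      ring_nf
      rw [Complex.I_sq]; ring
    rw [this, Complex.exp_re]
    simp only [Complex.add_re, Complex.ofReal_re, Complex.mul_re, Complex.I_re, mul_zero,
      Complex.ofReal_im, Complex.I_im, mul_one, sub_self, add_zero, Complex.add_im, Complex.mul_im,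
      zero_add]
    rw [← mul_assoc, ← Real.exp_add, Real.cos_neg]
    congr 2
    · ring
    · rw [hc]; field_simp
  simp only [hre] at h2
  rw [integral_const_mul] at h2
  have hr : (((Real.pi : ℂ) / b) ^ (1 / 2 : ℂ)).re = Real.sqrt (Real.pi / b) := by
    rw [Real.sqrt_eq_rpow, ← Complex.ofReal_div]
    have := Complex.ofReal_cpow (x := Real.pi / b) (by positivity) (1 / 2)
    push_cast at this ⊢
    rw [← this]
    norm_cast
  rw [hr] at h2
  have he : Real.exp (-(Real.pi ^ 2 / b) * u ^ 2) * Real.exp (b * c ^ 2) = 1 := by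
    rw [← Real.exp_add, Real.exp_eq_one_iff, hc]; field_simp; ring
  rw [← h2]
  calc _ = (Real.exp (-(Real.pi ^ 2 / b) * u ^ 2) * Real.exp (b * c ^ 2)) *
        ∫ ξ : ℝ, Real.exp (-b * ξ ^ 2) * Real.cos (2 * Real.pi * ξ * u) := by rw [he, one_mul]
    _ = _ := by ring

theorem integrable_exp_mul_cos {b : ℝ} (hb : 0 < b) (u : ℝ) :
    Integrable fun ξ : ℝ => Real.exp (-b * ξ ^ 2) * Real.cos (2 * Real.pi * ξ * u) := by
  apply (integrable_exp_neg_mul_sq hb).mul_bdd (c := 1)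
  · fun_prop
  · refine Filter.Eventually.of_forall fun x => ?_
    rw [Real.norm_eq_abs]; exact Real.abs_cos_le_one _

/-- Gaussian bump of width `1 / a` centred at `t`. -/
noncomputable def bump (a t x : ℝ) : ℝ := a * Real.exp (-(Real.pi * a ^ 2 * (x - t) ^ 2))

/-- Fourier transform of the bump centred at the origin. -/
noncomputable def bumpHat (a ξ : ℝ) : ℝ := Real.exp (-(Real.pi / a ^ 2 * ξ ^ 2))

theorem bump_mul_bump {a b : ℝ} (ha : 0 < a) (hb : 0 < b) (s t x : ℝ) :
    bump a s x * bump b t x =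
      (a * b * Real.exp (-(Real.pi * (a ^ 2 * b ^ 2 / (a ^ 2 + b ^ 2)) * (s - t) ^ 2))) *
      Real.exp (-(Real.pi * (a ^ 2 + b ^ 2)) *
        (x - (a ^ 2 * s + b ^ 2 * t) / (a ^ 2 + b ^ 2)) ^ 2) := by
  unfold bump
  rw [mul_mul_mul_comm, ← Real.exp_add, mul_assoc (a * b), ← Real.exp_add]
  congr 2
  field_simp
  ring

theorem integrable_bump_mul_bump {a b : ℝ} (ha : 0 < a) (hb : 0 < b) (s t : ℝ) :
    Integrable fun x => bump a s x * bump b t x := by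
  simp only [bump_mul_bump ha hb]
  apply Integrable.const_mul
  exact (integrable_exp_neg_mul_sq
    (by positivity : 0 < Real.pi * (a ^ 2 + b ^ 2))).comp_sub_right _

theorem integrable_bumpHat_mul {a b : ℝ} (ha : 0 < a) (hb : 0 < b) (u : ℝ) :
    Integrable fun ξ => bumpHat a ξ * bumpHat b ξ * Real.cos (2 * Real.pi * ξ * u) := by
  have : ∀ ξ, bumpHat a ξ * bumpHat b ξ =
      Real.exp (-(Real.pi / a ^ 2 + Real.pi / b ^ 2) * ξ ^ 2) := by
    intro ξ; unfold bumpHat; rw [← Real.exp_add]; congr 1; ring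
  simp only [this]
  exact integrable_exp_mul_cos (by positivity) u

theorem integral_bump_mul_bump {a b : ℝ} (ha : 0 < a) (hb : 0 < b) (s t : ℝ) :
    ∫ x, bump a s x * bump b t x =
      ∫ ξ, bumpHat a ξ * bumpHat b ξ * Real.cos (2 * Real.pi * ξ * (s - t)) := by
  have : ∀ ξ, bumpHat a ξ * bumpHat b ξ =
      Real.exp (-(Real.pi / a ^ 2 + Real.pi / b ^ 2) * ξ ^ 2) := by
    intro ξ; unfold bumpHat; rw [← Real.exp_add]; congr 1; ring
  simp only [this]
  rw [integral_exp_mul_cos (by positivity)]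
  simp only [bump_mul_bump ha hb]
  rw [integral_const_mul, integral_sub_right_eq_self
    (fun x => Real.exp (-(Real.pi * (a ^ 2 + b ^ 2)) * x ^ 2)), integral_gaussian]
  have h1 : Real.pi / (Real.pi / a ^ 2 + Real.pi / b ^ 2) = (a * b) ^ 2 / (a ^ 2 + b ^ 2) := by
    have := Real.pi_pos
    field_simp; ring
  have h2 : Real.pi / (Real.pi * (a ^ 2 + b ^ 2)) = 1 / (a ^ 2 + b ^ 2) := by
    have := Real.pi_pos
    field_simp
  rw [h1, h2, Real.sqrt_div (by positivity), Real.sqrt_div (by positivity), Real.sqrt_sq (by positivity),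
    Real.sqrt_one]
  have h3 : -(Real.pi ^ 2 / (Real.pi / a ^ 2 + Real.pi / b ^ 2)) * (s - t) ^ 2 =
    -(Real.pi * (a ^ 2 * b ^ 2 / (a ^ 2 + b ^ 2)) * (s - t) ^ 2) := by
    have := Real.pi_pos
    field_simp; ring
  rw [h3]; ring

section Energy
variable {α : Type*} (S : Finset α) (t : α → ℝ)

/-- Gaussian energy of a finite family of points at scale `1 / R`. -/
noncomputable def gaussEnergy (R : ℝ) : ℝ :=
  ∑ i ∈ S, ∑ j ∈ S, Real.exp (-(Real.pi / 2 * R ^ 2 * (t i - t j) ^ 2))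

/-- Squared modulus of the exponential sum of a finite family of points. -/
noncomputable def expSumSq (ξ : ℝ) : ℝ :=
  ∑ i ∈ S, ∑ j ∈ S, Real.cos (2 * Real.pi * ξ * (t i - t j))

theorem expSumSq_eq (ξ : ℝ) : expSumSq S t ξ =
    ‖∑ i ∈ S, Complex.exp (((2 * Real.pi * ξ * t i : ℝ) : ℂ) * Complex.I)‖ ^ 2 := by
  rw [← Complex.normSq_eq_norm_sq, Complex.normSq_apply, Complex.re_sum, Complex.im_sum,
    Finset.sum_mul_sum, Finset.sum_mul_sum, ← Finset.sum_add_distrib, expSumSq]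
  apply Finset.sum_congr rfl; intro i _
  rw [← Finset.sum_add_distrib]
  apply Finset.sum_congr rfl; intro j _
  rw [Complex.exp_ofReal_mul_I_re, Complex.exp_ofReal_mul_I_re, Complex.exp_ofReal_mul_I_im,
    Complex.exp_ofReal_mul_I_im, ← Real.cos_sub]
  congr 1; ring

theorem expSumSq_nonneg (ξ : ℝ) : 0 ≤ expSumSq S t ξ := by
  rw [expSumSq_eq]; positivity

theorem continuous_expSumSq : Continuous (expSumSq S t) := by
  unfold expSumSq; fun_prop

theorem gaussEnergy_nonneg (R : ℝ) : 0 ≤ gaussEnergy S t R :=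
  Finset.sum_nonneg fun _ _ => Finset.sum_nonneg fun _ _ => (Real.exp_pos _).le

theorem gaussEnergy_anti {R R' : ℝ} (hR : 0 ≤ R) (h : R ≤ R') :
    gaussEnergy S t R' ≤ gaussEnergy S t R := by
  apply Finset.sum_le_sum; intro i _
  apply Finset.sum_le_sum; intro j _
  have := Real.pi_pos
  gcongr

theorem integrable_exp_mul_expSumSq {b : ℝ} (hb : 0 < b) :
    Integrable fun ξ => Real.exp (-b * ξ ^ 2) * expSumSq S t ξ := by
  simp only [expSumSq, Finset.mul_sum]
  exact integrable_finset_sum _ fun i _ => integrable_finset_sum _ fun j _ =>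
    integrable_exp_mul_cos hb _

theorem integral_exp_mul_expSumSq {R : ℝ} (hR : 0 < R) :
    ∫ ξ, Real.exp (-(2 * Real.pi / R ^ 2) * ξ ^ 2) * expSumSq S t ξ =
      R / Real.sqrt 2 * gaussEnergy S t R := by
  have hp := Real.pi_pos
  have hb : 0 < 2 * Real.pi / R ^ 2 := by positivity
  simp only [expSumSq, Finset.mul_sum]
  rw [integral_finset_sum _ fun i _ => integrable_finset_sum _ fun j _ =>
    integrable_exp_mul_cos hb _, gaussEnergy, Finset.mul_sum]
  apply Finset.sum_congr rfl; intro i _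
  rw [integral_finset_sum _ fun j _ => integrable_exp_mul_cos hb _, Finset.mul_sum]
  apply Finset.sum_congr rfl; intro j _
  rw [integral_exp_mul_cos hb]
  have h1 : Real.pi / (2 * Real.pi / R ^ 2) = R ^ 2 / 2 := by field_simp
  rw [h1, Real.sqrt_div (by positivity), Real.sqrt_sq hR.le]
  congr 2
  field_simp

theorem integral_exp_mul_expSumSq_le {R : ℝ} (hR : 0 < R) :
    ∫ ξ, Real.exp (-(Real.pi / R ^ 2) * ξ ^ 2) * expSumSq S t ξ ≤ R * gaussEnergy S t R := by
  have hp := Real.pi_pos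
  have h := integral_exp_mul_expSumSq S t (R := Real.sqrt 2 * R) (by positivity)
  have h2 : 2 * Real.pi / (Real.sqrt 2 * R) ^ 2 = Real.pi / R ^ 2 := by
    rw [mul_pow, Real.sq_sqrt (by norm_num)]; field_simp
  rw [h2, mul_div_assoc, mul_div_left_comm, div_self (by positivity), mul_one] at h
  rw [h]
  gcongr
  apply gaussEnergy_anti _ _ hR.le
  have : 1 ≤ Real.sqrt 2 := Real.one_le_sqrt.mpr (by norm_num)
  nlinarith

/-- Plancherel for differences of Gaussian mollifications of a finite family of points. -/
theorem integral_sq_sum_bump {R R' : ℝ} (hR : 0 < R) (hR' : 0 < R') :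
    ∫ x, (∑ i ∈ S, (bump R' (t i) x - bump R (t i) x)) ^ 2 =
      ∫ ξ, (bumpHat R' ξ - bumpHat R ξ) ^ 2 * expSumSq S t ξ := by
  have e1 : ∀ x, (∑ i ∈ S, (bump R' (t i) x - bump R (t i) x)) ^ 2 =
      ∑ i ∈ S, ∑ j ∈ S, (bump R' (t i) x * bump R' (t j) x - bump R' (t i) x * bump R (t j) x -
        bump R (t i) x * bump R' (t j) x + bump R (t i) x * bump R (t j) x) := by
    intro x
    rw [sq, Finset.sum_mul_sum]
    apply Finset.sum_congr rfl; intro i _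
    apply Finset.sum_congr rfl; intro j _
    ring
  have e2 : ∀ ξ, (bumpHat R' ξ - bumpHat R ξ) ^ 2 * expSumSq S t ξ =
      ∑ i ∈ S, ∑ j ∈ S,
        (bumpHat R' ξ * bumpHat R' ξ * Real.cos (2 * Real.pi * ξ * (t i - t j)) -
        bumpHat R' ξ * bumpHat R ξ * Real.cos (2 * Real.pi * ξ * (t i - t j)) -
        bumpHat R ξ * bumpHat R' ξ * Real.cos (2 * Real.pi * ξ * (t i - t j)) +
        bumpHat R ξ * bumpHat R ξ * Real.cos (2 * Real.pi * ξ * (t i - t j))) := by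
    intro x
    rw [expSumSq, Finset.mul_sum]
    apply Finset.sum_congr rfl; intro i _
    rw [Finset.mul_sum]
    apply Finset.sum_congr rfl; intro j _
    ring
  simp only [e1, e2]
  have i1 : ∀ i j, Integrable fun x => (bump R' (t i) x * bump R' (t j) x -
      bump R' (t i) x * bump R (t j) x - bump R (t i) x * bump R' (t j) x +
      bump R (t i) x * bump R (t j) x) := fun i j =>
    (((integrable_bump_mul_bump hR' hR' _ _).sub (integrable_bump_mul_bump hR' hR _ _)).sub
      (integrable_bump_mul_bump hR hR' _ _)).add (integrable_bump_mul_bump hR hR _ _)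
  have i2 : ∀ u, Integrable fun ξ => (bumpHat R' ξ * bumpHat R' ξ * Real.cos (2 * Real.pi * ξ * u) -
        bumpHat R' ξ * bumpHat R ξ * Real.cos (2 * Real.pi * ξ * u) -
        bumpHat R ξ * bumpHat R' ξ * Real.cos (2 * Real.pi * ξ * u) +
        bumpHat R ξ * bumpHat R ξ * Real.cos (2 * Real.pi * ξ * u)) := fun u =>
    (((integrable_bumpHat_mul hR' hR' _).sub (integrable_bumpHat_mul hR' hR _)).sub
      (integrable_bumpHat_mul hR hR' _)).add (integrable_bumpHat_mul hR hR _)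
  rw [integral_finset_sum _ fun i _ => integrable_finset_sum _ fun j _ => i1 i j,
    integral_finset_sum _ fun i _ => integrable_finset_sum _ fun j _ => i2 _]
  apply Finset.sum_congr rfl; intro i _
  rw [integral_finset_sum _ fun j _ => i1 i j, integral_finset_sum _ fun j _ => i2 _]
  apply Finset.sum_congr rfl; intro j _
  have ip := fun {a b : ℝ} (ha : 0 < a) (hb : 0 < b) => integrable_bump_mul_bump ha hb (t i) (t j)
  have iq := fun {a b : ℝ} (ha : 0 < a) (hb : 0 < b) => integrable_bumpHat_mul ha hb (t i - t j)
  rw [integral_add, integral_sub, integral_sub, integral_add, integral_sub, integral_sub,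
    integral_bump_mul_bump hR' hR', integral_bump_mul_bump hR' hR, integral_bump_mul_bump hR hR',
    integral_bump_mul_bump hR hR]
  · exact iq hR' hR'
  · exact iq hR' hR
  · exact (iq hR' hR').sub (iq hR' hR)
  · exact iq hR hR'
  · exact ((iq hR' hR').sub (iq hR' hR)).sub (iq hR hR')
  · exact iq hR hR
  · exact ip hR' hR'
  · exact ip hR' hR
  · exact (ip hR' hR').sub (ip hR' hR)
  · exact ip hR hR'
  · exact ((ip hR' hR').sub (ip hR' hR)).sub (ip hR hR')
  · exact ip hR hR

end Energy

theorem sum_pow_natAbs_le (D : Finset ℤ) : ∑ d ∈ D, ((4 : ℝ)⁻¹) ^ d.natAbs ≤ 8 / 3 := by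
  have key : ∀ E : Finset ℤ, Set.InjOn Int.natAbs E → ∑ d ∈ E, ((4 : ℝ)⁻¹) ^ d.natAbs ≤ 4 / 3 := by
    intro E hE
    rw [← Finset.sum_image (f := fun n => ((4 : ℝ)⁻¹) ^ n) hE]
    refine (Summable.sum_le_tsum _ (fun _ _ => by positivity)
      (summable_geometric_of_lt_one (by norm_num) (by norm_num))).trans ?_
    rw [tsum_geometric_of_lt_one (by norm_num) (by norm_num)]; norm_num
  rw [← Finset.sum_filter_add_sum_filter_not D (fun d => 0 ≤ d)]
  have h1 := key (D.filter fun d => 0 ≤ d) (by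
    intro a ha b hb h
    simp only [Finset.coe_filter, Set.mem_setOf_eq] at ha hb
    omega)
  have h2 := key (D.filter fun d => ¬ 0 ≤ d) (by
    intro a ha b hb h
    simp only [Finset.coe_filter, Set.mem_setOf_eq] at ha hb
    omega)
  linarith

section
variable {α : Type*} (S : Finset α) (t : α → ℝ)

/-- Number of pairs of points lying in the same cell of length `1 / R`. -/
noncomputable def collCount (R : ℝ) : ℝ :=
  ∑ i ∈ S, ∑ j ∈ S, if ⌊R * t i⌋ = ⌊R * t j⌋ then (1 : ℝ) else 0

theorem collCount_eq (R : ℝ) : collCount S t R =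
    ∑ c ∈ S.image (fun i => ⌊R * t i⌋), ((S.filter fun i => ⌊R * t i⌋ = c).card : ℝ) ^ 2 := by
  have e : ∀ i ∈ S, (∑ j ∈ S, if ⌊R * t i⌋ = ⌊R * t j⌋ then (1 : ℝ) else 0) =
      ((S.filter fun j => ⌊R * t j⌋ = ⌊R * t i⌋).card : ℝ) := by
    intro i _
    rw [Finset.sum_ite, Finset.sum_const_zero, add_zero, Finset.sum_const, nsmul_eq_mul, mul_one]
    simp only [eq_comm]
  rw [collCount, Finset.sum_congr rfl e,
    ← Finset.sum_fiberwise_of_maps_to (t := S.image (fun i => ⌊R * t i⌋)) (g := fun i => ⌊R * t i⌋)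
      (fun i hi => Finset.mem_image_of_mem _ hi)]
  apply Finset.sum_congr rfl
  intro c _
  rw [Finset.sum_congr rfl (g := fun _ => ((S.filter fun j => ⌊R * t j⌋ = c).card : ℝ))]
  · rw [Finset.sum_const, nsmul_eq_mul, sq]
  · intro i hi
    rw [(Finset.mem_filter.mp hi).2]

theorem collCount_nonneg (R : ℝ) : 0 ≤ collCount S t R :=
  Finset.sum_nonneg fun _ _ => Finset.sum_nonneg fun _ _ => by split_ifs <;> norm_num

theorem collCount_le_gaussEnergy {R : ℝ} : collCount S t R ≤ 8 * gaussEnergy S t R := by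
  rw [collCount, gaussEnergy, Finset.mul_sum]
  apply Finset.sum_le_sum; intro i _
  rw [Finset.mul_sum]
  apply Finset.sum_le_sum; intro j _
  split_ifs with h
  · have h1 := Int.abs_sub_lt_one_of_floor_eq_floor h
    rw [← mul_sub] at h1
    have h2 : R ^ 2 * (t i - t j) ^ 2 ≤ 1 := by
      rw [← mul_pow, sq_le_one_iff_abs_le_one]; exact h1.le
    have h3 : Real.exp (-2) ≤ Real.exp (-(Real.pi / 2 * R ^ 2 * (t i - t j) ^ 2)) := by
      apply Real.exp_le_exp.mpr
      have := Real.pi_le_four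
      have := Real.pi_pos
      rw [neg_le_neg_iff, mul_assoc]
      nlinarith
    have h4 : Real.exp 2 ≤ 8 := by
      have := Real.exp_one_lt_d9
      have e : Real.exp 2 = Real.exp 1 * Real.exp 1 := by rw [← Real.exp_add]; norm_num
      rw [e]; nlinarith [Real.exp_pos 1]
    have h5 : Real.exp (-2) * Real.exp 2 = 1 := by rw [← Real.exp_add]; norm_num
    nlinarith [Real.exp_pos (-2)]
  · positivity

theorem gaussEnergy_le_collCount (R : ℝ) : gaussEnergy S t R ≤ 11 * collCount S t R := by
  have hw : ∀ i j, Real.exp (-(Real.pi / 2 * R ^ 2 * (t i - t j) ^ 2)) ≤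
      4 * ((4 : ℝ)⁻¹) ^ (⌊R * t i⌋ - ⌊R * t j⌋).natAbs := by
    intro i j
    set d := ⌊R * t i⌋ - ⌊R * t j⌋ with hd
    rcases Nat.eq_zero_or_pos d.natAbs with h0 | h0
    · rw [h0, pow_zero, mul_one]
      have : Real.exp (-(Real.pi / 2 * R ^ 2 * (t i - t j) ^ 2)) ≤ 1 := by
        rw [Real.exp_le_one_iff]; have := Real.pi_pos
        have : 0 ≤ Real.pi / 2 * R ^ 2 * (t i - t j) ^ 2 := by positivity
        linarith
      linarith
    obtain ⟨n, hn⟩ := Nat.exists_eq_succ_of_ne_zero h0.ne'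
    have e : 4 * ((4 : ℝ)⁻¹) ^ d.natAbs = (4⁻¹) ^ n := by rw [hn, pow_succ]; ring
    rw [e]
    have h1 : (n : ℝ) ≤ |R * t i - R * t j| := by
      have hc : |(d : ℝ)| = n + 1 := by
        rw [← Int.cast_abs, Int.abs_eq_natAbs, hn]; push_cast; rfl
      have f1 := Int.floor_le (R * t i)
      have f2 := Int.floor_le (R * t j)
      have f3 := Int.lt_floor_add_one (R * t i)
      have f4 := Int.lt_floor_add_one (R * t j)
      have hd' : (d : ℝ) = ⌊R * t i⌋ - ⌊R * t j⌋ := by rw [hd]; push_cast; rfl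
      rcases abs_cases (d : ℝ) with h | h <;> rcases abs_cases (R * t i - R * t j) with h' | h' <;>
        linarith
    have h2 : (n : ℝ) ≤ R ^ 2 * (t i - t j) ^ 2 := by
      have : R ^ 2 * (t i - t j) ^ 2 = |R * t i - R * t j| ^ 2 := by rw [sq_abs]; ring
      rw [this]
      have hnn : (n : ℝ) ≤ (n : ℝ) ^ 2 := by
        rcases Nat.eq_zero_or_pos n with h | h
        · simp [h]
        · have : (1 : ℝ) ≤ n := by exact_mod_cast h
          nlinarith
      refine hnn.trans ?_
      gcongr
    have h3 : Real.exp (-(Real.pi / 2)) ≤ 4⁻¹ := by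
      have e1 := Real.exp_one_gt_d9
      have hpi := Real.pi_gt_three
      have e2 : 4 ≤ Real.exp (Real.pi / 2) := by
        have e3 : Real.exp (3 / 2) ≤ Real.exp (Real.pi / 2) := Real.exp_le_exp.mpr (by linarith)
        have e4 : Real.exp (3 / 2) ^ 2 = Real.exp 1 ^ 3 := by
          rw [← Real.exp_nat_mul, ← Real.exp_nat_mul]; norm_num
        have e5 : (19 : ℝ) ≤ Real.exp 1 ^ 3 := by
          calc (19 : ℝ) ≤ 2.7 ^ 3 := by norm_num
            _ ≤ _ := by gcongr; linarith
        have e6 := Real.exp_pos (3 / 2)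
        nlinarith
      rw [Real.exp_neg]
      exact inv_anti₀ (by norm_num) e2
    calc _ ≤ Real.exp (-(Real.pi / 2)) ^ n := by
          rw [← Real.exp_nat_mul]
          apply Real.exp_le_exp.mpr
          have := Real.pi_pos
          nlinarith
      _ ≤ _ := by gcongr
  set C := S.image (fun i => ⌊R * t i⌋) with hC
  set n : ℤ → ℝ := fun c => ((S.filter fun i => ⌊R * t i⌋ = c).card : ℝ) with hn
  have hsum : ∀ g : ℤ → ℝ, ∑ i ∈ S, g ⌊R * t i⌋ = ∑ c ∈ C, n c * g c := by
    intro g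
    rw [← Finset.sum_fiberwise_of_maps_to (t := C) (g := fun i => ⌊R * t i⌋)
      (fun i hi => Finset.mem_image_of_mem _ hi)]
    apply Finset.sum_congr rfl
    intro c _
    rw [Finset.sum_congr rfl (g := fun _ => g c)]
    · rw [Finset.sum_const, nsmul_eq_mul]
    · intro i hi
      rw [(Finset.mem_filter.mp hi).2]
  have hrow : ∀ c : ℤ, ∑ c' ∈ C, 4 * ((4 : ℝ)⁻¹) ^ (c - c').natAbs ≤ 11 := by
    intro c
    rw [← Finset.mul_sum, ← Finset.sum_image (f := fun d : ℤ => ((4 : ℝ)⁻¹) ^ d.natAbs)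
      (g := fun c' => c - c') (by intro a _ b _ h; simpa using h)]
    have := sum_pow_natAbs_le (C.image fun c' => c - c')
    linarith
  calc gaussEnergy S t R ≤ ∑ i ∈ S, ∑ j ∈ S, 4 * ((4 : ℝ)⁻¹) ^ (⌊R * t i⌋ - ⌊R * t j⌋).natAbs :=
        Finset.sum_le_sum fun i _ => Finset.sum_le_sum fun j _ => hw i j
    _ = ∑ c ∈ C, n c * ∑ c' ∈ C, n c' * (4 * ((4 : ℝ)⁻¹) ^ (c - c').natAbs) := by
        rw [← hsum (fun c => ∑ c' ∈ C, n c' * (4 * ((4 : ℝ)⁻¹) ^ (c - c').natAbs))]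
        apply Finset.sum_congr rfl; intro i _
        exact hsum (fun c' => 4 * ((4 : ℝ)⁻¹) ^ (⌊R * t i⌋ - c').natAbs)
    _ ≤ ∑ c ∈ C, ∑ c' ∈ C, (n c ^ 2 / 2 * (4 * ((4 : ℝ)⁻¹) ^ (c - c').natAbs) +
          n c' ^ 2 / 2 * (4 * ((4 : ℝ)⁻¹) ^ (c' - c).natAbs)) := by
        apply Finset.sum_le_sum; intro c _
        rw [Finset.mul_sum]
        apply Finset.sum_le_sum; intro c' _
        have e : (c' - c).natAbs = (c - c').natAbs := by omega
        rw [e, ← mul_assoc, ← add_mul]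
        gcongr
        nlinarith [sq_nonneg (n c - n c')]
    _ = ∑ c ∈ C, n c ^ 2 * ∑ c' ∈ C, 4 * ((4 : ℝ)⁻¹) ^ (c - c').natAbs := by
        simp only [Finset.sum_add_distrib]
        rw [Finset.sum_comm (f := fun c c' => n c' ^ 2 / 2 * (4 * ((4 : ℝ)⁻¹) ^ (c' - c).natAbs)),
          ← Finset.sum_add_distrib]
        apply Finset.sum_congr rfl; intro c _
        rw [← Finset.mul_sum]; ring
    _ ≤ ∑ c ∈ C, n c ^ 2 * 11 := by
        gcongr with c _
        exact hrow c
    _ = 11 * collCount S t R := by rw [collCount_eq, ← Finset.sum_mul, mul_comm]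

theorem integrable_sq_sum_bump {R R' : ℝ} (hR : 0 < R) (hR' : 0 < R') :
    Integrable fun x => (∑ i ∈ S, (bump R' (t i) x - bump R (t i) x)) ^ 2 := by
  have e1 : ∀ x, (∑ i ∈ S, (bump R' (t i) x - bump R (t i) x)) ^ 2 =
      ∑ i ∈ S, ∑ j ∈ S, (bump R' (t i) x * bump R' (t j) x - bump R' (t i) x * bump R (t j) x -
        bump R (t i) x * bump R' (t j) x + bump R (t i) x * bump R (t j) x) := by
    intro x
    rw [sq, Finset.sum_mul_sum]
    apply Finset.sum_congr rfl; intro i _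
    apply Finset.sum_congr rfl; intro j _
    ring
  simp only [e1]
  exact integrable_finset_sum _ fun i _ => integrable_finset_sum _ fun j _ =>
    (((integrable_bump_mul_bump hR' hR' _ _).sub (integrable_bump_mul_bump hR' hR _ _)).sub
      (integrable_bump_mul_bump hR hR' _ _)).add (integrable_bump_mul_bump hR hR _ _)

theorem bump_le_half_bump {R X ρ s x : ℝ} (hR : 0 < R) (hX : 1 ≤ X) (hρ : 0 ≤ ρ)
    (hXρ : 2 * X ≤ Real.exp (Real.pi * (X ^ 2 - 1) * ρ ^ 2 / 4)) (hx : ρ / (2 * R) ≤ |x - s|) :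
    bump (X * R) s x ≤ bump R s x / 2 := by
  unfold bump
  have hp := Real.pi_pos
  have h1 : ρ ^ 2 / 4 ≤ R ^ 2 * (x - s) ^ 2 := by
    have : (ρ / (2 * R)) ^ 2 ≤ |x - s| ^ 2 := by gcongr
    rw [sq_abs] at this
    calc ρ ^ 2 / 4 = R ^ 2 * (ρ / (2 * R)) ^ 2 := by field_simp; ring
      _ ≤ _ := by gcongr
  have h2 : 2 * X ≤ Real.exp (Real.pi * (X ^ 2 - 1) * (R ^ 2 * (x - s) ^ 2)) := by
    refine hXρ.trans (Real.exp_le_exp.mpr ?_)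
    have : 0 ≤ Real.pi * (X ^ 2 - 1) := mul_nonneg hp.le (by nlinarith)
    rw [mul_div_assoc]
    gcongr
  have h3 : Real.exp (-(Real.pi * R ^ 2 * (x - s) ^ 2)) =
      Real.exp (-(Real.pi * (X * R) ^ 2 * (x - s) ^ 2)) *
        Real.exp (Real.pi * (X ^ 2 - 1) * (R ^ 2 * (x - s) ^ 2)) := by
    rw [← Real.exp_add]; congr 1; ring
  rw [h3]
  have h4 := Real.exp_pos (-(Real.pi * (X * R) ^ 2 * (x - s) ^ 2))
  have := mul_le_mul_of_nonneg_left h2 (mul_pos hR h4).le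
  linarith

set_option maxHeartbeats 800000 in
/-- If every point is close to a gap of the family, mollification at two scales separates. -/
theorem collCount_le_integral {R X ρ : ℝ} (hR : 0 < R) (hX : 1 ≤ X) (hρ : 0 < ρ) (hρ1 : ρ ≤ 1)
    (hXρ : 2 * X ≤ Real.exp (Real.pi * (X ^ 2 - 1) * ρ ^ 2 / 4))
    (hgap : ∀ i ∈ S, ∃ y, |y - t i| ≤ 2 / R ∧ ∀ j ∈ S, ρ / R ≤ |t j - y|) :
    ρ * R * Real.exp (-(32 * Real.pi)) * collCount S t R ≤
      28 * ∫ x, (∑ i ∈ S, (bump (X * R) (t i) x - bump R (t i) x)) ^ 2 := by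
  have hp := Real.pi_pos
  set C := S.image (fun i => ⌊R * t i⌋) with hC
  set n : ℤ → ℝ := fun c => ((S.filter fun i => ⌊R * t i⌋ = c).card : ℝ) with hn
  have hex : ∀ c ∈ C, ∃ y, (∃ i ∈ S, ⌊R * t i⌋ = c ∧ |y - t i| ≤ 2 / R) ∧
      ∀ j ∈ S, ρ / R ≤ |t j - y| := by
    intro c hc
    obtain ⟨i, hi, rfl⟩ := Finset.mem_image.mp hc
    obtain ⟨y, h1, h2⟩ := hgap i hi
    exact ⟨y, ⟨i, hi, rfl, h1⟩, h2⟩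
  choose! y hy1 hy2 using hex
  set h : ℝ → ℝ := fun x => (∑ i ∈ S, (bump (X * R) (t i) x - bump R (t i) x)) ^ 2 with hh
  have hint : Integrable h := integrable_sq_sum_bump S t hR (by positivity)
  have hh0 : ∀ x, 0 ≤ h x := fun x => sq_nonneg _
  set I : ℤ → Set ℝ := fun c => Set.Icc (y c - ρ / (2 * R)) (y c + ρ / (2 * R)) with hI
  have hlow : ∀ c ∈ C, ∀ x ∈ I c, R ^ 2 * Real.exp (-(32 * Real.pi)) / 4 * n c ^ 2 ≤ h x := by
    intro c hc x hx
    have hxy : |x - y c| ≤ ρ / (2 * R) := by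
      rw [abs_le]; constructor <;> linarith [hx.1, hx.2]
    have h1 : ∀ i ∈ S, bump (X * R) (t i) x - bump R (t i) x ≤ -(bump R (t i) x / 2) := by
      intro i hi
      have h2 := hy2 c hc i hi
      have h3 : ρ / (2 * R) ≤ |x - t i| := by
        have e : ρ / R = ρ / (2 * R) + ρ / (2 * R) := by field_simp; ring
        have : |t i - y c| ≤ |x - t i| + |x - y c| := by
          have := abs_sub_le (t i) x (y c)
          rw [abs_sub_comm (t i) x] at this; exact this
        linarith
      linarith [bump_le_half_bump hR hX hρ.le hXρ h3]
    have hb0 : ∀ i, 0 ≤ bump R (t i) x := fun i => by unfold bump; positivity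
    have h4 : ∀ i ∈ S.filter (fun i => ⌊R * t i⌋ = c), R * Real.exp (-(16 * Real.pi)) ≤
        bump R (t i) x := by
      intro i hi
      obtain ⟨hiS, hic⟩ := Finset.mem_filter.mp hi
      obtain ⟨i0, _, hi0c, hi0⟩ := hy1 c hc
      have h5 := Int.abs_sub_lt_one_of_floor_eq_floor (hic.trans hi0c.symm)
      have h6 : |R * (x - t i)| ≤ 4 := by
        have a1 : |R * (x - y c)| ≤ 1 / 2 := by
          rw [abs_mul, abs_of_pos hR]
          calc R * |x - y c| ≤ R * (ρ / (2 * R)) := by gcongr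
            _ = ρ / 2 := by field_simp
            _ ≤ 1 / 2 := by linarith
        have a2 : |R * (y c - t i0)| ≤ 2 := by
          rw [abs_mul, abs_of_pos hR]
          calc R * |y c - t i0| ≤ R * (2 / R) := by gcongr
            _ = 2 := by field_simp
        rw [abs_le] at a1 a2 ⊢
        rw [abs_lt] at h5
        constructor <;> linarith [a1.1, a1.2, a2.1, a2.2, h5.1, h5.2]
      have : (R * (x - t i)) ^ 2 ≤ 4 ^ 2 := by rw [← sq_abs]; gcongr
      have h16 : Real.pi * R ^ 2 * (x - t i) ^ 2 ≤ 16 * Real.pi := by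
        have e : Real.pi * R ^ 2 * (x - t i) ^ 2 = Real.pi * (R * (x - t i)) ^ 2 := by ring
        rw [e]; nlinarith
      exact mul_le_mul_of_nonneg_left (Real.exp_le_exp.mpr (neg_le_neg h16)) hR.le
    have h5 : n c * (R * Real.exp (-(16 * Real.pi))) ≤ ∑ i ∈ S, bump R (t i) x := by
      calc _ = ∑ i ∈ S.filter (fun i => ⌊R * t i⌋ = c), R * Real.exp (-(16 * Real.pi)) := by
            rw [Finset.sum_const, nsmul_eq_mul]
        _ ≤ ∑ i ∈ S.filter (fun i => ⌊R * t i⌋ = c), bump R (t i) x := Finset.sum_le_sum h4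
        _ ≤ _ := Finset.sum_le_sum_of_subset_of_nonneg (Finset.filter_subset _ _) fun i _ _ => hb0 i
    have h6 : ∑ i ∈ S, (bump (X * R) (t i) x - bump R (t i) x) ≤
        -(n c * (R * Real.exp (-(16 * Real.pi))) / 2) := by
      refine (Finset.sum_le_sum h1).trans ?_
      rw [Finset.sum_neg_distrib, ← Finset.sum_div]
      linarith
    have h7 : 0 ≤ n c * (R * Real.exp (-(16 * Real.pi))) / 2 := by positivity
    have h8 : Real.exp (-(32 * Real.pi)) = Real.exp (-(16 * Real.pi)) ^ 2 := by
      rw [← Real.exp_nat_mul]; congr 1; push_cast; ring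
    rw [h8]
    calc _ = (n c * (R * Real.exp (-(16 * Real.pi))) / 2) ^ 2 := by ring
      _ ≤ (-∑ i ∈ S, (bump (X * R) (t i) x - bump R (t i) x)) ^ 2 := by
          gcongr; linarith
      _ = h x := by rw [neg_sq]
  have hset : ∀ c ∈ C, ρ * R * Real.exp (-(32 * Real.pi)) / 4 * n c ^ 2 ≤ ∫ x in I c, h x := by
    intro c hc
    have h1 : volume (I c) ≠ ⊤ := by rw [hI]; simp
    have h2 : volume.real (I c) = ρ / R := by
      simp only [hI, Measure.real, Real.volume_Icc]
      rw [ENNReal.toReal_ofReal]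
      · field_simp; ring
      · have : 0 < ρ / (2 * R) := by positivity
        linarith
    calc _ = ∫ x in I c, R ^ 2 * Real.exp (-(32 * Real.pi)) / 4 * n c ^ 2 := by
          rw [setIntegral_const, h2, smul_eq_mul]; field_simp
      _ ≤ _ := setIntegral_mono_on (integrableOn_const h1) hint.integrableOn measurableSet_Icc (hlow c hc)
  have hcover : ∀ x, ∑ c ∈ C, (I c).indicator h x ≤ 7 * h x := by
    intro x
    calc ∑ c ∈ C, (I c).indicator h x = ∑ c ∈ C.filter (fun c => x ∈ I c), h x := by
          simp only [Set.indicator_apply]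
          rw [← Finset.sum_filter]
      _ = ((C.filter (fun c => x ∈ I c)).card : ℝ) * h x := by
          rw [Finset.sum_const, nsmul_eq_mul]
      _ ≤ 7 * h x := by
          have : (C.filter (fun c => x ∈ I c)).card ≤
              (Finset.Icc (⌊R * x⌋ - 3) (⌊R * x⌋ + 3)).card := by
            apply Finset.card_le_card
            intro c hc'
            obtain ⟨hc, hx⟩ := Finset.mem_filter.mp hc'
            obtain ⟨i0, _, hi0c, hi0⟩ := hy1 c hc
            have a1 : |R * (x - y c)| ≤ 1 / 2 := by
              rw [abs_mul, abs_of_pos hR]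
              have hxy : |x - y c| ≤ ρ / (2 * R) := by
                rw [abs_le]; constructor <;> linarith [hx.1, hx.2]
              calc R * |x - y c| ≤ R * (ρ / (2 * R)) := by gcongr
                _ = ρ / 2 := by field_simp
                _ ≤ 1 / 2 := by linarith
            have a2 : |R * (y c - t i0)| ≤ 2 := by
              rw [abs_mul, abs_of_pos hR]
              calc R * |y c - t i0| ≤ R * (2 / R) := by gcongr
                _ = 2 := by field_simp
            rw [abs_le] at a1 a2
            have f1 := Int.floor_le (R * x)
            have f2 := Int.lt_floor_add_one (R * x)
            have f3 := Int.floor_le (R * t i0)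
            have f4 := Int.lt_floor_add_one (R * t i0)
            rw [hi0c] at f3 f4
            have g1 : ((⌊R * x⌋ : ℤ) : ℝ) - 4 < c := by linarith [a1.1, a1.2, a2.1, a2.2]
            have g2 : (c : ℝ) < ⌊R * x⌋ + 4 := by linarith [a1.1, a1.2, a2.1, a2.2]
            have g1' : ⌊R * x⌋ - 4 < c := by exact_mod_cast g1
            have g2' : c < ⌊R * x⌋ + 4 := by exact_mod_cast g2
            rw [Finset.mem_Icc]; omega
          rw [Int.card_Icc] at this
          have h7 : (C.filter (fun c => x ∈ I c)).card ≤ 7 := by omega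
          have : ((C.filter (fun c => x ∈ I c)).card : ℝ) ≤ 7 := by exact_mod_cast h7
          exact mul_le_mul_of_nonneg_right this (hh0 x)
  have hindint : ∀ c ∈ C, Integrable ((I c).indicator h) := fun c _ =>
    hint.indicator measurableSet_Icc
  have hfin : ∑ c ∈ C, ∫ x in I c, h x ≤ 7 * ∫ x, h x := by
    calc ∑ c ∈ C, ∫ x in I c, h x = ∑ c ∈ C, ∫ x, (I c).indicator h x := by
          apply Finset.sum_congr rfl; intro c _
          rw [integral_indicator measurableSet_Icc]
      _ = ∫ x, ∑ c ∈ C, (I c).indicator h x := (integral_finset_sum _ hindint).symm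
      _ ≤ ∫ x, 7 * h x := integral_mono (integrable_finset_sum _ hindint) (hint.const_mul 7) hcover
      _ = 7 * ∫ x, h x := integral_const_mul _ _
  have h1 := (Finset.sum_le_sum hset).trans hfin
  rw [← Finset.mul_sum, ← collCount_eq] at h1
  linarith

end

theorem sq_bumpHat_sub_le {R X κ H ξ : ℝ} (hR : 0 < R) (hX : 1 ≤ X) (hκ1 : κ ≤ 1)
    (hH : 0 ≤ H) :
    ((bumpHat (X * R) ξ - bumpHat R ξ) ^ 2 ≤
        Real.pi ^ 2 * κ ^ 4 * Real.exp (2 * Real.pi) * Real.exp (-(2 * Real.pi / R ^ 2) * ξ ^ 2) ∨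
      κ * R ≤ |ξ|) ∧
    ((bumpHat (X * R) ξ - bumpHat R ξ) ^ 2 ≤
        Real.exp (-(Real.pi * H ^ 2)) * Real.exp (-(Real.pi / (X * R) ^ 2) * ξ ^ 2) ∨
      |ξ| ≤ H * (X * R)) ∧
    (bumpHat (X * R) ξ - bumpHat R ξ) ^ 2 ≤ Real.exp (-(2 * Real.pi / (X * R) ^ 2) * ξ ^ 2) := by
  have hp := Real.pi_pos
  have hXR : R ≤ X * R := by nlinarith
  have hXR0 : 0 < X * R := by positivity
  have h0 : bumpHat R ξ ≤ bumpHat (X * R) ξ := by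
    unfold bumpHat
    gcongr
  have h1 : bumpHat (X * R) ξ ≤ 1 := by
    unfold bumpHat
    rw [Real.exp_le_one_iff]
    have : 0 ≤ Real.pi / (X * R) ^ 2 * ξ ^ 2 := by positivity
    linarith
  have hR0 : 0 ≤ bumpHat R ξ := (Real.exp_pos _).le
  have hD0 : 0 ≤ bumpHat (X * R) ξ - bumpHat R ξ := by linarith
  have h2 : (bumpHat (X * R) ξ) ^ 2 = Real.exp (-(2 * Real.pi / (X * R) ^ 2) * ξ ^ 2) := by
    unfold bumpHat
    rw [← Real.exp_nat_mul]; congr 1; push_cast; ring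
  have h3 : (bumpHat (X * R) ξ - bumpHat R ξ) ^ 2 ≤ (bumpHat (X * R) ξ) ^ 2 := by
    gcongr; linarith
  refine ⟨?_, ?_, by rw [← h2]; exact h3⟩
  · by_cases hξ : κ * R ≤ |ξ|
    · exact Or.inr hξ
    left
    push Not at hξ
    have hκ0 : 0 < κ := by
      by_contra hneg
      have : κ * R ≤ 0 := by nlinarith
      linarith [abs_nonneg ξ]
    have h4 : ξ ^ 2 ≤ κ ^ 2 * R ^ 2 := by
      rw [← mul_pow, ← sq_abs ξ]; gcongr
    have h5 : Real.pi / R ^ 2 * ξ ^ 2 ≤ Real.pi * κ ^ 2 := by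
      rw [div_mul_eq_mul_div, div_le_iff₀ (by positivity)]; nlinarith
    have h6 : bumpHat (X * R) ξ - bumpHat R ξ ≤ Real.pi * κ ^ 2 := by
      have : 1 - Real.pi / R ^ 2 * ξ ^ 2 ≤ bumpHat R ξ := by
        unfold bumpHat
        have := Real.add_one_le_exp (-(Real.pi / R ^ 2 * ξ ^ 2)); linarith
      linarith
    have h7 : 1 ≤ Real.exp (2 * Real.pi) * Real.exp (-(2 * Real.pi / R ^ 2) * ξ ^ 2) := by
      rw [← Real.exp_add, Real.one_le_exp_iff]
      have e : 2 * Real.pi + -(2 * Real.pi / R ^ 2) * ξ ^ 2 =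
        2 * (Real.pi - Real.pi / R ^ 2 * ξ ^ 2) := by ring
      rw [e]
      have : κ ^ 2 ≤ 1 := by nlinarith
      nlinarith
    calc _ ≤ (Real.pi * κ ^ 2) ^ 2 := by gcongr
      _ = Real.pi ^ 2 * κ ^ 4 * 1 := by ring
      _ ≤ Real.pi ^ 2 * κ ^ 4 *
          (Real.exp (2 * Real.pi) * Real.exp (-(2 * Real.pi / R ^ 2) * ξ ^ 2)) := by gcongr
      _ = _ := by ring
  · by_cases hξ : |ξ| ≤ H * (X * R)
    · exact Or.inr hξ
    left
    push Not at hξ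
    refine h3.trans ?_
    rw [h2, ← Real.exp_add]
    apply Real.exp_le_exp.mpr
    have h4 : H ^ 2 * (X * R) ^ 2 ≤ ξ ^ 2 := by
      rw [← mul_pow, ← sq_abs ξ]; gcongr
    have h5 : Real.pi * H ^ 2 ≤ Real.pi / (X * R) ^ 2 * ξ ^ 2 := by
      rw [div_mul_eq_mul_div, le_div_iff₀ (by positivity)]; nlinarith
    have e : -(2 * Real.pi / (X * R) ^ 2) * ξ ^ 2 = -(Real.pi / (X * R) ^ 2 * ξ ^ 2) +
      -(Real.pi / (X * R) ^ 2) * ξ ^ 2 := by ring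
    rw [e]; linarith

set_option maxHeartbeats 800000 in
/-- Energy decay: gaps plus decay of the averaged exponential sums on a middle range of frequencies
bound the averaged energy at scale `R` by that of a comparison family at scale `X * R`. -/
theorem sum_gaussEnergy_le {α β ω : Type*} (S : Finset α) (V : Finset ω) (t : ω → α → ℝ)
    (A : Finset β) (x : β → ℝ) {R X ρ κ H B : ℝ} (hR : 0 < R) (hX : 1 ≤ X) (hρ : 0 < ρ)
    (hρ1 : ρ ≤ 1) (hκ1 : κ ≤ 1) (hH : 0 ≤ H) (hB0 : 0 ≤ B)
    (hXρ : 2 * X ≤ Real.exp (Real.pi * (X ^ 2 - 1) * ρ ^ 2 / 4))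
    (hgap : ∀ v ∈ V, ∀ i ∈ S, ∃ y, |y - t v i| ≤ 2 / R ∧ ∀ j ∈ S, ρ / R ≤ |t v j - y|)
    (hB : ∀ ξ : ℝ, κ * R ≤ |ξ| → |ξ| ≤ H * (X * R) →
      ∑ v ∈ V, expSumSq S (t v) ξ ≤ B * expSumSq A x ξ)
    (habs : Real.pi ^ 2 * κ ^ 4 * Real.exp (2 * Real.pi) + Real.exp (-(Real.pi * H ^ 2)) * X ≤
      ρ * Real.exp (-(32 * Real.pi)) / 616) :
    ρ * Real.exp (-(32 * Real.pi)) * ∑ v ∈ V, gaussEnergy S (t v) R ≤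
      616 * (B * X * gaussEnergy A x (X * R)) := by
  have hp := Real.pi_pos
  have hXR : 0 < X * R := by positivity
  set Γ := ∑ v ∈ V, gaussEnergy S (t v) R with hΓ
  have hΓ0 : 0 ≤ Γ := Finset.sum_nonneg fun v _ => gaussEnergy_nonneg _ _ _
  set c₁ := Real.pi ^ 2 * κ ^ 4 * Real.exp (2 * Real.pi) with hc₁
  set c₂ := Real.exp (-(Real.pi * H ^ 2)) with hc₂
  have hc₁0 : 0 ≤ c₁ := by positivity
  have hc₂0 : 0 ≤ c₂ := by positivity
  have hb1 : 0 < 2 * Real.pi / R ^ 2 := by positivity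
  have hb2 : 0 < Real.pi / (X * R) ^ 2 := by positivity
  have hb3 : 0 < 2 * Real.pi / (X * R) ^ 2 := by positivity
  have hF : ∀ v ∈ V, ρ * R * Real.exp (-(32 * Real.pi)) * gaussEnergy S (t v) R ≤
      308 * ∫ ξ, (bumpHat (X * R) ξ - bumpHat R ξ) ^ 2 * expSumSq S (t v) ξ := by
    intro v hv
    have h1 := collCount_le_integral S (t v) hR hX hρ hρ1 hXρ (hgap v hv)
    rw [integral_sq_sum_bump S (t v) hR hXR] at h1
    have h2 := gaussEnergy_le_collCount S (t v) R
    calc _ ≤ ρ * R * Real.exp (-(32 * Real.pi)) * (11 * collCount S (t v) R) := by gcongr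
      _ = 11 * (ρ * R * Real.exp (-(32 * Real.pi)) * collCount S (t v) R) := by ring
      _ ≤ 11 * (28 * ∫ ξ, (bumpHat (X * R) ξ - bumpHat R ξ) ^ 2 * expSumSq S (t v) ξ) := by gcongr
      _ = _ := by ring
  have hI1 : ∀ v ∈ V, Integrable fun ξ =>
      c₁ * (Real.exp (-(2 * Real.pi / R ^ 2) * ξ ^ 2) * expSumSq S (t v) ξ) := fun v _ =>
    (integrable_exp_mul_expSumSq S (t v) hb1).const_mul _
  have hI2 : ∀ v ∈ V, Integrable fun ξ =>
      c₂ * (Real.exp (-(Real.pi / (X * R) ^ 2) * ξ ^ 2) * expSumSq S (t v) ξ) := fun v _ =>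
    (integrable_exp_mul_expSumSq S (t v) hb2).const_mul _
  have hI3 : Integrable fun ξ =>
      B * (Real.exp (-(2 * Real.pi / (X * R) ^ 2) * ξ ^ 2) * expSumSq A x ξ) :=
    (integrable_exp_mul_expSumSq A x hb3).const_mul _
  have hI12 : ∀ v ∈ V, Integrable fun ξ =>
      (c₁ * (Real.exp (-(2 * Real.pi / R ^ 2) * ξ ^ 2) * expSumSq S (t v) ξ) +
      c₂ * (Real.exp (-(Real.pi / (X * R) ^ 2) * ξ ^ 2) * expSumSq S (t v) ξ)) :=
    fun v hv => (hI1 v hv).add (hI2 v hv)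
  have hI0 : ∀ v ∈ V, Integrable fun ξ =>
      (bumpHat (X * R) ξ - bumpHat R ξ) ^ 2 * expSumSq S (t v) ξ := by
    intro v _
    refine (integrable_exp_mul_expSumSq S (t v) hb3).mono' ?_ ?_
    · apply Continuous.aestronglyMeasurable
      have := continuous_expSumSq S (t v)
      unfold bumpHat; fun_prop
    · refine Filter.Eventually.of_forall fun ξ => ?_
      have h1 := expSumSq_nonneg S (t v) ξ
      have h2 := (sq_bumpHat_sub_le (ξ := ξ) hR hX hκ1 hH).2.2
      rw [Real.norm_eq_abs, abs_of_nonneg (by positivity)]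
      gcongr
  have hpt : ∀ ξ, ∑ v ∈ V, (bumpHat (X * R) ξ - bumpHat R ξ) ^ 2 * expSumSq S (t v) ξ ≤
      (∑ v ∈ V, (c₁ * (Real.exp (-(2 * Real.pi / R ^ 2) * ξ ^ 2) * expSumSq S (t v) ξ) +
        c₂ * (Real.exp (-(Real.pi / (X * R) ^ 2) * ξ ^ 2) * expSumSq S (t v) ξ))) +
      B * (Real.exp (-(2 * Real.pi / (X * R) ^ 2) * ξ ^ 2) * expSumSq A x ξ) := by
    intro ξ
    obtain ⟨d1, d2, d3⟩ := sq_bumpHat_sub_le (ξ := ξ) hR hX hκ1 hH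
    have hA0 := expSumSq_nonneg A x ξ
    have hS0 := fun v => expSumSq_nonneg S (t v) ξ
    have hlast : 0 ≤ B * (Real.exp (-(2 * Real.pi / (X * R) ^ 2) * ξ ^ 2) * expSumSq A x ξ) := by
      positivity
    rcases d1 with d1 | d1
    · refine le_trans (Finset.sum_le_sum fun v _ => ?_) (le_add_of_nonneg_right hlast)
      have := mul_le_mul_of_nonneg_right d1 (hS0 v)
      have h2 : 0 ≤ c₂ * (Real.exp (-(Real.pi / (X * R) ^ 2) * ξ ^ 2) * expSumSq S (t v) ξ) := by
        have := hS0 v; positivity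
      linarith
    rcases d2 with d2 | d2
    · refine le_trans (Finset.sum_le_sum fun v _ => ?_) (le_add_of_nonneg_right hlast)
      have := mul_le_mul_of_nonneg_right d2 (hS0 v)
      have h2 : 0 ≤ c₁ * (Real.exp (-(2 * Real.pi / R ^ 2) * ξ ^ 2) * expSumSq S (t v) ξ) := by
        have := hS0 v; positivity
      linarith
    · have hfirst : 0 ≤ ∑ v ∈ V,
          (c₁ * (Real.exp (-(2 * Real.pi / R ^ 2) * ξ ^ 2) * expSumSq S (t v) ξ) +
          c₂ * (Real.exp (-(Real.pi / (X * R) ^ 2) * ξ ^ 2) * expSumSq S (t v) ξ)) :=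
        Finset.sum_nonneg fun v _ => by have := hS0 v; positivity
      refine le_trans ?_ (le_add_of_nonneg_left hfirst)
      rw [← Finset.mul_sum]
      have hS := Finset.sum_nonneg fun v (_ : v ∈ V) => hS0 v
      calc _ ≤ Real.exp (-(2 * Real.pi / (X * R) ^ 2) * ξ ^ 2) * (B * expSumSq A x ξ) :=
            mul_le_mul d3 (hB ξ d1 d2) hS (Real.exp_pos _).le
        _ = _ := by ring
  have hmain : ∑ v ∈ V, ∫ ξ, (bumpHat (X * R) ξ - bumpHat R ξ) ^ 2 * expSumSq S (t v) ξ ≤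
      c₁ * (R * Γ) + c₂ * (X * R * Γ) + B * (X * R * gaussEnergy A x (X * R)) := by
    rw [← integral_finset_sum _ hI0]
    refine (integral_mono (integrable_finset_sum _ hI0)
      ((integrable_finset_sum _ hI12).add hI3) hpt).trans ?_
    simp only [Pi.add_apply]
    rw [integral_add (integrable_finset_sum _ hI12) hI3, integral_finset_sum _ hI12,
      integral_const_mul, integral_exp_mul_expSumSq A x hXR]
    have hs2 : 1 ≤ Real.sqrt 2 := Real.one_le_sqrt.mpr (by norm_num)
    have hdiv : ∀ r : ℝ, 0 ≤ r → r / Real.sqrt 2 ≤ r := fun r hr => div_le_self hr hs2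
    have hg := gaussEnergy_nonneg A x (X * R)
    have h1 : ∑ v ∈ V, ∫ ξ, (c₁ * (Real.exp (-(2 * Real.pi / R ^ 2) * ξ ^ 2) * expSumSq S (t v) ξ) +
        c₂ * (Real.exp (-(Real.pi / (X * R) ^ 2) * ξ ^ 2) * expSumSq S (t v) ξ)) ≤
        ∑ v ∈ V, (c₁ * (R * gaussEnergy S (t v) R) + c₂ * (X * R * gaussEnergy S (t v) R)) := by
      apply Finset.sum_le_sum
      intro v hv
      have hgv := gaussEnergy_nonneg S (t v) R
      rw [integral_add (hI1 v hv) (hI2 v hv), integral_const_mul, integral_const_mul,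
        integral_exp_mul_expSumSq S (t v) hR]
      have h2 := integral_exp_mul_expSumSq_le S (t v) hXR
      have h3 := gaussEnergy_anti S (t v) hR.le (by nlinarith : R ≤ X * R)
      have h4 := hdiv R hR.le
      gcongr
      exact h2.trans (by gcongr)
    rw [Finset.sum_add_distrib, ← Finset.mul_sum, ← Finset.mul_sum, ← Finset.mul_sum,
      ← Finset.mul_sum] at h1
    have h5 := hdiv (X * R) hXR.le
    gcongr
  have h1 := Finset.sum_le_sum hF
  rw [← Finset.mul_sum, ← Finset.mul_sum] at h1
  have h2 : (c₁ + c₂ * X) * (R * Γ) ≤ ρ * Real.exp (-(32 * Real.pi)) / 616 * (R * Γ) := by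
    gcongr
  have h3 : R * (ρ * Real.exp (-(32 * Real.pi)) * Γ) ≤
      R * (616 * (B * X * gaussEnergy A x (X * R))) := by
    have e1 : 308 * (c₁ * (R * Γ) + c₂ * (X * R * Γ) + B * (X * R * gaussEnergy A x (X * R))) =
      308 * ((c₁ + c₂ * X) * (R * Γ)) + 308 * (B * (X * R * gaussEnergy A x (X * R))) := by ring
    have h4 := h1.trans (mul_le_mul_of_nonneg_left hmain (by norm_num : (0 : ℝ) ≤ 308))
    rw [e1] at h4
    linarith
  exact le_of_mul_le_mul_left h3 hR

theorem sum_binWords_succ {M : Type*} [AddCommMonoid M] (m : ℕ) (f : List Bool → M) :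
    ∑ v ∈ binWords (m + 1), f v =
      ∑ v ∈ binWords m, f (false :: v) + ∑ v ∈ binWords m, f (true :: v) := by
  have h : binWords (m + 1) = (binWords m).image (List.cons false) ∪
      (binWords m).image (List.cons true) := by
    ext v
    simp only [mem_binWords, Finset.mem_union, Finset.mem_image]
    constructor
    · intro hv
      match v, hv with
      | false :: w, hv => exact Or.inl ⟨w, by simpa using hv, rfl⟩
      | true :: w, hv => exact Or.inr ⟨w, by simpa using hv, rfl⟩
    · rintro (⟨w, hw, rfl⟩ | ⟨w, hw, rfl⟩) <;> simp [hw]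
  rw [h, Finset.sum_union, Finset.sum_image, Finset.sum_image]
  · intro a _ b _ h; simpa using h
  · intro a _ b _ h; simpa using h
  · rw [Finset.disjoint_left]
    intro v hv hv'
    obtain ⟨w, _, rfl⟩ := Finset.mem_image.mp hv
    obtain ⟨w', _, h⟩ := Finset.mem_image.mp hv'
    simp at h

theorem exists_phase_sum_cos (lam : ℝ) (m : ℕ) : ∀ y : ℝ, ∃ φ : ℝ, ∀ θ : ℝ,
    ∑ v ∈ binWords m, Real.cos (θ + 2 * Real.pi * y * codeSum lam v) =
      2 ^ m * (∏ j ∈ Finset.range m, Real.cos (Real.pi * (y / lam ^ j))) * Real.cos (θ + φ) := by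
  induction m with
  | zero =>
    intro y
    refine ⟨0, fun θ => ?_⟩
    have : binWords 0 = {[]} := by
      ext v; rw [mem_binWords, Finset.mem_singleton, List.length_eq_zero_iff]
    simp [this, codeSum]
  | succ m ih =>
    intro y
    obtain ⟨φ, hφ⟩ := ih (y / lam)
    refine ⟨φ + Real.pi * y, fun θ => ?_⟩
    rw [sum_binWords_succ]
    have e1 : ∀ v, θ + 2 * Real.pi * y * codeSum lam (false :: v) =
        θ + 2 * Real.pi * (y / lam) * codeSum lam v := by
      intro v; simp [codeSum]; ring
    have e2 : ∀ v, θ + 2 * Real.pi * y * codeSum lam (true :: v) =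
        (θ + 2 * Real.pi * y) + 2 * Real.pi * (y / lam) * codeSum lam v := by
      intro v; simp [codeSum]; ring
    simp only [e1, e2]
    rw [hφ, hφ, ← mul_add, Finset.prod_range_succ']
    have e3 : ∀ j, y / lam / lam ^ j = y / lam ^ (j + 1) := by
      intro j; rw [pow_succ', div_div]
    simp only [e3, pow_zero, div_one]
    have e4 : Real.cos (θ + φ) + Real.cos (θ + 2 * Real.pi * y + φ) =
        2 * Real.cos (Real.pi * y) * Real.cos (θ + (φ + Real.pi * y)) := by
      rw [Real.cos_add_cos]
      have a1 : (θ + φ + (θ + 2 * Real.pi * y + φ)) / 2 = θ + (φ + Real.pi * y) := by ring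
      have a2 : (θ + φ - (θ + 2 * Real.pi * y + φ)) / 2 = -(Real.pi * y) := by ring
      rw [a1, a2, Real.cos_neg]; ring
    rw [e4]; ring

theorem sum_cos_binWords_le (lam : ℝ) (m : ℕ) (y θ : ℝ) :
    ∑ v ∈ binWords m, Real.cos (θ + 2 * Real.pi * y * codeSum lam v) ≤
      2 ^ m * ∏ j ∈ Finset.range m, |Real.cos (Real.pi * (y / lam ^ j))| := by
  obtain ⟨φ, hφ⟩ := exists_phase_sum_cos lam m y
  rw [hφ]
  refine (le_abs_self _).trans ?_
  rw [abs_mul, abs_mul, Finset.abs_prod, abs_of_pos (by positivity : (0 : ℝ) < 2 ^ m)]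
  exact mul_le_of_le_one_right (by positivity) (Real.abs_cos_le_one _)

theorem expSumSq_prod {β κ : Type*} (A : Finset β) (I : Finset κ) (x : β → ℝ) (z : κ → ℝ) (ξ : ℝ) :
    expSumSq (A ×ˢ I) (fun p => x p.1 + z p.2) ξ = expSumSq A x ξ * expSumSq I z ξ := by
  rw [expSumSq_eq, expSumSq_eq, expSumSq_eq, ← mul_pow, ← norm_mul, Finset.sum_mul_sum,
    Finset.sum_product]
  congr 2
  apply Finset.sum_congr rfl; intro a _
  apply Finset.sum_congr rfl; intro i _
  rw [← Complex.exp_add]; congr 1; push_cast; ring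

/-- Averaging over digit blocks, exponential sums with separated slopes are small. -/
theorem sum_expSumSq_le {lam : ℝ} (h8 : 8 ≤ lam) {T : ℕ} (hT : 0 < T) :
    ∃ (G : ℕ) (C : ℝ), 0 < G ∧ 0 ≤ C ∧ ∀ (m k l : ℕ), m ≤ T * k → G * l ≤ m →
      ∀ (β κ : Type) (A : Finset β) (I : Finset κ) (x : β → ℝ) (τ σ : κ → ℝ) (ξ : ℝ),
      (∀ i ∈ I, ∀ j ∈ I, i ≠ j → 1 ≤ |ξ| * lam ^ m * |σ i - σ j|) →
      (∀ i ∈ I, ∀ j ∈ I, |ξ| * |σ i - σ j| ≤ 1) →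
      ∑ v ∈ binWords m,
          expSumSq (A ×ˢ I) (fun p => x p.1 + (τ p.2 + lam ^ m * σ p.2 * codeSum lam v)) ξ ≤
        2 ^ m * I.card * (I.card * (2 ^ l)⁻¹ + C * 2 ^ k) * expSumSq A x ξ := by
  obtain ⟨G, C, hG, hC, h⟩ := exists_sum_prod_cos_le h8 hT
  refine ⟨G, C, hG, hC, fun m k l hmk hl β κ A I x τ σ ξ hsep hbd => ?_⟩
  have hlm : 0 < lam ^ m := by positivity
  have e1 : ∀ v, expSumSq (A ×ˢ I)
      (fun p => x p.1 + (τ p.2 + lam ^ m * σ p.2 * codeSum lam v)) ξ =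
      expSumSq A x ξ * expSumSq I (fun i => τ i + lam ^ m * σ i * codeSum lam v) ξ := fun v =>
    expSumSq_prod A I x (fun i => τ i + lam ^ m * σ i * codeSum lam v) ξ
  simp only [e1]
  rw [← Finset.mul_sum, mul_comm]
  apply mul_le_mul_of_nonneg_right _ (expSumSq_nonneg A x ξ)
  simp only [expSumSq]
  rw [Finset.sum_comm]
  calc _ ≤ ∑ i ∈ I, 2 ^ m * (I.card * (2 ^ l)⁻¹ + C * 2 ^ k) := by
        apply Finset.sum_le_sum; intro i hi
        rw [Finset.sum_comm]
        set y : κ → ℝ := fun j => ξ * lam ^ m * (σ i - σ j) with hy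
        have hysep : ∀ j ∈ I, ∀ j' ∈ I, j ≠ j' → 1 ≤ |y j - y j'| := by
          intro j hj j' hj' hne
          have e : y j - y j' = ξ * lam ^ m * (σ j' - σ j) := by simp only [hy]; ring
          rw [e, abs_mul, abs_mul, abs_of_pos hlm]
          exact hsep j' hj' j hj hne.symm
        have hyinj : Set.InjOn y I := by
          intro j hj j' hj' hjj
          by_contra hne
          have := hysep j hj j' hj' hne
          rw [hjj, sub_self, abs_zero] at this
          linarith
        have h1 := h m k l hmk hl (I.image y)
          (by
            intro a ha b hb hab
            obtain ⟨j, hj, rfl⟩ := Finset.mem_image.mp ha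
            obtain ⟨j', hj', rfl⟩ := Finset.mem_image.mp hb
            exact hysep j hj j' hj' (fun e => hab (by rw [e])))
          (by
            intro a ha
            obtain ⟨j, hj, rfl⟩ := Finset.mem_image.mp ha
            simp only [hy]
            rw [abs_mul, abs_mul, abs_of_pos hlm]
            nlinarith [hbd i hi j hj])
        rw [Finset.sum_image hyinj, Finset.card_image_of_injOn hyinj] at h1
        calc _ ≤ ∑ j ∈ I, 2 ^ m * ∏ a ∈ Finset.range m, |Real.cos (Real.pi * (y j / lam ^ a))| := by
              apply Finset.sum_le_sum; intro j _
              refine le_trans (le_of_eq ?_)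
                (sum_cos_binWords_le lam m (y j) (2 * Real.pi * ξ * (τ i - τ j)))
              apply Finset.sum_congr rfl; intro v _
              congr 1; simp only [hy]; ring
          _ ≤ _ := by
              rw [← Finset.mul_sum]
              exact mul_le_mul_of_nonneg_left h1 (by positivity)
    _ = _ := by rw [Finset.sum_const, nsmul_eq_mul]; ring

section
variable {α : Type*} (S : Finset α) (t : α → ℝ)

theorem card_sq_le_mul_collCount (R : ℝ) {n : ℕ} (h : (S.image fun i => ⌊R * t i⌋).card ≤ n) :
    (S.card : ℝ) ^ 2 ≤ n * collCount S t R := by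
  rw [collCount_eq, Finset.card_eq_sum_card_image (fun i => ⌊R * t i⌋) S]
  push_cast
  refine (sq_sum_le_card_mul_sum_sq).trans ?_
  have : ((S.image fun i => ⌊R * t i⌋).card : ℝ) ≤ n := by exact_mod_cast h
  gcongr

theorem floor_eq_of_floor_mul_eq {R x y : ℝ} {p : ℕ} (hp : 0 < p)
    (h : ⌊p * R * x⌋ = ⌊p * R * y⌋) : ⌊R * x⌋ = ⌊R * y⌋ := by
  have key : ∀ z : ℝ, ⌊R * z⌋ = ⌊p * R * z⌋ / (p : ℤ) := by
    intro z
    rw [← Int.floor_div_natCast]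
    congr 1
    have : (p : ℝ) ≠ 0 := by positivity
    field_simp
  rw [key, key, h]

theorem sum_collCount_fiber {R : ℝ} {p : ℕ} (hp : 0 < p) :
    ∑ c ∈ S.image (fun i => ⌊R * t i⌋), collCount (S.filter fun i => ⌊R * t i⌋ = c) t (p * R) =
      collCount S t (p * R) := by
  rw [collCount, ← Finset.sum_fiberwise_of_maps_to (t := S.image (fun i => ⌊R * t i⌋))
    (g := fun i => ⌊R * t i⌋) (fun i hi => Finset.mem_image_of_mem _ hi)]
  apply Finset.sum_congr rfl; intro c _
  rw [collCount]
  apply Finset.sum_congr rfl; intro i hi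
  have hic := (Finset.mem_filter.mp hi).2
  rw [Finset.sum_filter]
  apply Finset.sum_congr rfl; intro j _
  by_cases hj : ⌊p * R * t i⌋ = ⌊p * R * t j⌋
  · have := floor_eq_of_floor_mul_eq hp hj
    rw [if_pos (by rw [← this, hic])]
  · rw [if_neg hj, ite_self]

theorem collCount_anti {R : ℝ} {p : ℕ} (hp : 0 < p) :
    collCount S t (p * R) ≤ collCount S t R := by
  apply Finset.sum_le_sum; intro i _
  apply Finset.sum_le_sum; intro j _
  split_ifs with h1 h2
  · exact le_rfl
  · exact absurd (floor_eq_of_floor_mul_eq hp h1) h2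
  · exact zero_le_one
  · exact le_rfl

theorem collCount_le_mul {R : ℝ} {p : ℕ} (hp : 0 < p) :
    collCount S t R ≤ p * collCount S t (p * R) := by
  rw [← sum_collCount_fiber S t hp, collCount_eq, Finset.mul_sum]
  apply Finset.sum_le_sum; intro c _
  apply card_sq_le_mul_collCount
  have hsub : ((S.filter fun i => ⌊R * t i⌋ = c).image fun i => ⌊p * R * t i⌋) ⊆
      Finset.Ico (p * c) (p * c + p) := by
    intro z hz
    obtain ⟨i, hi, rfl⟩ := Finset.mem_image.mp hz
    have hic := (Finset.mem_filter.mp hi).2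
    have h1 := Int.floor_le (R * t i)
    have h2 := Int.lt_floor_add_one (R * t i)
    rw [hic] at h1 h2
    have hp' : (0 : ℝ) < p := by exact_mod_cast hp
    rw [Finset.mem_Ico, Int.le_floor, Int.floor_lt, mul_assoc]
    push_cast
    constructor
    · gcongr
    · nlinarith
  refine (Finset.card_le_card hsub).trans ?_
  rw [Int.card_Ico]; simp

end

theorem exists_forall_le_of_sum_le {γ κ : Type*} (C : Finset γ) (hC : C.Nonempty) (Λ : Finset κ)
    (n : γ → ℝ) (hn : ∀ c ∈ C, 0 < n c) (e : κ → γ → ℝ) (a : κ → ℝ) (ha : ∀ l ∈ Λ, 0 < a l)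
    (he : ∀ l ∈ Λ, ∀ c ∈ C, 0 ≤ e l c)
    (h : ∀ l ∈ Λ, ∑ c ∈ C, e l c ≤ a l * ∑ c ∈ C, n c) :
    ∃ c ∈ C, ∀ l ∈ Λ, e l c ≤ Λ.card * a l * n c := by
  by_contra! hcon
  have hΛ : Λ.Nonempty := by
    obtain ⟨c, hc⟩ := hC
    obtain ⟨l, hl, _⟩ := hcon c hc
    exact ⟨l, hl⟩
  have hΛc : (0 : ℝ) < Λ.card := by exact_mod_cast hΛ.card_pos
  have h1 : ∀ c ∈ C, n c < ∑ l ∈ Λ, e l c / (Λ.card * a l) := by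
    intro c hc
    obtain ⟨l, hl, hlt⟩ := hcon c hc
    have := ha l hl
    calc n c < e l c / (Λ.card * a l) := by
          rw [lt_div_iff₀ (by positivity)]; linarith
      _ ≤ _ := Finset.single_le_sum (f := fun l => e l c / (Λ.card * a l))
          (fun l' hl' => div_nonneg (he l' hl' c hc) (by have := ha l' hl'; positivity)) hl
  have h2 := Finset.sum_lt_sum_of_nonempty hC h1
  rw [Finset.sum_comm] at h2
  have h3 : ∑ l ∈ Λ, ∑ c ∈ C, e l c / (Λ.card * a l) ≤ ∑ l ∈ Λ, (∑ c ∈ C, n c) / Λ.card := by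
    apply Finset.sum_le_sum; intro l hl
    have := ha l hl
    rw [← Finset.sum_div, div_le_div_iff₀ (by positivity) hΛc]
    have := mul_le_mul_of_nonneg_right (h l hl) hΛc.le
    linarith
  rw [Finset.sum_const, nsmul_eq_mul, mul_div_cancel₀ _ hΛc.ne'] at h3
  linarith

theorem card_sq_le_two_pow_mul_collCount {α : Type*} (S : Finset α) (t : α → ℝ)
    (ht : ∀ i ∈ S, |t i| ≤ 2) (k : ℕ) :
    (S.card : ℝ) ^ 2 ≤ 2 ^ (k + 3) * collCount S t (2 ^ k) := by
  have hcard : (S.image fun i => ⌊(2 : ℝ) ^ k * t i⌋).card ≤ 2 ^ (k + 3) := by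
    have hsub' : (S.image fun i => ⌊(2 : ℝ) ^ k * t i⌋) ⊆
        Finset.Ico (-(2 ^ (k + 2))) (2 ^ (k + 2) : ℤ) := by
      intro z hz
      obtain ⟨i, hi, rfl⟩ := Finset.mem_image.mp hz
      have h1 := abs_le.mp (ht i hi)
      have hp : (0 : ℝ) < 2 ^ k := by positivity
      have h2 : -(2 ^ (k + 2)) ≤ ⌊(2 : ℝ) ^ k * t i⌋ := by
        rw [Int.le_floor]; push_cast; rw [pow_add]; nlinarith
      have h3 : ⌊(2 : ℝ) ^ k * t i⌋ < 2 ^ (k + 2) := by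
        rw [Int.floor_lt]; push_cast; rw [pow_add]; nlinarith
      exact Finset.mem_Ico.mpr ⟨h2, h3⟩
    refine (Finset.card_le_card hsub').trans ?_
    rw [Int.card_Ico]
    have : (2 : ℤ) ^ (k + 2) - -2 ^ (k + 2) = ((2 ^ (k + 3) : ℕ) : ℤ) := by
      push_cast; rw [pow_succ 2 (k + 2)]; ring
    rw [this, Int.toNat_natCast]
  have := card_sq_le_mul_collCount S t (2 ^ k) hcard
  push_cast at this
  exact this

/-- A dyadic cell in which a finite family of points looks regular at prescribed scales. -/
theorem exists_zoom {ι : Type*} [Fintype ι] [Nonempty ι] (t : ι → ℝ) (ht : ∀ i, |t i| ≤ 2)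
    {K kmin lmax : ℕ} {D ζ : ℝ} (hζ : 0 < ζ)
    (hs : collCount Finset.univ t (2 ^ K) ≤ (Fintype.card ι : ℝ) ^ 2 * 2 ^ (-(D * K)))
    (hK : (lmax + kmin + 3 : ℝ) < ζ * K) (hK' : kmin + lmax ≤ K) (Λ : Finset ℕ)
    (hΛ : ∀ l ∈ Λ, l ≤ lmax) :
    ∃ k₀, kmin ≤ k₀ ∧ k₀ + lmax ≤ K ∧ ∃ S : Finset ι, S.Nonempty ∧
      (∀ i ∈ S, ∀ j ∈ S, ⌊(2 : ℝ) ^ k₀ * t i⌋ = ⌊(2 : ℝ) ^ k₀ * t j⌋) ∧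
      ∀ l ∈ Λ, collCount S t (2 ^ (k₀ + l)) ≤
        Λ.card * 2 ^ (-(max (D - ζ) 0 * l)) * (S.card : ℝ) ^ 2 := by
  set s : ℕ → ℝ := fun k => collCount Finset.univ t (2 ^ k) with hsdef
  set N : ℝ := (Fintype.card ι : ℝ) with hN
  have hN0 : 0 < N := by rw [hN]; exact_mod_cast Fintype.card_pos
  have hpow : ∀ k l : ℕ, (2 : ℝ) ^ (k + l) = ((2 ^ l : ℕ) : ℝ) * 2 ^ k := by
    intro k l; push_cast; rw [pow_add, mul_comm]
  have hanti : ∀ k l, s (k + l) ≤ s k := by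
    intro k l
    simp only [hsdef]; rw [hpow]
    exact collCount_anti _ t (by positivity)
  have hdouble : ∀ k l, s k ≤ 2 ^ l * s (k + l) := by
    intro k l
    simp only [hsdef]; rw [hpow]
    have := collCount_le_mul Finset.univ t (R := 2 ^ k) (p := 2 ^ l) (by positivity)
    push_cast at this ⊢
    exact this
  have hlow : ∀ k, N ^ 2 ≤ 2 ^ (k + 3) * s k := by
    intro k
    have := card_sq_le_two_pow_mul_collCount Finset.univ t (fun i _ => ht i) k
    rwa [Finset.card_univ] at this
  set D' := max (D - ζ) 0 with hD'
  have hD'0 : 0 ≤ D' := le_max_right _ _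
  have hk : ∃ k₀, kmin ≤ k₀ ∧ k₀ + lmax ≤ K ∧ ∀ l ≤ lmax, s (k₀ + l) ≤ 2 ^ (-(D' * l)) * s k₀ := by
    rcases hD'0.eq_or_lt with h0 | hpos
    · refine ⟨kmin, le_rfl, hK', fun l _ => ?_⟩
      rw [← h0]; simpa using hanti kmin l
    · have hDe : D' = D - ζ := by
        rcases max_choice (D - ζ) 0 with h | h
        · exact h
        · rw [hD', h] at hpos; exact absurd hpos (lt_irrefl _)
      obtain ⟨k₀, hk₀, hmax⟩ := Finset.exists_max_image (Finset.Icc kmin K)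
        (fun k => s k * (2 : ℝ) ^ (D' * k)) ⟨kmin, by rw [Finset.mem_Icc]; omega⟩
      rw [Finset.mem_Icc] at hk₀
      have hk₀K : k₀ + lmax ≤ K := by
        by_contra hlt
        push Not at hlt
        have h1 := hmax kmin (by rw [Finset.mem_Icc]; omega)
        have h2 : (1 : ℝ) ≤ 2 ^ (D' * kmin) := Real.one_le_rpow (by norm_num) (by positivity)
        have h3 := hdouble k₀ (K - k₀)
        rw [Nat.add_sub_cancel' hk₀.2] at h3
        have h4 : (2 : ℝ) ^ (K - k₀) ≤ 2 ^ lmax := by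
          gcongr
          · norm_num
          · omega
        have h5 : (2 : ℝ) ^ (D' * k₀) ≤ 2 ^ (D' * K) := by
          apply Real.rpow_le_rpow_of_exponent_le (by norm_num)
          have : (k₀ : ℝ) ≤ K := by exact_mod_cast hk₀.2
          gcongr
        have hs0 : ∀ k, 0 ≤ s k := fun k => collCount_nonneg _ _ _
        have h6 : N ^ 2 ≤ 2 ^ (kmin + 3) * (2 ^ lmax * (N ^ 2 * 2 ^ (-(D * K))) * 2 ^ (D' * K)) := by
          calc N ^ 2 ≤ 2 ^ (kmin + 3) * s kmin := hlow kmin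
            _ ≤ 2 ^ (kmin + 3) * (s kmin * 2 ^ (D' * kmin)) := by
                gcongr
                exact le_mul_of_one_le_right (hs0 _) h2
            _ ≤ 2 ^ (kmin + 3) * (s k₀ * 2 ^ (D' * k₀)) := by gcongr
            _ ≤ 2 ^ (kmin + 3) * (2 ^ lmax * (N ^ 2 * 2 ^ (-(D * K))) * 2 ^ (D' * K)) := by
                gcongr
                refine h3.trans ?_
                have := hs0 K
                gcongr
        have h7 : (2 : ℝ) ^ (kmin + 3) * (2 ^ lmax * (N ^ 2 * 2 ^ (-(D * K))) * 2 ^ (D' * K)) =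
            N ^ 2 * 2 ^ ((lmax + kmin + 3 : ℝ) - ζ * K) := by
          rw [← Real.rpow_natCast 2 (kmin + 3), ← Real.rpow_natCast 2 lmax]
          have : (2 : ℝ) ^ ((lmax + kmin + 3 : ℝ) - ζ * K) =
            2 ^ ((kmin + 3 : ℕ) : ℝ) * 2 ^ (lmax : ℝ) * 2 ^ (-(D * K)) * 2 ^ (D' * K) := by
            rw [← Real.rpow_add (by norm_num), ← Real.rpow_add (by norm_num),
              ← Real.rpow_add (by norm_num), hDe]
            congr 1; push_cast; ring
          rw [this]; ring
        rw [h7] at h6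
        have h8 : (2 : ℝ) ^ ((lmax + kmin + 3 : ℝ) - ζ * K) < 1 :=
          Real.rpow_lt_one_of_one_lt_of_neg (by norm_num) (by linarith)
        nlinarith [sq_pos_of_pos hN0]
      refine ⟨k₀, hk₀.1, hk₀K, fun l hl => ?_⟩
      have h1 := hmax (k₀ + l) (by rw [Finset.mem_Icc]; omega)
      push_cast at h1
      rw [mul_add, Real.rpow_add (by norm_num), ← mul_assoc, mul_right_comm] at h1
      have h2 := le_of_mul_le_mul_right h1 (by positivity)
      rw [Real.rpow_neg (by norm_num), ← div_eq_inv_mul, le_div_iff₀ (by positivity)]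
      exact h2
  obtain ⟨k₀, hk1, hk2, hk3⟩ := hk
  refine ⟨k₀, hk1, hk2, ?_⟩
  set C := Finset.univ.image (fun i => ⌊(2 : ℝ) ^ k₀ * t i⌋) with hC
  obtain ⟨c, hc, hcl⟩ := exists_forall_le_of_sum_le C
    (by rw [hC]; exact Finset.univ_nonempty.image _) Λ
    (fun c => ((Finset.univ.filter fun i => ⌊(2 : ℝ) ^ k₀ * t i⌋ = c).card : ℝ) ^ 2)
    (by
      intro c hc
      obtain ⟨i, -, hi⟩ := Finset.mem_image.mp hc
      have : 0 < (Finset.univ.filter fun i => ⌊(2 : ℝ) ^ k₀ * t i⌋ = c).card :=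
        Finset.card_pos.mpr ⟨i, by simpa using hi⟩
      positivity)
    (fun l c => collCount (Finset.univ.filter fun i => ⌊(2 : ℝ) ^ k₀ * t i⌋ = c) t (2 ^ (k₀ + l)))
    (fun l => 2 ^ (-(D' * l))) (fun l _ => by positivity) (fun l _ c _ => collCount_nonneg _ _ _)
    (by
      intro l hl
      rw [← collCount_eq, hpow, sum_collCount_fiber _ _ (by positivity), ← hpow]
      exact hk3 l (hΛ l hl))
  obtain ⟨i, -, hi⟩ := Finset.mem_image.mp hc
  refine ⟨Finset.univ.filter fun i => ⌊(2 : ℝ) ^ k₀ * t i⌋ = c, ⟨i, by simpa using hi⟩, ?_, hcl⟩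
  intro i hi j hj
  rw [(Finset.mem_filter.mp hi).2, (Finset.mem_filter.mp hj).2]

theorem NearU.mul {h k : SL2R} {t s e : ℝ} (hh : NearU h t e) (hk : NearU k s e)
    (ht : |t| ≤ 2) (hs : |s| ≤ 2) (he : e ≤ 1) : NearU (h * k) (t + s) (8 * e) := by
  have e0 : 0 ≤ e := (abs_nonneg _).trans hh.h00
  have ee : e * e ≤ e := by nlinarith
  obtain ⟨a1, a2, a3, a4⟩ := hh
  obtain ⟨b1, b2, b3, b4⟩ := hk
  have c1 := abs_mul_le_mul a1 b1
  have c2 := abs_mul_le_mul a2 b3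
  have c2' := abs_mul_le_mul ht b3
  have c3 := abs_mul_le_mul a1 b2
  have c3' := abs_mul_le_mul a1 hs
  have c4 := abs_mul_le_mul a2 b4
  have c4' := abs_mul_le_mul ht b4
  have c5 := abs_mul_le_mul a3 b1
  have c6 := abs_mul_le_mul a4 b3
  have c7 := abs_mul_le_mul a3 b2
  have c7' := abs_mul_le_mul a3 hs
  have c8 := abs_mul_le_mul a4 b4
  rw [abs_le] at *
  constructor <;>
    simp only [SL2R.mul00, SL2R.mul01, SL2R.mul10, SL2R.mul11, abs_le] <;> constructor <;> linarith

/-- Conjugating a nearly unipotent matrix by the matrix of a word stretches it. -/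
theorem NearU.wordMat_conj {lam : ℝ} (h8 : 8 ≤ lam) (u : List Bool) {h : SL2R} {d e : ℝ}
    (hh : NearU h d e) :
    NearU (wordMat lam u * h * (wordMat lam u)⁻¹) (lam ^ u.length * d)
      (9 * (lam ^ u.length * e)) := by
  have hl0 : 0 < lam := by linarith
  have hs0 := codeSum_nonneg (by linarith : 2 ≤ lam) u
  have hs2 := codeSum_le (by linarith : 2 ≤ lam) u
  obtain ⟨c0, c1, c2, c3⟩ := upT_conj (u.length * (Real.log lam / 2)) (codeSum lam u) h
  rw [exp_word hl0] at c1
  rw [Real.exp_neg, exp_word hl0] at c2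
  have hL : 1 ≤ lam ^ u.length := one_le_pow₀ (by linarith)
  set s := codeSum lam u
  set L := lam ^ u.length
  have e0 : 0 ≤ e := (abs_nonneg _).trans hh.h00
  have hs' : |s| ≤ 2 := by rw [abs_of_nonneg hs0]; exact hs2
  have hs4 : |s ^ 2| ≤ 4 := by rw [abs_of_nonneg (sq_nonneg s)]; nlinarith
  have hLe : e ≤ L * e := le_mul_of_one_le_left e0 hL
  obtain ⟨a1, a2, a3, a4⟩ := hh
  have d1 := abs_mul_le_mul hs' a3
  have d2 := abs_mul_le_mul hs' a1
  have d3 := abs_mul_le_mul hs' a4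
  have d4 := abs_mul_le_mul hs4 a3
  unfold wordMat
  constructor
  · rw [c0, show h 0 0 - s * h 1 0 - 1 = (h 0 0 - 1) - s * h 1 0 by ring]
    refine (abs_sub _ _).trans ?_; linarith
  · rw [c1, show L * (h 0 1 + s * (h 0 0 - h 1 1) - s ^ 2 * h 1 0) - L * d =
      L * ((h 0 1 - d) + s * (h 0 0 - 1) - s * (h 1 1 - 1) - s ^ 2 * h 1 0) by ring, abs_mul,
      abs_of_nonneg (by linarith : 0 ≤ L), show 9 * (L * e) = L * (9 * e) by ring]
    gcongr
    rw [abs_le] at *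
    constructor <;> linarith
  · rw [c2, abs_mul, abs_of_nonneg (by positivity)]
    have : L⁻¹ ≤ 1 := inv_le_one_of_one_le₀ hL
    have := mul_le_mul this a3 (abs_nonneg _) zero_le_one
    linarith
  · rw [c3, show h 1 1 + s * h 1 0 - 1 = (h 1 1 - 1) + s * h 1 0 by ring]
    refine (abs_add_le _ _).trans ?_; linarith

theorem codeSum_cons_replicate_append (lam : ℝ) (s : Bool) (m : ℕ) (v : List Bool) :
    codeSum lam (s :: List.replicate m false ++ v) =
      (if s then 1 else 0) + codeSum lam v / lam ^ (m + 1) := by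
  rw [codeSum_append]
  simp [codeSum, codeSum_replicate_false]

/-- Conjugating a nearly unipotent matrix by the matrix of `s 0 ⋯ 0 v`. -/
theorem nearU_conj_second {lam : ℝ} (h8 : 8 ≤ lam) (s : Bool) {m : ℕ} {v : List Bool}
    (hv : v.length = m + 1) {k : SL2R} {θ : ℝ} (h0 : |k 0 0 - 1| ≤ θ) (h1 : |k 1 1 - 1| ≤ θ)
    (h2 : |k 1 0| ≤ θ) :
    NearU (wordMat lam (s :: List.replicate m false ++ v) * k *
        (wordMat lam (s :: List.replicate m false ++ v))⁻¹)
      (lam ^ (m + 1 + (m + 1)) * (k 0 1 + (if s then 1 else 0) * (k 0 0 - k 1 1) -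
        (if s then 1 else 0) * k 1 0) + lam ^ (m + 1) * (k 0 0 - k 1 1 -
          2 * (if s then 1 else 0) * k 1 0) * codeSum lam v) (4 * θ) := by
  have hl0 : 0 < lam := by linarith
  set u := s :: List.replicate m false ++ v with hu
  have hul : u.length = m + 1 + (m + 1) := by
    simp [hu, hv]; omega
  have hs0 := codeSum_nonneg (by linarith : 2 ≤ lam) u
  have hs2 := codeSum_le (by linarith : 2 ≤ lam) u
  have hc0 := codeSum_nonneg (by linarith : 2 ≤ lam) v
  have hc2 := codeSum_le (by linarith : 2 ≤ lam) v
  have hcode := codeSum_cons_replicate_append lam s m v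
  rw [← hu] at hcode
  obtain ⟨c0, c1, c2, c3⟩ := upT_conj (u.length * (Real.log lam / 2)) (codeSum lam u) k
  rw [exp_word hl0] at c1
  rw [Real.exp_neg, exp_word hl0] at c2
  have e0 : 0 ≤ θ := (abs_nonneg _).trans h0
  have d1 := abs_mul_le_mul (by rwa [abs_of_nonneg hs0] : |codeSum lam u| ≤ 2) h2
  unfold wordMat
  constructor
  · rw [c0, show k 0 0 - codeSum lam u * k 1 0 - 1 = (k 0 0 - 1) - codeSum lam u * k 1 0 by ring]
    refine (abs_sub _ _).trans ?_; linarith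
  · rw [c1, hul, hcode]
    have hb : (if s then (1 : ℝ) else 0) ^ 2 = if s then 1 else 0 := by split_ifs <;> norm_num
    set b : ℝ := if s then 1 else 0
    set L := lam ^ (m + 1) with hL
    have hL0 : 0 < L := by positivity
    have : lam ^ (m + 1 + (m + 1)) = L * L := by rw [hL, pow_add]
    rw [this]
    have key : L * L * (k 0 1 + (b + codeSum lam v / L) * (k 0 0 - k 1 1) -
        (b + codeSum lam v / L) ^ 2 * k 1 0) -
        (L * L * (k 0 1 + b * (k 0 0 - k 1 1) - b * k 1 0) +
          L * (k 0 0 - k 1 1 - 2 * b * k 1 0) * codeSum lam v) =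
        -(codeSum lam v ^ 2 * k 1 0) := by
      field_simp
      rw [← sub_eq_zero]
      linear_combination (-(L ^ 2) * k 1 0) * hb
    rw [key, abs_neg]
    exact abs_mul_le_mul (by rw [abs_of_nonneg (sq_nonneg _)]; nlinarith) h2
  · rw [c2, abs_mul, abs_of_nonneg (by positivity)]
    have hL : 1 ≤ lam ^ u.length := one_le_pow₀ (by linarith)
    have : (lam ^ u.length)⁻¹ ≤ 1 := inv_le_one_of_one_le₀ hL
    have := mul_le_mul this h2 (abs_nonneg _) zero_le_one
    linarith
  · rw [c3, show k 1 1 + codeSum lam u * k 1 0 - 1 = (k 1 1 - 1) + codeSum lam u * k 1 0 by ring]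
    refine (abs_add_le _ _).trans ?_; linarith

/-- Extending a word which almost reaches `Z₀` by a return word and a free word. -/
theorem extend_point {lam : ℝ} (h8 : 8 ≤ lam) {g Z₀ M₀ M h : SL2R} {w ω v : List Bool}
    {γ γω : SL2Z} {d e θ E : ℝ} {kst m : ℕ}
    (hw : wordMat lam w * g * intEmb γ = h * Z₀) (hh : NearU h d e)
    (hM : M = wordMat lam ω * (upT (kst * (Real.log lam / 2)) 0 * Z₀) * intEmb γω)
    (h0 : |(M * M₀⁻¹) 0 0 - 1| ≤ θ) (h1 : |(M * M₀⁻¹) 1 1 - 1| ≤ θ) (h2 : |(M * M₀⁻¹) 1 0| ≤ θ)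
    (s : Bool) (hv : v.length = m + 1) {k : ℕ} (hk : k = kst + ω.length + (m + 1 + (m + 1)))
    (hE1 : 9 * (lam ^ k * e) ≤ E) (hE2 : 4 * θ ≤ E) (hE : E ≤ 1) {p : ℝ}
    (hp : p = lam ^ (m + 1 + (m + 1)) * ((M * M₀⁻¹) 0 1 +
      (if s then 1 else 0) * ((M * M₀⁻¹) 0 0 - (M * M₀⁻¹) 1 1) -
        (if s then 1 else 0) * (M * M₀⁻¹) 1 0) + lam ^ (m + 1) * ((M * M₀⁻¹) 0 0 -
        (M * M₀⁻¹) 1 1 - 2 * (if s then 1 else 0) * (M * M₀⁻¹) 1 0) * codeSum lam v)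
    (hd : |lam ^ k * d| ≤ 2) (hp2 : |p| ≤ 2) :
    ∃ (w' : List Bool) (γ' : SL2Z) (h' : SL2R), w'.length = w.length + k ∧
      wordMat lam w' * g * intEmb γ' =
        h' * (wordMat lam (s :: List.replicate m false ++ v) * M₀) ∧
      NearU h' (lam ^ k * d + p) (8 * E) := by
  have hl0 : 0 < lam := by linarith
  set V := s :: List.replicate m false ++ v with hV
  have hVl : V.length = m + 1 + (m + 1) := by
    simp [hV, hv]; omega
  set B := List.replicate kst false ++ (ω ++ V) with hB
  have hBl : B.length = k := by simp only [hB, List.length_append, List.length_replicate, hVl]; omega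
  have hBm : wordMat lam B = wordMat lam V * wordMat lam ω *
      upT (kst * (Real.log lam / 2)) 0 := by
    rw [hB, wordMat_append hl0, wordMat_append hl0]
    congr 1
    rw [wordMat, codeSum_replicate_false, List.length_replicate]
  have n1 := hh.wordMat_conj h8 B
  rw [hBl] at n1
  have n2 := nearU_conj_second h8 s hv h0 h1 h2
  rw [← hp, ← hV] at n2
  refine ⟨w ++ B, γ * γω, _, by simp [hBl], ?_,
    (n1.mono hE1).mul (n2.mono hE2) hd hp2 hE⟩
  have hMZ : wordMat lam ω * upT (kst * (Real.log lam / 2)) 0 * Z₀ * intEmb γω = M := by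
    rw [hM]; group
  rw [wordMat_append hl0, map_mul]
  calc wordMat lam B * wordMat lam w * g * (intEmb γ * intEmb γω) =
      wordMat lam B * (wordMat lam w * g * intEmb γ) * intEmb γω := by group
    _ = wordMat lam B * h * Z₀ * intEmb γω := by rw [hw]; group
    _ = wordMat lam B * h * (wordMat lam B)⁻¹ * wordMat lam V *
        (wordMat lam ω * upT (kst * (Real.log lam / 2)) 0 * Z₀ * intEmb γω) := by
      rw [hBm]; group
    _ = _ := by rw [hMZ]; group

theorem upT_zero_add {lam : ℝ} (n k : ℕ) :
    upT ((n + k : ℕ) * (Real.log lam / 2)) 0 =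
      upT (n * (Real.log lam / 2)) 0 * upT (k * (Real.log lam / 2)) 0 := by
  rw [upT_mul]
  congr 1
  · push_cast; ring
  · simp

/-- Returns to a common small box with many separated slopes at a suitable scale. -/
theorem exists_branching_returns {lam : ℝ} (h8 : 8 ≤ lam) {lb : ℕ} (hlb : 0 < lb)
    (hlam : lam ≤ 2 ^ lb) {E q n₁ Q j₀ A n J : ℕ} (hE : 0 < E) (hq : 0 < q) (hn₁ : 8 * n₁ ≤ q)
    (hQ : Q = 16 * lb * E * q) (hj₀ : j₀ = 2 * lb + 2) (hA : A = 8 * (j₀ + 5)) (hn : n = A * Q)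
    (hJ : J = 3 * lb * A + 1) {Z₀ : SL2R} {k' : ℕ}
    (hP : SysGT (2 ^ n₁)⁻¹ (upT (k' * (Real.log lam / 2)) 0 * Z₀))
    (hw : ∀ w : List Bool, w.length = n →
      SysGT (2 ^ n₁)⁻¹ (wordMat lam w * (upT ((n + k' : ℕ) * (Real.log lam / 2)) 0 * Z₀))) :
    ∃ j, j₀ ≤ j ∧ j < J ∧ ∃ (I : Finset (List Bool)) (M : List Bool → SL2R) (M₀ : SL2R) (s : Bool),
      2 ^ (E * q) < 8 * I.card ∧
      (∀ w ∈ I, w.length = n ∧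
        (∃ γ, M w = wordMat lam w * (upT ((n + k' : ℕ) * (Real.log lam / 2)) 0 * Z₀) * intEmb γ) ∧
        |(M w * M₀⁻¹) 0 1| ≤ (2 ^ (j₀ * Q))⁻¹ ∧
        |(M w * M₀⁻¹) 0 0 - 1| ≤ 4 * (2 ^ (j * Q))⁻¹ ∧
        |(M w * M₀⁻¹) 1 1 - 1| ≤ 4 * (2 ^ (j * Q))⁻¹ ∧
        |(M w * M₀⁻¹) 1 0| ≤ 4 * (2 ^ (j * Q))⁻¹) ∧
      ∀ i ∈ I, ∀ i' ∈ I, i ≠ i' → (2 ^ ((j + 1) * Q))⁻¹ ≤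
        |((M i * M₀⁻¹) 0 0 - (M i * M₀⁻¹) 1 1 - 2 * (if s then 1 else 0) * (M i * M₀⁻¹) 1 0) -
        ((M i' * M₀⁻¹) 0 0 - (M i' * M₀⁻¹) 1 1 - 2 * (if s then 1 else 0) * (M i' * M₀⁻¹) 1 0)| := by
  have hQq : 16 * q ≤ Q := by
    rw [hQ]
    have : 1 ≤ lb * E := Nat.mul_pos hlb hE
    calc 16 * q = 16 * 1 * q := by ring
      _ ≤ 16 * (lb * E) * q := by gcongr
      _ = _ := by ring
  have hQ16 : 16 ≤ Q := by omega
  have hjQ : 4 * Q ≤ j₀ * Q := by gcongr; omega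
  have hl0 : 0 < lam := by linarith
  obtain ⟨W, M, hcard, hW, hWW⟩ := exists_close_returns (lam := lam) (ε := (2 ^ n₁)⁻¹)
    (η := (2 ^ (j₀ * Q))⁻¹) (n := n) (b := 2 ^ (j₀ * Q + 2 * n₁ + 5)) h8 (by positivity)
    (inv_le_one_of_one_le₀ (one_le_pow₀ (by norm_num))) (by positivity)
    (by
      rw [one_div]
      gcongr
      calc (16 : ℝ) = 2 ^ 4 := by norm_num
        _ ≤ 2 ^ (j₀ * Q) := by gcongr; norm_num; omega)
    hP
    (by
      have h1 : (2 : ℝ) ^ n ≤ lam ^ n := by gcongr; linarith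
      have h2 : (16 : ℝ) ≤ ((2 ^ n₁)⁻¹) ^ 2 * 2 ^ n := by
        have : n = 2 * n₁ + (n - 2 * n₁) := by
          have : Q ≤ n := by rw [hn]; exact Nat.le_mul_of_pos_left _ (by omega)
          omega
        rw [this, pow_add, pow_mul', inv_pow, inv_mul_cancel_left₀ (by positivity)]
        calc (16 : ℝ) = 2 ^ 4 := by norm_num
          _ ≤ 2 ^ (n - 2 * n₁) := by
            gcongr; norm_num
            have : Q ≤ n := by rw [hn]; exact Nat.le_mul_of_pos_left _ (by omega)
            omega
      refine h2.trans ?_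
      gcongr)
    (fun w hwn => by
      have := hw w hwn
      rwa [upT_zero_add, mul_assoc (upT _ _)] at this)
    (by
      push_cast
      rw [div_le_iff₀ (by positivity), pow_add, pow_add, pow_mul']
      apply le_of_eq
      field_simp; norm_num; ring)
  have hlt : 9 * (2 ^ (E * q) * 2 ^ (E * q)) ^ (J - j₀) < W.card := by
    by_contra hcon
    push Not at hcon
    have h1 : 2 ^ n ≤ 2 ^ (4 * (j₀ * Q + 2 * n₁ + 5) + 4 + 2 * (E * q) * J) := by
      calc 2 ^ n ≤ (2 ^ (j₀ * Q + 2 * n₁ + 5)) ^ 4 * W.card := hcard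
        _ ≤ (2 ^ (j₀ * Q + 2 * n₁ + 5)) ^ 4 * (2 ^ 4 * (2 ^ (E * q) * 2 ^ (E * q)) ^ J) := by
            gcongr
            refine hcon.trans ?_
            gcongr
            · norm_num
            · exact Nat.one_le_iff_ne_zero.mpr (by positivity)
            · omega
        _ = _ := by rw [← pow_add, ← two_mul, ← pow_mul, ← pow_mul]; ring
    have h2 := (Nat.pow_le_pow_iff_right (by norm_num)).mp h1
    have h3 : 2 * (E * q) * J * 8 ≤ (3 * A + 1) * Q := by
      rw [hJ, hQ]
      calc 2 * (E * q) * (3 * lb * A + 1) * 8 = (3 * lb * A + 1) * (16 * (E * q)) := by ring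
        _ ≤ (3 * lb * A + lb) * (16 * (E * q)) := by gcongr; omega
        _ = _ := by ring
    have h4 : n = 8 * (j₀ * Q) + 40 * Q := by rw [hn, hA]; ring
    have h5 : (3 * A + 1) * Q = 24 * (j₀ * Q) + 121 * Q := by rw [hA]; ring
    omega
  obtain ⟨j, hj1, hj2, I, hIS, i₀, hi₀, s, hs, hb, hent, hslope⟩ :=
    exists_separated_slopes (S := W) (M := M) (Q := Q) (j₀ := j₀) (J := J) (b := 2 ^ (E * q))
      (η := (2 ^ (j₀ * Q))⁻¹) (δ := (lam ^ (3 * n))⁻¹) rfl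
      (by
        rw [one_div]
        gcongr
        calc (16 : ℝ) = 2 ^ 4 := by norm_num
          _ ≤ 2 ^ (j₀ * Q) := by gcongr; norm_num; omega)
      (by
        have : j₀ * Q = Q + (j₀ * Q - Q) := by omega
        rw [this, pow_add, mul_inv, mul_inv_cancel_left₀ (by positivity), one_div]
        gcongr
        calc (64 : ℝ) = 2 ^ 6 := by norm_num
          _ ≤ _ := by gcongr; norm_num; omega)
      (by
        rw [hJ, hA, hj₀]
        have : 1 ≤ lb := hlb
        nlinarith)
      (fun w hw w' hw' => (hWW w hw w' hw').1)
      (fun w hw w' hw' hne => by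
        rw [inv_le_iff_one_le_mul₀ (by positivity), mul_comm]
        exact (hWW w hw w' hw').2 hne)
      (by
        have h1 : lam ^ (3 * n) ≤ 2 ^ (3 * lb * A * Q) := by
          calc lam ^ (3 * n) ≤ (2 ^ lb) ^ (3 * n) := by gcongr
            _ = _ := by rw [← pow_mul, hn]; ring_nf
        have h2 : (2 : ℝ) ^ (J * Q) = 2 ^ (3 * lb * A * Q) * 2 ^ Q := by
          rw [← pow_add, hJ]; ring_nf
        have h3 : (2 : ℝ) < 2 ^ Q := by
          calc (2 : ℝ) = 2 ^ 1 := by norm_num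
            _ < _ := by gcongr; norm_num; omega
        rw [h2, mul_inv, lt_inv_comm₀ (by positivity) (by positivity)]
        simp only [mul_inv, inv_inv]
        have : (0 : ℝ) < 2 ^ (3 * lb * A * Q) := by positivity
        nlinarith)
      hlt
  have hs' : s = if (decide (s = 1)) then 1 else 0 := by
    rcases hs with rfl | rfl <;> simp
  refine ⟨j, hj1, hj2, I, M, M i₀, decide (s = 1), hb, ?_, ?_⟩
  · intro w hwI
    obtain ⟨hl, γ, hγ⟩ := hW w (hIS hwI)
    refine ⟨hl, ⟨γ, ?_⟩, ?_, hent w hwI⟩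
    · rw [hγ, upT_zero_add, mul_assoc (upT _ _)]
    · simpa using (hWW w (hIS hwI) i₀ (hIS hi₀)).1.h01
  · rw [← hs']; exact hslope

/-- Every family can be refined, near one of its members, by return words. -/
theorem IsFam.exists_extension {lam : ℝ} (h8 : 8 ≤ lam) {lb : ℕ} (hlb : 0 < lb)
    (hlam : lam ≤ 2 ^ lb) {E q n₁ Q j₀ A n J : ℕ} (hE : 0 < E) (hq : 0 < q) (hn₁ : 8 * n₁ ≤ q)
    (hQ : Q = 16 * lb * E * q) (hj₀ : j₀ = 2 * lb + 2) (hA : A = 8 * (j₀ + 5)) (hn : n = A * Q)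
    (hJ : J = 3 * lb * A + 1) {ι : Type} {t : ι → ℝ} {g Z : SL2R} {N K L k₀ k₁ k' : ℕ}
    (hfam : IsFam lam g N (2 ^ K)⁻¹ t Z) (hno : NoExc lam L (2 ^ n₁)⁻¹ g) (hL : N + K ≤ L)
    {S : Finset ι} {i₀ : ι} (ht : ∀ i ∈ S, |t i - t i₀| ≤ (2 ^ k₀)⁻¹)
    (hk₁ : lam ^ k₁ ≤ 2 ^ k₀) (hk : k₁ = n + k' + n + (Q + Q)) (hK : k₀ + J * Q ≤ K) :
    ∃ j, j₀ ≤ j ∧ j < J ∧ ∃ (I : Finset (List Bool)) (τ σ : List Bool → ℝ),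
      2 ^ (E * q) < 8 * I.card ∧
      (∀ i ∈ I, |σ i| ≤ 16 * (2 ^ (j * Q))⁻¹) ∧
      (∀ i ∈ I, ∀ i' ∈ I, i ≠ i' → (2 ^ ((j + 1) * Q))⁻¹ ≤ |σ i - σ i'|) ∧
      ∀ v ∈ binWords Q, ∃ Z', IsFam lam g (N + k₁) (2 ^ 10 * (2 ^ (j * Q))⁻¹)
        (fun p : ↥(S ×ˢ I) => lam ^ k₁ * (t p.1.1 - t i₀) +
          (τ p.1.2 + lam ^ Q * σ p.1.2 * codeSum lam v)) Z' := by
  have hl0 : 0 < lam := by linarith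
  have hQq : 16 * q ≤ Q := by
    rw [hQ]
    have : 1 ≤ lb * E := Nat.mul_pos hlb hE
    calc 16 * q = 16 * 1 * q := by ring
      _ ≤ 16 * (lb * E) * q := by gcongr
      _ = _ := by ring
  have hQ16 : 16 ≤ Q := by omega
  have hk₁₀ : k₁ ≤ k₀ := by
    have h1 : (2 : ℝ) ^ k₁ ≤ 2 ^ k₀ := le_trans (by gcongr; linarith) hk₁
    exact (pow_le_pow_iff_right₀ (by norm_num)).mp h1
  choose w γ h hwl hw hh using hfam.orbit
  set Z₀ := wordMat lam (w i₀) * g * intEmb (γ i₀) with hZ₀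
  have hsys : ∀ u : List Bool, u.length + N ≤ L →
      SysGT (2 ^ n₁)⁻¹ (wordMat lam u * Z₀) := by
    intro u hu
    have := (hno (w i₀ ++ u) (by rw [List.length_append]; have := hwl i₀; omega)).mul_int (γ i₀)
    rw [wordMat_append hl0] at this
    rw [hZ₀]
    convert this using 1
    group
  have hup : ∀ (u : List Bool) (k : ℕ), wordMat lam (List.replicate k false ++ u) =
      wordMat lam u * upT (k * (Real.log lam / 2)) 0 := by
    intro u k
    rw [wordMat_append hl0]
    congr 1
    rw [wordMat, codeSum_replicate_false, List.length_replicate]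
  obtain ⟨j, hj1, hj2, I, M, M₀, s, hcard, hI, hslope⟩ :=
    exists_branching_returns h8 hlb hlam hE hq hn₁ hQ hj₀ hA hn hJ (Z₀ := Z₀) (k' := k')
      (by
        have := hsys (List.replicate k' false) (by rw [List.length_replicate]; omega)
        have e := hup [] k'
        simp only [List.append_nil] at e
        rw [e] at this
        have e1 : wordMat lam [] = 1 := by
          rw [wordMat]; apply SL2R_ext <;> simp [codeSum]
        rwa [e1, one_mul] at this)
      (by
        intro u hu
        have := hsys (List.replicate (n + k') false ++ u)
          (by rw [List.length_append, List.length_replicate]; omega)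
        rwa [hup, mul_assoc] at this)
  set b : ℝ := if s then 1 else 0 with hb
  have hbabs : |b| ≤ 1 := by rw [hb]; split_ifs <;> norm_num
  set m := Q - 1 with hm
  have hm1 : m + 1 = Q := by omega
  refine ⟨j, hj1, hj2, I,
    fun i => lam ^ (Q + Q) * ((M i * M₀⁻¹) 0 1 + b * ((M i * M₀⁻¹) 0 0 - (M i * M₀⁻¹) 1 1) -
      b * (M i * M₀⁻¹) 1 0),
    fun i => (M i * M₀⁻¹) 0 0 - (M i * M₀⁻¹) 1 1 - 2 * b * (M i * M₀⁻¹) 1 0, hcard, ?_, hslope, ?_⟩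
  · intro i hi
    obtain ⟨-, -, -, h1, h2, h3⟩ := hI i hi
    have h4 := abs_mul_le_mul hbabs h3
    rw [abs_le] at *
    constructor <;> linarith
  · intro v hv
    rw [mem_binWords] at hv
    have hθ0 : (0 : ℝ) < (2 ^ (j * Q))⁻¹ := by positivity
    have hjη : ((2 : ℝ) ^ (j * Q))⁻¹ ≤ (2 ^ (j₀ * Q))⁻¹ := by
      gcongr; norm_num
    have hlQ : lam ^ (Q + Q) * (2 ^ (j₀ * Q))⁻¹ ≤ (1 : ℝ) / 128 := by
      have h1 : lam ^ (Q + Q) ≤ 2 ^ (2 * lb * Q) := by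
        calc lam ^ (Q + Q) ≤ (2 ^ lb) ^ (Q + Q) := by gcongr
          _ = _ := by rw [← pow_mul]; ring_nf
      have h2 : (2 : ℝ) ^ (j₀ * Q) = 2 ^ (2 * lb * Q) * 2 ^ (2 * Q) := by
        rw [← pow_add, hj₀]; ring_nf
      have h3 : (128 : ℝ) ≤ 2 ^ (2 * Q) := by
        calc (128 : ℝ) = 2 ^ 7 := by norm_num
          _ ≤ _ := by gcongr; norm_num; omega
      rw [h2, mul_inv, ← mul_assoc]
      calc lam ^ (Q + Q) * (2 ^ (2 * lb * Q))⁻¹ * (2 ^ (2 * Q))⁻¹ ≤ 1 * 128⁻¹ := by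
            gcongr
            rw [mul_inv_le_iff₀ (by positivity), one_mul]; exact h1
        _ = _ := by norm_num
    have hlQ1 : lam ^ Q ≤ lam ^ (Q + Q) := by
      gcongr
      · linarith
      · omega
    have hp : ∀ i ∈ I, |lam ^ (Q + Q) * ((M i * M₀⁻¹) 0 1 + b * ((M i * M₀⁻¹) 0 0 -
        (M i * M₀⁻¹) 1 1) - b * (M i * M₀⁻¹) 1 0) + lam ^ Q * ((M i * M₀⁻¹) 0 0 - (M i * M₀⁻¹) 1 1 -
        2 * b * (M i * M₀⁻¹) 1 0) * codeSum lam v| ≤ 1 := by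
      intro i hi
      obtain ⟨-, -, h0, h1, h2, h3⟩ := hI i hi
      have hc0 := codeSum_nonneg (by linarith : 2 ≤ lam) v
      have hc2 := codeSum_le (by linarith : 2 ≤ lam) v
      have a1 : |(M i * M₀⁻¹) 0 1 + b * ((M i * M₀⁻¹) 0 0 -
        (M i * M₀⁻¹) 1 1) - b * (M i * M₀⁻¹) 1 0| ≤ 13 * (2 ^ (j₀ * Q))⁻¹ := by
        have h4 := abs_mul_le_mul hbabs h3
        have h5 := abs_mul_le_mul hbabs h1
        have h6 := abs_mul_le_mul hbabs h2
        rw [abs_le] at *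
        constructor <;> linarith
      have a2 : |(M i * M₀⁻¹) 0 0 - (M i * M₀⁻¹) 1 1 - 2 * b * (M i * M₀⁻¹) 1 0| ≤
          16 * (2 ^ (j₀ * Q))⁻¹ := by
        have h4 := abs_mul_le_mul hbabs h3
        rw [abs_le] at *
        constructor <;> linarith
      have a3 := abs_mul_le_mul (le_of_eq (abs_of_nonneg (by positivity : 0 ≤ lam ^ (Q + Q)))) a1
      have a4 := abs_mul_le_mul ((abs_of_nonneg (by positivity : 0 ≤ lam ^ Q)).le.trans hlQ1) a2
      have a5 := abs_mul_le_mul a4 ((abs_of_nonneg hc0).le.trans hc2)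
      refine (abs_add_le _ _).trans ((add_le_add a3 a5).trans ?_)
      linarith
    have ht1 : ∀ i ∈ S, |lam ^ k₁ * (t i - t i₀)| ≤ 1 := by
      intro i hi
      have := abs_mul_le_mul ((abs_of_nonneg (by positivity : 0 ≤ lam ^ k₁)).le.trans hk₁) (ht i hi)
      rwa [mul_inv_cancel₀ (by positivity)] at this
    refine ⟨wordMat lam (s :: List.replicate m false ++ v) * M₀, ?_, ?_⟩
    · rintro ⟨⟨i, u⟩, hiu⟩
      obtain ⟨hi, hu⟩ := Finset.mem_product.mp hiu
      have h1 := ht1 i hi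
      have h2 := hp u hu
      refine (abs_add_le _ _).trans ?_
      simp only at h1 h2 ⊢
      linarith
    · rintro ⟨⟨i, u⟩, hiu⟩
      obtain ⟨hi, hu⟩ := Finset.mem_product.mp hiu
      simp only at hi hu
      obtain ⟨hul, ⟨γω, hγω⟩, h0, h1, h2, h3⟩ := hI u hu
      have herr : ((2 : ℝ) ^ K)⁻¹ ≤ 1 := inv_le_one_of_one_le₀ (one_le_pow₀ (by norm_num))
      have hnear := (hh i).mul_inv (hh i₀) (hfam.bound i) (hfam.bound i₀) herr
      have hwi : wordMat lam (w i) * g * intEmb (γ i) = h i * (h i₀)⁻¹ * Z₀ := by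
        rw [hZ₀, hw i, hw i₀]; group
      have hE1 : 9 * (lam ^ k₁ * (8 * (2 ^ K)⁻¹)) ≤ 2 ^ 7 * ((2 : ℝ) ^ (j * Q))⁻¹ := by
        have e1 : (2 : ℝ) ^ k₀ * (2 ^ K)⁻¹ ≤ (2 ^ (j * Q))⁻¹ := by
          rw [mul_inv_le_iff₀ (by positivity), inv_mul_eq_div, le_div_iff₀ (by positivity), ← pow_add]
          gcongr
          · norm_num
          · have : j * Q ≤ J * Q := by gcongr
            omega
        have e2 : lam ^ k₁ * ((2 : ℝ) ^ K)⁻¹ ≤ 2 ^ k₀ * (2 ^ K)⁻¹ := by gcongr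
        linarith
      have hE3 : 2 ^ 7 * ((2 : ℝ) ^ (j * Q))⁻¹ ≤ 1 := by
        rw [mul_inv_le_iff₀ (by positivity), one_mul]
        gcongr
        · norm_num
        · have : 1 * Q ≤ j * Q := by gcongr; omega
          omega
      obtain ⟨w', γ', h', hl', hw', hn'⟩ := extend_point h8 hwi hnear hγω h1 h2 h3 s
        (v := v) (m := m) (by omega) (k := k₁) (by rw [hul, hm1]; omega) hE1 (by linarith) hE3
        (p := lam ^ (Q + Q) * ((M u * M₀⁻¹) 0 1 + b * ((M u * M₀⁻¹) 0 0 -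
          (M u * M₀⁻¹) 1 1) - b * (M u * M₀⁻¹) 1 0) + lam ^ Q * ((M u * M₀⁻¹) 0 0 -
          (M u * M₀⁻¹) 1 1 - 2 * b * (M u * M₀⁻¹) 1 0) * codeSum lam v)
        (by rw [hm1])
        ((ht1 i hi).trans (by norm_num)) ((hp u hu).trans (by norm_num))
      refine ⟨w', γ', h', by rw [hl']; have := hwl i; omega, hw', ?_⟩
      convert hn' using 1
      ring

theorem exists_pow_two_ge (x : ℝ) : ∃ c : ℕ, ∀ q ≥ c, x ≤ 2 ^ q := by
  obtain ⟨c, hc⟩ := pow_unbounded_of_one_lt x (by norm_num : (1 : ℝ) < 2)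
  exact ⟨c, fun q hq => hc.le.trans (by gcongr; norm_num)⟩

theorem two_mul_pow_le_exp {q : ℕ} (hq : 2 ≤ q) : 2 * (2 : ℝ) ^ (4 * q) ≤
    Real.exp (Real.pi * ((2 ^ (4 * q)) ^ 2 - 1) * ((2 ^ q)⁻¹) ^ 2 / 4) := by
  have h1 : (2 : ℝ) ^ (4 * q) = (2 ^ q) ^ 4 := by rw [← pow_mul]; ring_nf
  rw [h1]
  have hy : (4 : ℝ) ≤ 2 ^ q := by
    calc (4 : ℝ) = 2 ^ 2 := by norm_num
      _ ≤ _ := by gcongr; norm_num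
  set y : ℝ := 2 ^ q
  have hy0 : 0 < y := by linarith
  have h2 : 2 * y ^ 4 ≤ 3 * ((y ^ 4) ^ 2 - 1) * (y⁻¹) ^ 2 / 4 := by
    have e : 3 * ((y ^ 4) ^ 2 - 1) * (y⁻¹) ^ 2 / 4 = 3 * (y ^ 8 - 1) / (4 * y ^ 2) := by
      field_simp
    rw [e, le_div_iff₀ (by positivity)]
    have h3 : (16 : ℝ) ≤ y ^ 2 := by nlinarith
    have h4 : 16 * y ^ 6 ≤ y ^ 2 * y ^ 6 := by gcongr
    have h5 : 1 ≤ y ^ 6 := one_le_pow₀ (by linarith)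
    nlinarith
  have h3 : 3 * ((y ^ 4) ^ 2 - 1) * (y⁻¹) ^ 2 / 4 ≤
      Real.pi * ((y ^ 4) ^ 2 - 1) * (y⁻¹) ^ 2 / 4 := by
    have : 0 ≤ (y ^ 4) ^ 2 - 1 := by
      have : 1 ≤ (y ^ 4) ^ 2 := one_le_pow₀ (one_le_pow₀ (by linarith))
      linarith
    have := Real.pi_gt_three.le
    gcongr
  have := Real.add_one_le_exp (Real.pi * ((y ^ 4) ^ 2 - 1) * (y⁻¹) ^ 2 / 4)
  linarith

theorem exp_neg_pi_mul_le {q : ℕ} (hq : 3 ≤ q) :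
    Real.exp (-(Real.pi * (2 ^ q) ^ 2)) * 2 ^ (4 * q) ≤ ((2 : ℝ) ^ (4 * q))⁻¹ := by
  have h1 : (2 : ℝ) ^ (8 * q) ≤ Real.exp (Real.pi * (2 ^ q) ^ 2) := by
    have h2 : ((8 * q : ℕ) : ℝ) ≤ (2 ^ q) ^ 2 := by
      have : 8 * q ≤ (2 ^ q) ^ 2 := by
        have := q.lt_two_pow_self
        have h3 : 8 ≤ 2 ^ q := by
          calc 8 = 2 ^ 3 := by norm_num
            _ ≤ _ := by gcongr; norm_num
        nlinarith
      exact_mod_cast this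
    have h3 : (2 : ℝ) ≤ Real.exp 1 := by
      have := Real.add_one_le_exp 1; linarith
    calc (2 : ℝ) ^ (8 * q) ≤ (Real.exp 1) ^ (8 * q) := by gcongr
      _ = Real.exp ((8 * q : ℕ) : ℝ) := by rw [← Real.exp_nat_mul, mul_one]
      _ ≤ _ := by
        apply Real.exp_le_exp.mpr
        have := Real.pi_gt_three
        nlinarith [sq_nonneg ((2 : ℝ) ^ q)]
  rw [Real.exp_neg, ← div_eq_inv_mul, div_le_iff₀ (Real.exp_pos _), ← div_eq_inv_mul,
    le_div_iff₀ (by positivity), ← pow_add, show 4 * q + 4 * q = 8 * q by ring]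
  exact h1

theorem exists_absorb : ∃ c : ℕ, ∀ q ≥ c,
    Real.pi ^ 2 * ((2 ^ q)⁻¹) ^ 4 * Real.exp (2 * Real.pi) +
      Real.exp (-(Real.pi * (2 ^ q) ^ 2)) * 2 ^ (4 * q) ≤
      ((2 : ℝ) ^ q)⁻¹ * Real.exp (-(32 * Real.pi)) / 616 := by
  obtain ⟨c, hc⟩ := exists_pow_two_ge
    ((Real.pi ^ 2 * Real.exp (2 * Real.pi) + 1) * 616 * Real.exp (32 * Real.pi))
  refine ⟨c + 3, fun q hq => ?_⟩
  have h1 := exp_neg_pi_mul_le (q := q) (by omega)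
  have h2 := hc q (by omega)
  have h3 : (2 : ℝ) ^ (4 * q) = (2 ^ q) ^ 4 := by rw [← pow_mul]; ring_nf
  rw [h3] at h1 ⊢
  have hy : (1 : ℝ) ≤ 2 ^ q := one_le_pow₀ (by norm_num)
  set y : ℝ := 2 ^ q
  have hy0 : 0 < y := by linarith
  set w := Real.pi ^ 2 * Real.exp (2 * Real.pi) with hw
  have hw0 : 0 ≤ w := by positivity
  calc _ ≤ Real.pi ^ 2 * y⁻¹ ^ 4 * Real.exp (2 * Real.pi) + (y ^ 4)⁻¹ := by gcongr
    _ = (w + 1) * (y⁻¹) ^ 4 := by rw [hw, inv_pow]; ring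
    _ ≤ (w + 1) * (y⁻¹) ^ 2 := by
        have h5 : y⁻¹ ≤ 1 := inv_le_one_of_one_le₀ hy
        have h6 : y⁻¹ ^ 4 ≤ y⁻¹ ^ 2 := pow_le_pow_of_le_one (by positivity) h5 (by norm_num)
        gcongr
    _ ≤ _ := by
        rw [Real.exp_neg, le_div_iff₀ (by norm_num)]
        rw [show (w + 1) * y⁻¹ ^ 2 * 616 = y⁻¹ * (((w + 1) * 616) * y⁻¹) by ring]
        gcongr
        rw [mul_inv_le_iff₀ hy0, ← div_eq_inv_mul, le_div_iff₀ (Real.exp_pos _)]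
        exact h2

theorem exists_gaussEnergy_le {α β ω : Type*} (S : Finset α) {V : Finset ω} (hV : V.Nonempty)
    (t : ω → α → ℝ) (A : Finset β) (x : β → ℝ) {R B : ℝ} {q : ℕ} (hq : 2 ≤ q) (hR : 0 < R)
    (hB0 : 0 ≤ B)
    (hgap : ∀ v ∈ V, ∀ i ∈ S, ∃ y, |y - t v i| ≤ 2 / R ∧ ∀ j ∈ S, (2 ^ q)⁻¹ / R ≤ |t v j - y|)
    (hB : ∀ ξ : ℝ, (2 ^ q)⁻¹ * R ≤ |ξ| → |ξ| ≤ 2 ^ q * (2 ^ (4 * q) * R) →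
      ∑ v ∈ V, expSumSq S (t v) ξ ≤ V.card * B * expSumSq A x ξ)
    (habs : Real.pi ^ 2 * ((2 ^ q)⁻¹) ^ 4 * Real.exp (2 * Real.pi) +
      Real.exp (-(Real.pi * (2 ^ q) ^ 2)) * 2 ^ (4 * q) ≤
      ((2 : ℝ) ^ q)⁻¹ * Real.exp (-(32 * Real.pi)) / 616) :
    ∃ v ∈ V, gaussEnergy S (t v) R ≤
      616 * Real.exp (32 * Real.pi) * 2 ^ (5 * q) * B * gaussEnergy A x R := by
  have hX : (1 : ℝ) ≤ 2 ^ (4 * q) := one_le_pow₀ (by norm_num)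
  have h1 : ((2 : ℝ) ^ q)⁻¹ ≤ 1 := inv_le_one_of_one_le₀ (one_le_pow₀ (by norm_num))
  have h := sum_gaussEnergy_le S V t A x (R := R) (X := 2 ^ (4 * q)) (ρ := (2 ^ q)⁻¹)
    (κ := (2 ^ q)⁻¹) (H := 2 ^ q) (B := V.card * B) hR hX (by positivity) h1 h1 (by positivity)
    (by positivity) (two_mul_pow_le_exp hq) hgap hB habs
  have hanti : gaussEnergy A x (2 ^ (4 * q) * R) ≤ gaussEnergy A x R :=
    gaussEnergy_anti A x hR.le (le_mul_of_one_le_left hR.le hX)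
  have hVc : (0 : ℝ) < V.card := by exact_mod_cast hV.card_pos
  have h2 : ∑ v ∈ V, gaussEnergy S (t v) R ≤
      ∑ _v ∈ V, 616 * Real.exp (32 * Real.pi) * 2 ^ (5 * q) * B * gaussEnergy A x R := by
    rw [Finset.sum_const, nsmul_eq_mul]
    rw [Real.exp_neg, mul_assoc, inv_mul_le_iff₀ (by positivity),
      inv_mul_le_iff₀ (Real.exp_pos _)] at h
    refine h.trans ?_
    have : (2 : ℝ) ^ (5 * q) = 2 ^ q * 2 ^ (4 * q) := by rw [← pow_add]; ring_nf
    rw [this]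
    calc _ ≤ Real.exp (32 * Real.pi) * (2 ^ q * (616 * (V.card * B * 2 ^ (4 * q) *
        gaussEnergy A x R))) := by gcongr
      _ = _ := by ring
  exact Finset.exists_le_of_sum_le hV h2

/-- There is a family, reached by words of length at most `N`, which has collision dimension
at least `D` at scale `2⁻ᴷ`. -/
def HasConcFam (lam : ℝ) (g : SL2R) (N K : ℕ) (D : ℝ) : Prop :=
  ∃ (ι : Type) (_ : Fintype ι) (_ : Nonempty ι) (t : ι → ℝ) (Z : SL2R),
    IsFam lam g N (2 ^ K)⁻¹ t Z ∧
      collCount Finset.univ t (2 ^ K) ≤ (Fintype.card ι : ℝ) ^ 2 * 2 ^ (-(D * K))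

theorem IsFam.mono {lam : ℝ} {g Z : SL2R} {N N' : ℕ} {e e' : ℝ} {ι : Type} {t : ι → ℝ}
    (h : IsFam lam g N e t Z) (hN : N ≤ N') (he : e ≤ e') : IsFam lam g N' e' t Z := by
  refine ⟨h.bound, fun i => ?_⟩
  obtain ⟨w, γ, k, h1, h2, h3⟩ := h.orbit i
  exact ⟨w, γ, k, h1.trans hN, h2, h3.mono he⟩

theorem collCount_coe {α : Type*} (s : Finset α) (f : α → ℝ) (R : ℝ) :
    collCount Finset.univ (fun p : ↥s => f p) R = collCount s f R := by
  simp only [collCount]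
  rw [← Finset.sum_coe_sort s]
  apply Finset.sum_congr rfl; intro i _
  rw [← Finset.sum_coe_sort s]

theorem gaussEnergy_mul_sub {α : Type*} (S : Finset α) (t : α → ℝ) (c d R : ℝ) :
    gaussEnergy S (fun i => c * (t i - d)) R = gaussEnergy S t (c * R) := by
  simp only [gaussEnergy]
  apply Finset.sum_congr rfl; intro i _
  apply Finset.sum_congr rfl; intro j _
  congr 1; ring

theorem IsFam.exists_gap_pow {lam err : ℝ} (h8 : 8 ≤ lam) {lb : ℕ} (hlam : lam ≤ 2 ^ lb)
    {L N q n₁ K : ℕ} {g Z : SL2R} {ι : Type} {t : ι → ℝ} (hno : NoExc lam L (2 ^ n₁)⁻¹ g)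
    (hfam : IsFam lam g N err t Z) (hn₁ : 8 * n₁ ≤ q) (hq : 24 + 4 * lb ≤ q)
    (hL : N + (K + 12 + 2 * lb + 4 * n₁) ≤ L) (herr : err ≤ (2 ^ (q + 6 + K))⁻¹) (i₀ : ι) :
    ∃ x, |x - t i₀| ≤ 2 / (2 ^ K : ℝ) ∧ ∀ i, ((2 : ℝ) ^ q)⁻¹ / 2 ^ K ≤ |t i - x| := by
  have hl0 : 0 < lam := by linarith
  have hlam2 : lam ^ 2 ≤ 2 ^ (2 * lb) := by
    calc lam ^ 2 ≤ (2 ^ lb) ^ 2 := by gcongr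
      _ = _ := by rw [← pow_mul, mul_comm]
  have h4 : (((2 : ℝ) ^ n₁)⁻¹) ^ 4 = (2 ^ (4 * n₁))⁻¹ := by rw [inv_pow, ← pow_mul, mul_comm]
  have hden : (2 : ℝ) ^ 12 * lam ^ 2 * 2 ^ (4 * n₁) ≤ 2 ^ q := by
    calc (2 : ℝ) ^ 12 * lam ^ 2 * 2 ^ (4 * n₁) ≤ 2 ^ 12 * 2 ^ (2 * lb) * 2 ^ (4 * n₁) := by gcongr
      _ = 2 ^ (12 + 2 * lb + 4 * n₁) := by rw [← pow_add, ← pow_add]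
      _ ≤ _ := by gcongr; norm_num; omega
  obtain ⟨x, hx1, hx2⟩ := hfam.exists_gap (R := 2 ^ K) (L' := K + 12 + 2 * lb + 4 * n₁) h8
    (by positivity) (inv_le_one_of_one_le₀ (one_le_pow₀ (by norm_num))) hno
    (one_le_pow₀ (by norm_num))
    (by
      rw [h4, pow_add _ _ (4 * n₁), mul_comm _ (2 ^ (4 * n₁) : ℝ), inv_mul_cancel_left₀ (by positivity),
        pow_add, pow_add]
      gcongr)
    hL
    (by
      refine herr.trans ?_
      rw [h4, le_div_iff₀ (by positivity), inv_mul_le_iff₀ (by positivity), ← div_eq_mul_inv,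
        le_div_iff₀ (by positivity), pow_add, pow_add]
      calc (2 : ℝ) ^ 18 * lam ^ 2 * 2 ^ K * 2 ^ (4 * n₁) =
          ((2 : ℝ) ^ 12 * lam ^ 2 * 2 ^ (4 * n₁)) * 2 ^ 6 * 2 ^ K := by ring
        _ ≤ _ := by gcongr) i₀
  refine ⟨x, hx1, fun i => le_trans ?_ (hx2 i).le⟩
  rw [h4, div_le_div_iff₀ (by positivity) (by positivity), inv_mul_le_iff₀ (by positivity)]
  calc (2 : ℝ) ^ 12 * lam ^ 2 * 2 ^ K = (2 : ℝ) ^ 12 * lam ^ 2 * 2 ^ (4 * n₁) * ((2 ^ (4 * n₁))⁻¹ *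
        2 ^ K) := by field_simp
    _ ≤ _ := by gcongr

theorem rpow_concentration_bound {J lb V q K : ℕ} {D a : ℝ} (hD : D ≤ 2) (hV : 0 < V)
    (hK : K ≤ V * q) (hlbK : lb ≤ K) (ha0 : 0 ≤ a)
    (ha : a * J * 2 ^ (2 * lb) ≤ 2 ^ q) :
    a * 2 ^ (5 * q) * ((2 : ℝ) ^ (19 * q))⁻¹ * (J * 2 ^ (-(max (D - 2 / V) 0 * (K - lb : ℕ)))) ≤
      2 ^ (-((D + 2 / V) * K)) := by
  set D' := max (D - 2 / V) 0 with hD'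
  have hV' : (0 : ℝ) < V := by exact_mod_cast hV
  have h0 : 0 ≤ D' := le_max_right _ _
  have h2 : D' ≤ 2 := max_le (by have : 0 < 2 / (V : ℝ) := by positivity
                                 linarith) (by norm_num)
  have h1 : D - 2 / V ≤ D' := le_max_left _ _
  have hKr : (K : ℝ) ≤ V * q := by exact_mod_cast hK
  have e1 : (2 : ℝ) ^ (-(D' * (K - lb : ℕ))) ≤ 2 ^ (2 * lb) * 2 ^ (-(D' * K)) := by
    rw [← Real.rpow_natCast 2 (2 * lb), ← Real.rpow_add (by norm_num)]
    apply Real.rpow_le_rpow_of_exponent_le (by norm_num)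
    push_cast [Nat.cast_sub hlbK]
    have : D' * lb ≤ 2 * lb := by gcongr
    linarith
  calc _ ≤ a * 2 ^ (5 * q) * ((2 : ℝ) ^ (19 * q))⁻¹ * (J * (2 ^ (2 * lb) * 2 ^ (-(D' * K)))) := by
        gcongr
    _ = (a * J * 2 ^ (2 * lb)) * 2 ^ (5 * q) * ((2 : ℝ) ^ (19 * q))⁻¹ * 2 ^ (-(D' * K)) := by ring
    _ ≤ 2 ^ q * 2 ^ (5 * q) * ((2 : ℝ) ^ (19 * q))⁻¹ * 2 ^ (-(D' * K)) := by gcongr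
    _ = 2 ^ (-(13 * q : ℝ) + -(D' * K)) := by
        rw [Real.rpow_add (by norm_num), Real.rpow_neg (by norm_num), ← pow_add]
        have : (2 : ℝ) ^ (19 * q) = 2 ^ (q + 5 * q) * 2 ^ (13 * q) := by
          rw [← pow_add]; ring_nf
        rw [this, ← Real.rpow_natCast 2 (13 * q)]
        push_cast
        field_simp
        rw [← Real.rpow_add (by norm_num)]; simp
    _ ≤ _ := by
        apply Real.rpow_le_rpow_of_exponent_le (by norm_num)
        have e2 : (4 / V : ℝ) * K ≤ 4 * q := by
          rw [div_mul_eq_mul_div, div_le_iff₀ hV']; nlinarith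
        have e3 : (D - 2 / V) * K ≤ D' * K := by gcongr
        have e4 : (4 / V : ℝ) * K = 2 * (2 / V * K) := by ring
        have e5 : (0 : ℝ) ≤ q := by positivity
        nlinarith

theorem card_bound {C : ℝ} {E q c : ℕ} (hE : 21 ≤ E) (hC0 : 0 ≤ C) (hC : 8 * C ≤ 2 ^ q)
    (hq : 1 ≤ q) (hc : 2 ^ (2 * E * q) < 8 * c) :
    (c : ℝ) * (2 ^ (20 * q))⁻¹ + C * 2 ^ (E * q) ≤ c * (2 ^ (19 * q))⁻¹ := by
  have hc' : (2 : ℝ) ^ (E * q) * 2 ^ (E * q) ≤ 8 * c := by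
    rw [← pow_add, ← two_mul, ← mul_assoc]; exact_mod_cast hc.le
  have h1 : C * 2 ^ (E * q) ≤ c * (2 ^ (20 * q))⁻¹ := by
    rw [← div_eq_mul_inv, le_div_iff₀ (by positivity)]
    have h2 : (2 : ℝ) ^ q * 2 ^ (20 * q) ≤ 2 ^ (E * q) := by
      rw [← pow_add]
      gcongr
      · norm_num
      · nlinarith
    have h3 : 8 * C * 2 ^ (20 * q) ≤ 2 ^ (E * q) := le_trans (by gcongr) h2
    have h4 : 8 * C * 2 ^ (20 * q) * 2 ^ (E * q) ≤ 2 ^ (E * q) * 2 ^ (E * q) := by gcongr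
    linarith
  have h2 : (2 : ℝ) ^ (20 * q) = 2 ^ (19 * q) * 2 ^ q := by rw [← pow_add]; ring_nf
  have h3 : ((2 : ℝ) ^ (20 * q))⁻¹ ≤ (2 ^ (19 * q))⁻¹ * 2⁻¹ := by
    rw [h2, mul_inv]
    gcongr
    calc (2 : ℝ) = 2 ^ 1 := by norm_num
      _ ≤ _ := by gcongr; norm_num
  have h4 : (c : ℝ) * (2 ^ (20 * q))⁻¹ ≤ c * ((2 ^ (19 * q))⁻¹ * 2⁻¹) := by gcongr
  linarith

set_option maxHeartbeats 2000000 in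
theorem HasConcFam.step {lam : ℝ} (h8 : 8 ≤ lam) : ∃ B V q₀ : ℕ, 0 < V ∧ 0 < B ∧ ∀ q ≥ q₀,
    ∀ (n₁ : ℕ) (g : SL2R) (D : ℝ) (N K L : ℕ), 8 * n₁ ≤ q → D ≤ 2 → B * q ≤ K → N + 3 * K ≤ L →
      NoExc lam L (2 ^ n₁)⁻¹ g → HasConcFam lam g N K D →
      ∃ K', q ≤ K' ∧ K' ≤ V * q ∧ HasConcFam lam g (N + K) K' (D + 2 / V) := by
  have hl0 : 0 < lam := by linarith
  obtain ⟨lb', hlb'⟩ := exists_pow_two_ge lam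
  set lb := lb' + 1 with hlbdef
  have hlam : lam ≤ 2 ^ lb := hlb' lb (by omega)
  have hlb : 0 < lb := by omega
  clear_value lb
  obtain ⟨G, C, hG, hC0, hsum⟩ := sum_expSumSq_le h8 (T := 32 * lb) (by omega)
  obtain ⟨c1, hc1⟩ := exists_absorb
  obtain ⟨c2, hc2⟩ := exists_pow_two_ge (8 * C)
  set E₂ := G + 21 with hE₂
  obtain ⟨E, hE⟩ : ∃ E, E = 16 * lb * (2 * E₂) := ⟨_, rfl⟩
  obtain ⟨j₀, hj₀⟩ : ∃ j, j = 2 * lb + 2 := ⟨_, rfl⟩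
  obtain ⟨A, hA⟩ : ∃ A, A = 8 * (j₀ + 5) := ⟨_, rfl⟩
  obtain ⟨J, hJ⟩ : ∃ J, J = 3 * lb * A + 1 := ⟨_, rfl⟩
  set a : ℝ := 8 * (616 * Real.exp (32 * Real.pi)) * 11 with ha
  have ha0 : 0 ≤ a := by positivity
  obtain ⟨c3, hc3⟩ := exists_pow_two_ge (a * J * 2 ^ (2 * lb))
  have hE7 : 704 ≤ E := by rw [hE]; nlinarith
  have hJ0 : 0 < J := by omega
  have hV0 : 0 < J * E := by positivity
  refine ⟨J * E * (J * E + lb * (2 * A * E + 2 * E + 1) + 4), J * E, c1 + c2 + c3 + 24 + 4 * lb,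
    hV0, by positivity, ?_⟩
  intro q hq n₁ g D N K L hn₁ hD hK hL hno ⟨ι, _, _, t, Z, hfam, hconc⟩
  obtain ⟨Q, hQ⟩ : ∃ Q, Q = E * q := ⟨_, rfl⟩
  have hq0 : 0 < q := by omega
  have hQq : 704 * q ≤ Q := by rw [hQ]; gcongr
  have hlin : J * Q + lb * (2 * (A * Q) + 2 * Q + 1) + 4 ≤
      (J * E + lb * (2 * A * E + 2 * E + 1) + 4) * q := by
    have e1 : (J * E + lb * (2 * A * E + 2 * E + 1) + 4) * q =
      J * Q + lb * (2 * (A * Q) + 2 * Q + q) + 4 * q := by rw [hQ]; ring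
    rw [e1]
    gcongr <;> omega
  have hK1 : J * E * (J * Q + lb * (2 * (A * Q) + 2 * Q + 1) + 4) ≤ K := by
    refine le_trans ?_ hK
    rw [mul_assoc (J * E)]
    gcongr
  have hK2 : J * Q + lb * (2 * (A * Q) + 2 * Q + 1) + 4 ≤ K :=
    le_trans (Nat.le_mul_of_pos_left _ hV0) hK1
  set Λ : Finset ℕ := (Finset.Ico j₀ J).image (fun j => (j - 1) * Q - lb) with hΛ
  have hΛJ : Λ.card ≤ J := Finset.card_image_le.trans (by simp)
  obtain ⟨k₀, hk₀, hk₀K, S, hS, hSf, hScoll⟩ := exists_zoom t hfam.bound (K := K)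
    (kmin := lb * (2 * (A * Q) + 2 * Q + 1)) (lmax := J * Q) (D := D) (ζ := 2 / (J * E : ℕ))
    (by positivity) hconc
    (by
      have hV' : (0 : ℝ) < (J * E : ℕ) := by exact_mod_cast hV0
      rw [div_mul_eq_mul_div, lt_div_iff₀ hV']
      have : ((J * E : ℕ) : ℝ) * ((J * Q : ℕ) + (lb * (2 * (A * Q) + 2 * Q + 1) : ℕ) + 4) ≤ K := by
        exact_mod_cast hK1
      linarith [(Nat.cast_nonneg K : (0 : ℝ) ≤ K)])
    (by omega) Λ
    (by
      intro l hl
      obtain ⟨j, hj, rfl⟩ := Finset.mem_image.mp hl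
      have hj' := (Finset.mem_Ico.mp hj).2
      have : (j - 1) * Q ≤ J * Q := by gcongr; omega
      omega)
  obtain ⟨i₀, hi₀⟩ := hS
  have ht : ∀ i ∈ S, |t i - t i₀| ≤ (2 ^ k₀)⁻¹ := by
    intro i hi
    have h1 := Int.abs_sub_lt_one_of_floor_eq_floor (hSf i hi i₀ hi₀)
    rw [← mul_sub, abs_mul, abs_of_pos (by positivity : (0 : ℝ) < 2 ^ k₀)] at h1
    rw [← one_div, le_div_iff₀' (by positivity)]
    exact h1.le
  obtain ⟨k₁, hk₁, hk₁'⟩ := exists_nat_pow_near (x := (2 : ℝ) ^ k₀) (y := lam)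
    (one_le_pow₀ (by norm_num)) (by linarith)
  have hk₁n : 2 * (A * Q) + 2 * Q ≤ k₁ := by
    by_contra hcon
    have h1 : lam ^ (k₁ + 1) ≤ (2 : ℝ) ^ k₀ := by
      calc lam ^ (k₁ + 1) ≤ lam ^ (2 * (A * Q) + 2 * Q + 1) := by
            gcongr
            · linarith
            · omega
        _ ≤ (2 ^ lb) ^ (2 * (A * Q) + 2 * Q + 1) := by gcongr
        _ = 2 ^ (lb * (2 * (A * Q) + 2 * Q + 1)) := by rw [← pow_mul]
        _ ≤ _ := by gcongr; norm_num
    linarith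
  have hk₁k₀ : k₁ ≤ k₀ := by
    have h1 : (2 : ℝ) ^ k₁ ≤ 2 ^ k₀ := le_trans (by gcongr; linarith) hk₁
    exact (pow_le_pow_iff_right₀ (by norm_num)).mp h1
  obtain ⟨j, hj, hjJ, I, τ, σ, hI, hσ, hσ', hext⟩ := hfam.exists_extension (E := 2 * E₂) (q := q)
    (n₁ := n₁) (Q := Q) (j₀ := j₀) (A := A) (n := A * Q) (J := J) (L := L) (k₀ := k₀) (k₁ := k₁)
    (k' := k₁ - (2 * (A * Q) + 2 * Q)) (S := S) (i₀ := i₀) h8 hlb hlam (by omega) hq0 hn₁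
    (by rw [hQ, hE]) hj₀ hA rfl hJ hno (by omega) ht hk₁ (by omega) hk₀K
  obtain ⟨j', rfl⟩ : ∃ j', j = j' + 1 := ⟨j - 1, by omega⟩
  obtain ⟨K', hK'⟩ : ∃ K', K' = j' * Q := ⟨_, rfl⟩
  have hjQ : (j' + 1) * Q = K' + Q := by rw [hK']; ring
  have hjQ2 : (j' + 1 + 1) * Q = K' + 2 * Q := by rw [hK']; ring
  have hQK' : Q ≤ K' := by rw [hK']; exact Nat.le_mul_of_pos_left _ (by omega)
  have hK'J : K' ≤ J * Q := by rw [hK']; gcongr; omega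
  rw [hjQ] at hσ hext
  rw [hjQ2] at hσ'
  have hl : K' - lb ∈ Λ := by
    rw [hΛ, Finset.mem_image]
    exact ⟨j' + 1, Finset.mem_Ico.mpr ⟨hj, hjJ⟩, by rw [hK']; simp⟩
  have hScoll' := hScoll _ hl
  have hIne : (0 : ℝ) < I.card := by
    have : 0 < I.card := by
      by_contra h
      have h2 : I.card = 0 := by omega
      rw [h2] at hI
      simp at hI
    exact_mod_cast this
  have herr : (2 : ℝ) ^ 10 * (2 ^ (K' + Q))⁻¹ ≤ (2 ^ (q + 6 + K'))⁻¹ := by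
    rw [← div_eq_mul_inv, div_le_iff₀ (by positivity), inv_mul_eq_div, le_div_iff₀ (by positivity),
      ← pow_add]
    exact pow_le_pow_right₀ (by norm_num) (by omega)
  have hcard := card_bound (E := E₂) (q := q) (c := I.card) (by omega) hC0 (hc2 q (by omega))
    (by omega) hI
  obtain ⟨v, hv, hE'⟩ := exists_gaussEnergy_le (S ×ˢ I) (V := binWords Q)
    (by rw [← Finset.card_pos, card_binWords]; positivity)
    (fun v p => lam ^ k₁ * (t p.1 - t i₀) + (τ p.2 + lam ^ Q * σ p.2 * codeSum lam v)) S
    (fun i => lam ^ k₁ * (t i - t i₀)) (R := 2 ^ K') (B := (I.card : ℝ) * (I.card * (2 ^ (19 * q))⁻¹))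
    (q := q) (by omega) (by positivity) (by positivity)
    (by
      intro v hv i hi
      obtain ⟨Z', hZ'⟩ := hext v hv
      obtain ⟨y, hy1, hy2⟩ := hZ'.exists_gap_pow (K := K') (q := q) h8 hlam hno hn₁ (by omega)
        (by omega) herr ⟨i, hi⟩
      exact ⟨y, hy1, fun j hj => hy2 ⟨j, hj⟩⟩)
    (by
      intro ξ hξ1 hξ2
      have h1 := hsum Q (E₂ * q) (20 * q) (by rw [hQ, hE]; apply le_of_eq; ring)
        (by rw [hQ, hE, hE₂]; linarith [Nat.mul_le_mul_right (G * q) (show 1 ≤ lb from hlb),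
          Nat.zero_le (lb * q), Nat.zero_le (lb * (G * q))]) _ _ S I
        (fun i => lam ^ k₁ * (t i - t i₀)) τ σ ξ
        (by
          intro i hi i' hi' hne
          have e1 := hσ' i hi i' hi' hne
          have e2 : (2 : ℝ) ^ (3 * Q) ≤ lam ^ Q := by
            rw [pow_mul]; gcongr; linarith
          calc (1 : ℝ) ≤ ((2 ^ q)⁻¹ * 2 ^ K') * 2 ^ (3 * Q) * (2 ^ (K' + 2 * Q))⁻¹ := by
                rw [← div_eq_mul_inv, le_div_iff₀ (by positivity), inv_mul_eq_div, div_mul_eq_mul_div,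
                  le_div_iff₀ (by positivity), one_mul, ← pow_add, ← pow_add]
                exact pow_le_pow_right₀ (by norm_num) (by omega)
            _ ≤ _ := by gcongr)
        (by
          intro i hi i' hi'
          have e1 : |σ i - σ i'| ≤ 2 ^ 5 * (2 ^ (K' + Q))⁻¹ := by
            have := abs_sub (σ i) (σ i')
            linarith [hσ i hi, hσ i' hi']
          calc _ ≤ ((2 : ℝ) ^ q * (2 ^ (4 * q) * 2 ^ K')) * (2 ^ 5 * (2 ^ (K' + Q))⁻¹) := by gcongr
            _ ≤ 1 := by
                rw [← mul_assoc, ← div_eq_mul_inv, div_le_one (by positivity), ← pow_add, ← pow_add,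
                  ← pow_add]
                exact pow_le_pow_right₀ (by norm_num) (by omega))
      refine h1.trans ?_
      rw [card_binWords]
      push_cast
      rw [← mul_assoc ((2 : ℝ) ^ Q)]
      have : 0 ≤ expSumSq S (fun i => lam ^ k₁ * (t i - t i₀)) ξ := expSumSq_nonneg _ _ _
      gcongr)
    (hc1 q (by omega))
  obtain ⟨Z', hZ'⟩ := hext v hv
  refine ⟨K', by omega, ?_, ↥(S ×ˢ I), inferInstance, ?_, _, Z', hZ'.mono (by omega) (herr.trans ?_), ?_⟩
  · calc K' ≤ J * Q := hK'J
      _ = J * E * q := by rw [hQ, mul_assoc]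
  · obtain ⟨i, hi⟩ : I.Nonempty := by
      rw [← Finset.card_pos]; exact_mod_cast hIne
    exact ⟨⟨(i₀, i), Finset.mk_mem_product hi₀ hi⟩⟩
  · exact inv_anti₀ (by positivity) (pow_le_pow_right₀ (by norm_num) (by omega))
  · rw [collCount_coe (S ×ˢ I) (fun p => lam ^ k₁ * (t p.1 - t i₀) +
      (τ p.2 + lam ^ Q * σ p.2 * codeSum lam v)), Fintype.card_coe, Finset.card_product]
    have hlbK : lb ≤ K' := by omega
    have e1 : gaussEnergy S (fun i => lam ^ k₁ * (t i - t i₀)) (2 ^ K') ≤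
        11 * (J * 2 ^ (-(max (D - 2 / (J * E : ℕ)) 0 * (K' - lb : ℕ))) * S.card ^ 2) := by
      rw [gaussEnergy_mul_sub]
      refine (gaussEnergy_anti S t (R := 2 ^ (k₀ + (K' - lb))) (by positivity) ?_).trans ?_
      · have e2 : (2 : ℝ) ^ k₀ ≤ lam ^ k₁ * 2 ^ lb := by
          refine hk₁'.le.trans ?_
          rw [pow_succ]; gcongr
        have e3 : (2 : ℝ) ^ K' = 2 ^ lb * 2 ^ (K' - lb) := by rw [← pow_add]; congr 1; omega
        rw [e3, pow_add, ← mul_assoc]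
        gcongr
      · refine (gaussEnergy_le_collCount _ _ _).trans ?_
        gcongr
        refine hScoll'.trans ?_
        gcongr
    have e4 := rpow_concentration_bound (J := J) (lb := lb) (V := J * E) (q := q) (K := K') (D := D)
      (a := a) hD hV0 (hK'J.trans (by rw [hQ, mul_assoc])) hlbK ha0 (hc3 q (by omega))
    refine (collCount_le_gaussEnergy _ _ (R := 2 ^ K')).trans ?_
    refine (mul_le_mul_of_nonneg_left (hE'.trans (mul_le_mul_of_nonneg_left e1 (by positivity)))
      (by norm_num)).trans ?_
    push_cast
    calc _ = (I.card : ℝ) ^ 2 * S.card ^ 2 * (a * 2 ^ (5 * q) * ((2 : ℝ) ^ (19 * q))⁻¹ *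
          (J * 2 ^ (-(max (D - 2 / (J * E : ℕ)) 0 * (K' - lb : ℕ))))) := by rw [ha]; push_cast; ring
      _ ≤ (I.card : ℝ) ^ 2 * S.card ^ 2 * 2 ^ (-((D + 2 / (J * E : ℕ)) * K')) := by gcongr
      _ = _ := by push_cast; ring

theorem NoExc.mono {lam ε : ℝ} {L L' : ℕ} {g : SL2R} (h : NoExc lam L ε g) (hL : L' ≤ L) :
    NoExc lam L' ε g := fun w hw => h w (hw.trans hL)

theorem HasConcFam.base (lam : ℝ) (g : SL2R) (K : ℕ) : HasConcFam lam g 0 K 0 := by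
  refine ⟨Unit, inferInstance, inferInstance, fun _ => 0, g, ⟨by simp, fun _ => ⟨[], 1, 1, by simp,
    ?_, ?_⟩⟩, ?_⟩
  · simp only [wordMat, codeSum, List.length_nil, map_one, mul_one, one_mul, Nat.cast_zero, zero_mul]
    have : upT 0 0 = 1 := by
      apply SL2R_ext <;> simp
    rw [this, one_mul]
  · constructor <;> simp
  · simp [collCount]

/-- Iterating the concentration step `i` times. -/
theorem HasConcFam.exists_iterate {lam : ℝ} {B V q₀ : ℕ} (hV : 0 < V) (hB : 0 < B)
    (hstep : ∀ q ≥ q₀, ∀ (n₁ : ℕ) (g : SL2R) (D : ℝ) (N K L : ℕ), 8 * n₁ ≤ q → D ≤ 2 →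
      B * q ≤ K → N + 3 * K ≤ L → NoExc lam L (2 ^ n₁)⁻¹ g → HasConcFam lam g N K D →
      ∃ K', q ≤ K' ∧ K' ≤ V * q ∧ HasConcFam lam g (N + K) K' (D + 2 / V)) (i : ℕ) (hi : i ≤ V) :
    ∃ c : ℕ, ∀ (r n₁ : ℕ) (g : SL2R), q₀ ≤ r → 8 * n₁ ≤ r → NoExc lam (c * r) (2 ^ n₁)⁻¹ g →
      ∃ N K, r ≤ K ∧ K ≤ c * r ∧ N ≤ c * r ∧ HasConcFam lam g N K (i * (2 / V)) := by
  induction i with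
  | zero =>
    refine ⟨1, fun r n₁ g hr hn hno => ⟨0, r, le_rfl, by omega, by omega, ?_⟩⟩
    simpa using HasConcFam.base lam g r
  | succ i ih =>
    obtain ⟨c, hc⟩ := ih (by omega)
    refine ⟨4 * c * B + V, fun r n₁ g hr hn hno => ?_⟩
    have hBr : r ≤ B * r := Nat.le_mul_of_pos_left _ hB
    have hexp : (4 * c * B + V) * r = 4 * (c * (B * r)) + V * r := by ring
    rw [hexp] at hno ⊢
    obtain ⟨N, K, h1, h2, h3, h4⟩ := hc (B * r) n₁ g (by omega) (by omega) (hno.mono (by omega))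
    have hV' : (0 : ℝ) < V := by exact_mod_cast hV
    have hD : (i : ℝ) * (2 / V) ≤ 2 := by
      rw [mul_div_assoc', div_le_iff₀ hV']
      have : (i : ℝ) ≤ V := by exact_mod_cast (by omega : i ≤ V)
      linarith
    obtain ⟨K', h5, h6, h7⟩ := hstep r hr n₁ g _ N K (4 * (c * (B * r)) + V * r) hn hD h1 (by omega)
      hno h4
    refine ⟨N + K, K', h5, by omega, by omega, ?_⟩
    convert h7 using 1
    push_cast; ring

/-- Every lattice is brought deep into the cusp by some word of controlled length. -/
theorem exists_excursion {lam : ℝ} (h8 : 8 ≤ lam) :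
    ∃ C m : ℕ, ∀ n ≥ m, ∀ g : SL2R, ¬ NoExc lam (C * n) (2 ^ n)⁻¹ g := by
  obtain ⟨B, V, q₀, hV, hB, hstep⟩ := HasConcFam.step h8
  obtain ⟨c, hc⟩ := HasConcFam.exists_iterate hV hB hstep V le_rfl
  refine ⟨8 * c, q₀ + 1, fun n hn g hno => ?_⟩
  obtain ⟨N, K, h1, -, -, ι, _, _, t, Z, hfam, hcoll⟩ := hc (8 * n) n g (by omega) le_rfl
    (hno.mono (by apply le_of_eq; ring))
  have hV' : (V : ℝ) ≠ 0 := by exact_mod_cast hV.ne'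
  rw [mul_div_cancel₀ _ hV'] at hcoll
  have h2 := card_sq_le_two_pow_mul_collCount Finset.univ t (fun i _ => hfam.bound i) K
  rw [Finset.card_univ] at h2
  have h3 : (0 : ℝ) < (Fintype.card ι : ℝ) ^ 2 := by
    have : 0 < Fintype.card ι := Fintype.card_pos
    positivity
  have h4 : (Fintype.card ι : ℝ) ^ 2 ≤ (Fintype.card ι : ℝ) ^ 2 * 2 ^ ((K + 3 : ℝ) - 2 * K) := by
    refine h2.trans ((mul_le_mul_of_nonneg_left hcoll (by positivity)).trans (le_of_eq ?_))
    rw [sub_eq_add_neg, Real.rpow_add (by norm_num), ← Real.rpow_natCast 2 (K + 3)]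
    push_cast; ring
  have h5 : (2 : ℝ) ^ ((K + 3 : ℝ) - 2 * K) < 1 := by
    apply Real.rpow_lt_one_of_one_lt_of_neg (by norm_num)
    have : (8 : ℝ) ≤ K := by exact_mod_cast (by omega : 8 ≤ K)
    linarith
  nlinarith

theorem exists_maximal_separated {K : Set ℝ} (hK : IsCompact K) {r : ℝ} (hr : 0 < r) :
    ∃ P : Finset ℝ, ↑P ⊆ K ∧ (∀ x ∈ P, ∀ y ∈ P, x ≠ y → r < |x - y|) ∧
      K ⊆ ⋃ p ∈ P, Metric.closedBall p r := by
  lift r to NNReal using hr.le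
  have hr' : r ≠ 0 := by rintro rfl; simp at hr
  have hfin : Metric.packingNumber r K ≠ ⊤ := by
    obtain ⟨t, -, htf, htc⟩ := Metric.totallyBounded_iff.mp hK.totallyBounded (r / 2) (by positivity)
      |>.imp fun t ht => (⟨trivial, ht.1, ht.2⟩ : True ∧ _ ∧ _)
    have h1 := Metric.packingNumber_two_mul_le_externalCoveringNumber (r / 2) K
    rw [mul_div_cancel₀ _ two_ne_zero] at h1
    have h2 : Metric.IsCover (r / 2) K t := by
      intro x hx
      obtain ⟨y, hy, hxy⟩ := mem_iUnion₂.mp (htc hx)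
      refine ⟨y, hy, ?_⟩
      simp only [Metric.mem_ball] at hxy
      show edist x y ≤ _
      rw [edist_dist, ← ENNReal.ofReal_coe_nnreal]
      apply ENNReal.ofReal_le_ofReal
      push_cast; exact hxy.le
    exact ((h1.trans h2.externalCoveringNumber_le_encard).trans_lt htf.encard_lt_top).ne
  have hPf : (Metric.maximalSeparatedSet r K).Finite := by
    rw [← encard_lt_top_iff, Metric.encard_maximalSeparatedSet hfin]
    exact lt_top_iff_ne_top.mpr hfin
  refine ⟨hPf.toFinset, by simpa using Metric.maximalSeparatedSet_subset, ?_, ?_⟩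
  · intro x hx y hy hne
    have h1 : (r : ENNReal) < edist x y := Metric.isSeparated_maximalSeparatedSet
      (hPf.mem_toFinset.mp hx) (hPf.mem_toFinset.mp hy) hne
    rw [edist_dist, ← ENNReal.ofReal_coe_nnreal, ENNReal.ofReal_lt_ofReal_iff_of_nonneg (by positivity)]
      at h1
    exact h1
  · intro x hx
    obtain ⟨y, hy, hxy⟩ := Metric.isCover_maximalSeparatedSet hfin hx
    refine mem_iUnion₂.mpr ⟨y, hPf.mem_toFinset.mpr hy, ?_⟩
    have h1 : edist x y ≤ r := hxy
    rw [Metric.mem_closedBall, ← ENNReal.ofReal_le_ofReal_iff (by positivity), ← edist_dist,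
      ENNReal.ofReal_coe_nnreal]
    exact h1

/-- Below the Hausdorff dimension, there are large separated sets at arbitrarily small scales. -/
theorem exists_separated_of_lt_dimH {K : Set ℝ} (hK : IsCompact K) {d : NNReal} (hd : d < dimH K)
    (A : ℝ) {δ₀ : ℝ} (hδ₀ : 0 < δ₀) : ∃ δ, 0 < δ ∧ δ < δ₀ ∧ ∃ P : Finset ℝ, ↑P ⊆ K ∧
      (∀ x ∈ P, ∀ y ∈ P, x ≠ y → δ < |x - y|) ∧ A * δ ^ (-(d : ℝ)) ≤ P.card := by
  by_contra! hcon
  set δ : ℕ → ℝ := fun n => δ₀ / (n + 2) with hδ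
  have hδ0 : ∀ n, 0 < δ n := fun n => by positivity
  have hδlt : ∀ n, δ n < δ₀ := fun n => by
    simp only [hδ]; rw [div_lt_iff₀ (by positivity)]; nlinarith [(Nat.cast_nonneg n : (0 : ℝ) ≤ n)]
  choose P hP1 hP2 hP3 using fun n => exists_maximal_separated hK (hδ0 n)
  have hcard := fun n => hcon (δ n) (hδ0 n) (hδlt n) (P n) (hP1 n) (hP2 n)
  have hlim : Filter.Tendsto (fun n => ENNReal.ofReal (2 * δ n)) Filter.atTop (nhds 0) := by
    rw [← ENNReal.ofReal_zero]
    apply ENNReal.tendsto_ofReal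
    have : Filter.Tendsto (fun n : ℕ => 2 * (δ₀ / ((n : ℝ) + 2))) Filter.atTop (nhds (2 * 0)) := by
      apply Filter.Tendsto.const_mul
      apply Filter.Tendsto.const_div_atTop
      exact Filter.tendsto_atTop_add_const_right _ _ tendsto_natCast_atTop_atTop
    simpa using this
  have hdiam : ∀ n (i : ↥(P n)), Metric.ediam (Metric.closedBall (i : ℝ) (δ n)) ≤
      ENNReal.ofReal (2 * δ n) := by
    intro n i
    rw [Real.closedBall_eq_Icc, Real.ediam_Icc]
    apply ENNReal.ofReal_le_ofReal; linarith
  have h1 := MeasureTheory.Measure.hausdorffMeasure_le_liminf_sum (ι := fun n => ↥(P n)) (d : ℝ) K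
    (l := Filter.atTop) (fun n => ENNReal.ofReal (2 * δ n)) hlim
    (fun n i => Metric.closedBall (i : ℝ) (δ n)) (Filter.Eventually.of_forall hdiam)
    (Filter.Eventually.of_forall fun n x hx => by
      obtain ⟨p, hp, hxp⟩ := mem_iUnion₂.mp (hP3 n hx)
      exact mem_iUnion.mpr ⟨⟨p, hp⟩, hxp⟩)
  rw [hausdorffMeasure_of_lt_dimH hd] at h1
  have h2 : ∀ n, ∑ i : ↥(P n), Metric.ediam (Metric.closedBall (i : ℝ) (δ n)) ^ (d : ℝ) ≤
      ENNReal.ofReal (A * 2 ^ (d : ℝ)) := by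
    intro n
    calc _ ≤ ∑ i : ↥(P n), ENNReal.ofReal (2 * δ n) ^ (d : ℝ) := by
          apply Finset.sum_le_sum; intro i _
          exact ENNReal.rpow_le_rpow (hdiam n i) d.coe_nonneg
      _ = ENNReal.ofReal ((P n).card * (2 * δ n) ^ (d : ℝ)) := by
          rw [Finset.sum_const, Finset.card_univ, Fintype.card_coe, nsmul_eq_mul,
            ENNReal.ofReal_mul (Nat.cast_nonneg _), ENNReal.ofReal_natCast,
            ENNReal.ofReal_rpow_of_nonneg (by have := hδ0 n; positivity) d.coe_nonneg]
      _ ≤ _ := by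
          apply ENNReal.ofReal_le_ofReal
          have := hδ0 n
          calc (P n).card * (2 * δ n) ^ (d : ℝ) ≤ (A * δ n ^ (-(d : ℝ))) * (2 * δ n) ^ (d : ℝ) := by
                gcongr; exact (hcard n).le
            _ = A * 2 ^ (d : ℝ) * (δ n ^ (-(d : ℝ)) * δ n ^ (d : ℝ)) := by
                rw [Real.mul_rpow (by norm_num) this.le]; ring
            _ = _ := by rw [← Real.rpow_add this]; simp
  have h3 : Filter.liminf (fun n => ∑ i : ↥(P n),
      Metric.ediam (Metric.closedBall (i : ℝ) (δ n)) ^ (d : ℝ)) Filter.atTop ≤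
      ENNReal.ofReal (A * 2 ^ (d : ℝ)) := by
    refine (Filter.liminf_le_liminf (Filter.Eventually.of_forall h2)).trans ?_
    simp
  exact absurd (h1.trans h3) (by simp)

/-- The value at `x` of the affine map with coefficients `h`. -/
def affEval (h : ℝ × ℝ) (x : ℝ) : ℝ := h.1 * x + h.2

/-- Composition of affine maps. -/
def affComp (h k : ℝ × ℝ) : ℝ × ℝ := (h.1 * k.1, h.1 * k.2 + h.2)

theorem affEval_comp (h k : ℝ × ℝ) (x : ℝ) : affEval (affComp h k) x = affEval h (affEval k x) := by
  simp only [affEval, affComp]; ring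

theorem affEval_sub (h : ℝ × ℝ) (x y : ℝ) : affEval h x - affEval h y = h.1 * (x - y) := by
  simp only [affEval]; ring

/-- An affine map of ratio in `(0, 1]` preserving `K`. -/
structure AffMaps (K : Set ℝ) (h : ℝ × ℝ) : Prop where
  pos : 0 < h.1
  le_one : h.1 ≤ 1
  mem : ∀ x ∈ K, affEval h x ∈ K

theorem AffMaps.comp {K : Set ℝ} {h k : ℝ × ℝ} (hh : AffMaps K h) (hk : AffMaps K k) :
    AffMaps K (affComp h k) :=
  ⟨mul_pos hh.pos hk.pos, mul_le_one₀ hh.le_one hk.pos.le hk.le_one,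
    fun x hx => by rw [affEval_comp]; exact hh.mem _ (hk.mem x hx)⟩

theorem AffMaps.id (K : Set ℝ) : AffMaps K (1, 0) :=
  ⟨by norm_num, by norm_num, fun x hx => by simpa [affEval] using hx⟩

theorem IFS.IsAttractor.affMaps {F : IFS} {K : Set ℝ} (hK : F.IsAttractor K) (i : Fin F.n) :
    AffMaps K (F.c i, F.b i) :=
  ⟨F.c_pos i, (F.c_lt_one i).le, fun x hx => by
    rw [hK.2.2]; exact mem_iUnion.mpr ⟨i, x, hx, rfl⟩⟩

/-- Each point of the attractor lies in a cylinder of ratio comparable to a given scale. -/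
theorem IFS.IsAttractor.exists_cylinder {F : IFS} {K : Set ℝ} (hK : F.IsAttractor K) :
    ∃ c₀, 0 < c₀ ∧ c₀ < 1 ∧ ∀ δ, 0 < δ → δ < 1 → ∀ x ∈ K,
      ∃ h, AffMaps K h ∧ c₀ * δ ≤ h.1 ∧ h.1 ≤ δ ∧ ∃ y ∈ K, affEval h y = x := by
  haveI : Nonempty (Fin F.n) := ⟨⟨0, F.npos⟩⟩
  obtain ⟨i₀, hi₀⟩ := Finite.exists_min F.c
  obtain ⟨i₁, hi₁⟩ := Finite.exists_max F.c
  refine ⟨F.c i₀, F.c_pos _, F.c_lt_one _, fun δ hδ0 hδ1 x hx => ?_⟩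
  have key : ∀ m : ℕ, ∃ h, AffMaps K h ∧ (∃ y ∈ K, affEval h y = x) ∧
      ((F.c i₀ * δ ≤ h.1 ∧ h.1 ≤ δ) ∨ (δ < h.1 ∧ h.1 ≤ F.c i₁ ^ m)) := by
    intro m
    induction m with
    | zero => exact ⟨(1, 0), AffMaps.id K, ⟨x, hx, by simp [affEval]⟩, Or.inr ⟨hδ1, by simp⟩⟩
    | succ m ih =>
      obtain ⟨h, h1, ⟨y, hy, hyx⟩, h2 | ⟨h2, h3⟩⟩ := ih
      · exact ⟨h, h1, ⟨y, hy, hyx⟩, Or.inl h2⟩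
      · have hy' := hy
        rw [hK.2.2] at hy'
        obtain ⟨i, z, hz, hzy⟩ := mem_iUnion.mp hy'
        refine ⟨affComp h (F.c i, F.b i), h1.comp (hK.affMaps i), ⟨z, hz, ?_⟩, ?_⟩
        · rw [affEval_comp, ← hyx, ← hzy]; rfl
        · have e1 : F.c i₀ * δ ≤ h.1 * F.c i := by
            rw [mul_comm]
            exact mul_le_mul h2.le (hi₀ i) (F.c_pos _).le h1.pos.le
          have e2 : h.1 * F.c i ≤ F.c i₁ ^ (m + 1) := by
            rw [pow_succ]
            exact mul_le_mul h3 (hi₁ i) (F.c_pos _).le (pow_nonneg (F.c_pos _).le _)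
          rcases le_or_gt (h.1 * F.c i) δ with h4 | h4
          · exact Or.inl ⟨e1, h4⟩
          · exact Or.inr ⟨h4, e2⟩
  obtain ⟨m, hm⟩ := exists_pow_lt_of_lt_one hδ0 (F.c_lt_one i₁)
  obtain ⟨h, h1, h2, h3 | h3⟩ := key m
  · exact ⟨h, h1, h3.1, h3.2, h2⟩
  · linarith

/-- A large family of well separated cylinders of comparable size. -/
theorem IFS.IsAttractor.exists_separated_cylinders {F : IFS} {K : Set ℝ} (hK : F.IsAttractor K)
    {d : NNReal} (hd : d < dimH K) {θ : ℝ} (hθ : 0 < θ) :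
    ∃ ρ, 0 < ρ ∧ ρ < 1 ∧ ∃ (M : ℕ) (u : Fin M → ℝ × ℝ), (∀ i, AffMaps K (u i)) ∧
      (∀ i, ρ ≤ (u i).1) ∧
      (∀ i j, i ≠ j → ∀ x ∈ K, ∀ y ∈ K, ρ ≤ |affEval (u i) x - affEval (u j) y|) ∧
      (ρ * θ) ^ (-(d : ℝ)) ≤ M := by
  obtain ⟨c₀, hc₀, hc₁, hcyl⟩ := hK.exists_cylinder
  obtain ⟨Δ, hΔ0, hΔ⟩ : ∃ Δ, 0 ≤ Δ ∧ ∀ x ∈ K, ∀ y ∈ K, |x - y| ≤ Δ :=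
    ⟨Metric.diam K, Metric.diam_nonneg, fun x hx y hy =>
      Metric.dist_le_diam_of_mem hK.2.1.isBounded hx hy⟩
  set a := c₀ * θ / (2 * (Δ + 1)) with ha
  have ha0 : 0 < a := by positivity
  obtain ⟨s, hs0, hs1, P, hPK, hPs, hPc⟩ := exists_separated_of_lt_dimH hK.2.1 hd (a ^ (-(d : ℝ)))
    one_pos
  set δ := s / (2 * (Δ + 1)) with hδ
  have hδ0 : 0 < δ := by positivity
  have hδs : s = 2 * δ * (Δ + 1) := by rw [hδ]; field_simp
  have hδ1 : δ < 1 := by nlinarith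
  choose! h h1 h2 h3 y hy hyx using hcyl δ hδ0 hδ1
  refine ⟨c₀ * δ, by positivity, by nlinarith, P.card, fun i => h (P.equivFin.symm i), ?_, ?_, ?_, ?_⟩
  · exact fun i => h1 _ (hPK (P.equivFin.symm i).2)
  · exact fun i => h2 _ (hPK (P.equivFin.symm i).2)
  · intro i j hij x hx z hz
    have hp := hPK (P.equivFin.symm i).2
    have hp' := hPK (P.equivFin.symm j).2
    have hsep := hPs _ (P.equivFin.symm i).2 _ (P.equivFin.symm j).2
      (fun hne => hij (P.equivFin.symm.injective (Subtype.ext hne)))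
    set p : ℝ := (P.equivFin.symm i : ℝ)
    set p' : ℝ := (P.equivFin.symm j : ℝ)
    have e : ∀ p ∈ K, ∀ x ∈ K, |affEval (h p) x - p| ≤ δ * Δ := by
      intro p hp x hx
      have e0 : affEval (h p) x - p = (h p).1 * (x - y p) := by rw [← affEval_sub, hyx p hp]
      rw [e0, abs_mul, abs_of_pos (h1 p hp).pos]
      exact mul_le_mul (h3 p hp) (hΔ _ hx _ (hy p hp)) (abs_nonneg _) hδ0.le
    have e1 := abs_le.mp (e p hp x hx)
    have e2 := abs_le.mp (e p' hp' z hz)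
    have e3 : 2 * δ ≤ |affEval (h p) x - affEval (h p') z| := by
      rcases lt_abs.mp hsep with h5 | h5
      · rw [le_abs]; left; nlinarith
      · rw [le_abs]; right; nlinarith
    nlinarith
  · refine le_trans (le_of_eq ?_) hPc
    rw [← Real.mul_rpow ha0.le hs0.le]
    congr 1
    rw [ha, hδ]; ring

/-- Good rational approximations to points of a coded set, with excursions of controlled length. -/
theorem exists_code_approx {lam : ℝ} (h8 : 8 ≤ lam) :
    ∃ C m : ℕ, ∀ n ≥ m, ∀ α r : ℝ, 0 < r → ∃ w : List Bool, w.length ≤ C * n ∧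
      ∃ p q : ℤ, (p ≠ 0 ∨ q ≠ 0) ∧
        |(q : ℝ) * (α + r * codeSum lam w) - p| ≤ (2 ^ n)⁻¹ * √(r / lam ^ w.length) ∧
        |(q : ℝ)| * √(r / lam ^ w.length) ≤ (2 ^ n)⁻¹ := by
  obtain ⟨C, m, hCm⟩ := exists_excursion h8
  refine ⟨C, m, fun n hn α r hr => ?_⟩
  have hlam : 0 < lam := by linarith
  have h := hCm n hn (upT (-(Real.log r / 2)) α)
  simp only [NoExc, SysGT] at h
  push Not at h
  obtain ⟨w, hw, p, q, hpq, h1, h2⟩ := h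
  refine ⟨w, hw, p, q, hpq, ?_⟩
  set t := (w.length : ℝ) * (Real.log lam / 2) with ht
  set S := √(r / lam ^ w.length) with hS
  have hS0 : 0 < S := Real.sqrt_pos.mpr (by positivity)
  have hSe : Real.exp (-(Real.log r / 2) + t) = S⁻¹ := by
    have e1 : Real.exp (-(-(Real.log r / 2) + t)) = S := by
      rw [hS, eq_comm, Real.sqrt_eq_iff_eq_sq (by positivity) (Real.exp_pos _).le, ← Real.exp_nat_mul]
      push_cast
      rw [show 2 * -(-(Real.log r / 2) + t) = Real.log r - 2 * t by ring, Real.exp_sub,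
        Real.exp_log hr, ht, exp_word hlam]
    rw [← e1, Real.exp_neg, inv_inv]
  have hSe' : Real.exp (-(-(Real.log r / 2) + t)) = S := by
    rw [Real.exp_neg, hSe, inv_inv]
  have hm : wordMat lam w * upT (-(Real.log r / 2)) α =
      upT (-(Real.log r / 2) + t) (α + r * codeSum lam w) := by
    rw [wordMat, ← ht, upT_mul, show -(2 * -(Real.log r / 2)) = Real.log r by ring,
      Real.exp_log hr, add_comm t]
  rw [hm] at h1 h2
  simp only [upT.e00, upT.e01, upT.e10, upT.e11, hSe, hSe'] at h1 h2
  constructor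
  · have e : (q : ℝ) * (α + r * codeSum lam w) - p =
        -(S * (S⁻¹ * p + -(S⁻¹ * (α + r * codeSum lam w)) * q)) := by
      field_simp; ring
    rw [e, abs_neg, abs_mul, abs_of_pos hS0, mul_comm]
    exact mul_le_mul_of_nonneg_right h1 hS0.le
  · rwa [zero_mul, zero_add, abs_mul, abs_of_pos hS0, mul_comm] at h2

/-- If the attractor has positive dimension, two maps of the system have distinct fixed points. -/
theorem IFS.IsAttractor.exists_fixed_ne {F : IFS} {K : Set ℝ} (hK : F.IsAttractor K)
    (hd : 0 < dimH K) : ∃ i j, (1 - F.c i) * F.b j < (1 - F.c j) * F.b i := by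
  by_contra! hcon
  haveI : Nonempty (Fin F.n) := ⟨⟨0, F.npos⟩⟩
  obtain ⟨i₀⟩ := this
  set z := F.b i₀ / (1 - F.c i₀) with hz
  have hzi : ∀ i, F.c i * z + F.b i = z := by
    intro i
    have h1 := hcon i i₀
    have h2 := hcon i₀ i
    have h3 : 1 - F.c i₀ ≠ 0 := by have := F.c_lt_one i₀; linarith
    rw [hz]
    field_simp
    linarith
  obtain ⟨x, hx, hmax⟩ := hK.2.1.exists_isMaxOn hK.1
    (continuous_abs.comp (continuous_id.sub (continuous_const (y := z)))).continuousOn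
  have hx0 : |x - z| = 0 := by
    have hx' := hx
    rw [hK.2.2] at hx'
    obtain ⟨i, y, hy, rfl⟩ := mem_iUnion.mp hx'
    have h1 : |y - z| ≤ |F.map i y - z| := hmax hy
    have h2 : F.map i y - z = F.c i * (y - z) := by
      have := hzi i
      simp only [IFS.map]; linarith
    rw [h2, abs_mul, abs_of_pos (F.c_pos i)] at h1 ⊢
    have h3 := F.c_lt_one i
    have h4 : |y - z| = 0 := le_antisymm (by nlinarith [abs_nonneg (y - z)]) (abs_nonneg _)
    rw [h4, mul_zero]
  have hsub : K ⊆ {z} := by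
    intro y hy
    have h1 : |y - z| ≤ |x - z| := hmax hy
    rw [hx0] at h1
    have := abs_eq_zero.mp (le_antisymm h1 (abs_nonneg _))
    simp only [mem_singleton_iff]; linarith
  have := dimH_mono hsub
  rw [dimH_singleton] at this
  exact absurd hd (not_lt.mpr this)

/-- A homogeneous binary subsystem with strong contraction, in coded form. -/
theorem IFS.IsAttractor.exists_binary_family {F : IFS} {K : Set ℝ} (hK : F.IsAttractor K)
    (hd : 0 < dimH K) : ∃ lam b z : ℝ, 8 ≤ lam ∧ 0 < b ∧ ∀ w : List Bool,
      AffMaps K (1 / lam ^ w.length, z * (1 - 1 / lam ^ w.length) + b * codeSum lam w) := by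
  obtain ⟨i, j, hij⟩ := hK.exists_fixed_ne hd
  set c := F.c i * F.c j with hc
  have hc0 : 0 < c := mul_pos (F.c_pos i) (F.c_pos j)
  have hc1 : c < 1 := mul_lt_one_of_nonneg_of_lt_one_left (F.c_pos i).le (F.c_lt_one i)
    (F.c_lt_one j).le
  have key : ∀ p : ℕ, ∃ t₁ t₂, t₁ < t₂ ∧ AffMaps K (c ^ (p + 1), t₁) ∧
      AffMaps K (c ^ (p + 1), t₂) := by
    intro p
    induction p with
    | zero =>
      refine ⟨F.c j * F.b i + F.b j, F.c i * F.b j + F.b i, by linarith, ?_, ?_⟩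
      · rw [zero_add, pow_one, hc, mul_comm]
        exact (hK.affMaps j).comp (hK.affMaps i)
      · rw [zero_add, pow_one]
        exact (hK.affMaps i).comp (hK.affMaps j)
    | succ p ih =>
      obtain ⟨t₁, t₂, h1, h2, h3⟩ := ih
      have h4 := h2.comp ((hK.affMaps i).comp (hK.affMaps j))
      refine ⟨c * t₁ + (F.c i * F.b j + F.b i), c * t₂ + (F.c i * F.b j + F.b i), by
        have := mul_lt_mul_of_pos_left h1 hc0
        linarith, ?_, ?_⟩
      · rw [pow_succ']
        exact ((hK.affMaps i).comp (hK.affMaps j)).comp h2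
      · rw [pow_succ']
        exact ((hK.affMaps i).comp (hK.affMaps j)).comp h3
  obtain ⟨p, hp⟩ := exists_pow_lt_of_lt_one (show (0 : ℝ) < 1 / 8 by norm_num) hc1
  obtain ⟨t₁, t₂, h1, h2, h3⟩ := key p
  set e := c ^ (p + 1) with he
  have he0 : 0 < e := pow_pos hc0 _
  have he8 : e ≤ 1 / 8 := (pow_le_pow_of_le_one hc0.le hc1.le (Nat.le_succ p)).trans hp.le
  refine ⟨1 / e, t₂ - t₁, t₁ / (1 - e), ?_, by linarith, fun w => ?_⟩
  · rw [le_div_iff₀ he0]; linarith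
  · have h4 : 1 - e ≠ 0 := by linarith
    induction w with
    | nil => simpa [codeSum] using AffMaps.id K
    | cons s w ih =>
      have h5 : AffMaps K (e, if s then t₂ else t₁) := by
        split_ifs
        · exact h3
        · exact h2
      convert h5.comp ih using 1
      simp only [affComp, codeSum, List.length_cons, one_div, inv_pow, inv_inv, Prod.mk.injEq,
        div_inv_eq_mul]
      refine ⟨by rw [pow_succ']; ring, ?_⟩
      rw [pow_succ']
      cases s
      · simp only [Bool.false_eq_true, if_false]
        field_simp; ring
      · simp only [if_true]
        field_simp; ring

/-- Any map preserving `K` extends, at controlled cost, to one whose image lies very close to a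
rational number. -/
theorem IFS.IsAttractor.exists_approx_extension {F : IFS} {K : Set ℝ} (hK : F.IsAttractor K)
    (hd : 0 < dimH K) : ∃ θ : ℝ, 0 < θ ∧ θ < 1 ∧ ∀ κ, 0 < κ → κ < 1 →
      ∃ v : ℝ, 1 < v ∧ ∃ (m : ℕ) (D : ℝ), ∀ n ≥ m, ∀ h, AffMaps K h → κ ^ n ≤ h.1 →
        ∃ e, AffMaps K e ∧ θ ^ n ≤ e.1 ∧ ∃ (p : ℤ) (q : ℕ), 0 < q ∧ ∀ x ∈ K,
          |(q : ℝ) * affEval (affComp h e) x - p| < (q : ℝ) ^ (-v) ∧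
          |(q : ℝ) * affEval (affComp h e) x - p| ≤ D * (2 ^ n)⁻¹ := by
  obtain ⟨lam, b, z, h8, hb, hw⟩ := hK.exists_binary_family hd
  obtain ⟨C, m, hC⟩ := exists_code_approx h8
  have hlam : 0 < lam := by linarith
  obtain ⟨Δ, hΔ0, hΔ⟩ : ∃ Δ, 0 ≤ Δ ∧ ∀ x ∈ K, |x - z| ≤ Δ := by
    obtain ⟨Δ, hΔ⟩ := hK.2.1.exists_bound_of_continuousOn
      (continuous_id.sub (continuous_const (y := z))).continuousOn
    obtain ⟨x, hx⟩ := hK.1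
    exact ⟨Δ, (norm_nonneg _).trans (hΔ x hx), hΔ⟩
  have hl1 : 1 / lam < 1 := by rw [div_lt_one hlam]; linarith
  refine ⟨(1 / lam) ^ (C + 1), by positivity, pow_lt_one₀ (by positivity) hl1 (by omega),
    fun κ hκ0 hκ1 => ?_⟩
  set θ := (1 / lam) ^ (C + 1) with hθ
  have hθ0 : 0 < θ := by positivity
  set β := min b 1 * (κ * θ) with hβ
  have hβ0 : 0 < β := by positivity
  obtain ⟨N, hN⟩ := exists_pow_lt_of_lt_one hβ0 (show (1 / 2 : ℝ) < 1 by norm_num)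
  set E := 1 + Δ / b with hE
  have hE0 : 0 < E := by positivity
  obtain ⟨m', hm'⟩ := pow_unbounded_of_one_lt (E + √b) (show (1 : ℝ) < 2 by norm_num)
  refine ⟨1 + ((N + 1 : ℕ) : ℝ)⁻¹, by simp; positivity, m + m' + 1, √b * E, fun n hn h hh hhn => ?_⟩
  have hr : 0 < h.1 * b := mul_pos hh.pos hb
  obtain ⟨w, hwl, p, q, hpq, h1, h2⟩ := hC n (by omega) (affEval h z) (h.1 * b) hr
  set l := lam ^ w.length with hl
  have hl0 : 0 < l := by positivity
  set R := √(h.1 * b / l) with hR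
  have hR0 : 0 < R := Real.sqrt_pos.mpr (by positivity)
  have hRsq : R ^ 2 = h.1 * b / l := Real.sq_sqrt (by positivity)
  have hl1' : 1 ≤ l := one_le_pow₀ (by linarith)
  have hRb : R ≤ √b := by
    apply Real.sqrt_le_sqrt
    rw [div_le_iff₀ hl0]
    have := hh.le_one
    nlinarith
  have h2n : E + √b < 2 ^ n := hm'.trans_le (pow_le_pow_right₀ (by norm_num) (by omega))
  have h2n0 : (0 : ℝ) < 2 ^ n := by positivity
  have hθl : θ ^ n ≤ 1 / l := by
    rw [hθ, hl, ← one_div_pow, ← pow_mul]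
    apply pow_le_pow_of_le_one (by positivity) hl1.le
    nlinarith
  have hRlow : ((1 / 2) ^ (N + 1)) ^ n ≤ R := by
    have e1 : ((1 / 2 : ℝ) ^ (N + 1)) ^ n ≤ R ^ 2 := by
      rw [hRsq]
      calc ((1 / 2 : ℝ) ^ (N + 1)) ^ n ≤ β ^ n := by
            apply pow_le_pow_left₀ (by positivity)
            exact (pow_le_pow_of_le_one (by norm_num) (by norm_num) (Nat.le_succ N)).trans hN.le
        _ = (min b 1) ^ n * (κ ^ n * θ ^ n) := by rw [hβ, mul_pow, mul_pow]
        _ ≤ b * (h.1 * (1 / l)) := by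
            have e2 : (min b 1) ^ n ≤ b := by
              calc (min b 1) ^ n ≤ (min b 1) ^ 1 :=
                    pow_le_pow_of_le_one (by positivity) (min_le_right _ _) (by omega)
                _ ≤ b := by rw [pow_one]; exact min_le_left _ _
            have e3 : κ ^ n * θ ^ n ≤ h.1 * (1 / l) :=
              mul_le_mul hhn hθl (by positivity) hh.pos.le
            exact mul_le_mul e2 e3 (by positivity) hb.le
        _ = h.1 * b / l := by ring
    have e2 : ((1 / 2 : ℝ) ^ (N + 1)) ^ n ≤ 1 :=
      pow_le_one₀ (by positivity) (pow_le_one₀ (by norm_num) (by norm_num))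
    have e3 : (0 : ℝ) < ((1 / 2 : ℝ) ^ (N + 1)) ^ n := by positivity
    by_contra! hcon
    nlinarith
  have hq0 : q ≠ 0 := by
    rintro rfl
    simp only [Int.cast_zero, zero_mul, zero_sub, abs_neg] at h1
    have e1 : |(p : ℝ)| < 1 := by
      refine h1.trans_lt ?_
      rw [inv_mul_lt_iff₀ h2n0]
      linarith
    have e2 : |p| < 1 := by exact_mod_cast e1
    rw [Int.abs_lt_one_iff] at e2
    simp [e2] at hpq
  wlog hqpos : 0 < q generalizing p q
  · refine this (-p) (-q) (by simpa using hpq) ?_ ?_ (by omega) (by omega)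
    · push_cast
      rw [← abs_neg]
      convert h1 using 2
      ring
    · push_cast
      rwa [abs_neg]
  lift q to ℕ using hqpos.le
  simp only [Int.cast_natCast] at h1 h2
  have hq1 : 0 < q := by exact_mod_cast hqpos
  have hqR : (0 : ℝ) < q := by exact_mod_cast hq1
  rw [abs_of_pos hqR] at h2
  refine ⟨_, hw w, hθl, p, q, hq1, fun x hx => ?_⟩
  have hdist : |(q : ℝ) * affEval (affComp h (1 / l, z * (1 - 1 / l) + b * codeSum lam w)) x - p|
      ≤ (2 ^ n)⁻¹ * R * E := by
    have e1 : (q : ℝ) * affEval (affComp h (1 / l, z * (1 - 1 / l) + b * codeSum lam w)) x - p =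
        ((q : ℝ) * (affEval h z + h.1 * b * codeSum lam w) - p) + q * R ^ 2 * ((x - z) / b) := by
      rw [hRsq]
      simp only [affEval, affComp]
      field_simp
      ring
    rw [e1]
    refine (abs_add_le _ _).trans ?_
    rw [abs_mul (_ * _ ^ _), abs_of_pos (mul_pos hqR (pow_pos hR0 2)), abs_div, abs_of_pos hb]
    have e2 : (q : ℝ) * R ^ 2 * (|x - z| / b) ≤ (2 ^ n)⁻¹ * R * (Δ / b) := by
      have : (q : ℝ) * R ^ 2 ≤ (2 ^ n)⁻¹ * R := by
        rw [pow_two, ← mul_assoc]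
        exact mul_le_mul_of_nonneg_right h2 hR0.le
      exact mul_le_mul this (by gcongr; exact hΔ x hx) (by positivity) (by positivity)
    rw [hE]
    linarith
  constructor
  · refine hdist.trans_lt ?_
    have e1 : (2 ^ n)⁻¹ * R * E < R := by
      rw [mul_assoc, inv_mul_lt_iff₀ h2n0, mul_comm]
      have := Real.sqrt_nonneg b
      exact mul_lt_mul_of_pos_right (by linarith) hR0
    refine e1.trans_le ?_
    have e2 : (q : ℝ) ≤ (2 ^ n) ^ (N + 1) := by
      have e3 : (2 ^ n : ℝ)⁻¹ ≤ 1 := inv_le_one_of_one_le₀ (one_le_pow₀ (by norm_num))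
      have e4 : (q : ℝ) * ((1 / 2) ^ (N + 1)) ^ n ≤ 1 :=
        ((mul_le_mul_of_nonneg_left hRlow hqR.le).trans h2).trans e3
      have e5 : ((1 / 2 : ℝ) ^ (N + 1)) ^ n = ((2 ^ n) ^ (N + 1))⁻¹ := by
        rw [← pow_mul, ← pow_mul, one_div, inv_pow, mul_comm]
      rw [e5, mul_inv_le_iff₀ (by positivity), one_mul] at e4
      exact e4
    have e3 : (q : ℝ) ^ (((N + 1 : ℕ) : ℝ)⁻¹) ≤ 2 ^ n := by
      calc (q : ℝ) ^ (((N + 1 : ℕ) : ℝ)⁻¹) ≤ ((2 ^ n) ^ (N + 1)) ^ (((N + 1 : ℕ) : ℝ)⁻¹) :=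
            Real.rpow_le_rpow hqR.le e2 (by positivity)
        _ = 2 ^ n := Real.pow_rpow_inv_natCast h2n0.le (by omega)
    rw [Real.rpow_neg hqR.le, le_inv_comm₀ hR0 (by positivity), Real.rpow_add hqR, Real.rpow_one]
    rw [← one_div R, le_div_iff₀ hR0]
    calc (q : ℝ) * (q : ℝ) ^ (((N + 1 : ℕ) : ℝ)⁻¹) * R
        = (q * R) * (q : ℝ) ^ (((N + 1 : ℕ) : ℝ)⁻¹) := by ring
      _ ≤ (2 ^ n)⁻¹ * 2 ^ n := mul_le_mul h2 e3 (by positivity) (by positivity)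
      _ = 1 := inv_mul_cancel₀ h2n0.ne'
  · refine hdist.trans ?_
    rw [mul_assoc, mul_comm]
    exact mul_le_mul_of_nonneg_right (mul_le_mul_of_nonneg_right hRb hE0.le) (by positivity)

theorem mem_VWA_of_approx {v y D : ℝ} (hv : 1 < v)
    (h : ∀ n₀ : ℕ, ∃ n ≥ n₀, ∃ (p : ℤ) (q : ℕ), 0 < q ∧ |(q : ℝ) * y - p| < (q : ℝ) ^ (-v) ∧
      |(q : ℝ) * y - p| ≤ D * (2 ^ n)⁻¹) : y ∈ VWA := by
  refine mem_biUnion (show v ∈ Ioi (1 : ℝ) from hv) ?_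
  by_cases hex : ∃ (p : ℤ) (q : ℕ), 0 < q ∧ (q : ℝ) * y - p = 0
  · obtain ⟨p, q, hq, hpq⟩ := hex
    refine infinite_of_injective_forall_mem
      (f := fun k : ℕ => (((k + 1 : ℕ) : ℤ) * p, (k + 1) * q)) ?_ ?_
    · intro k l hkl
      have := (Prod.mk.inj hkl).2
      have := Nat.eq_of_mul_eq_mul_right hq this
      omega
    · intro k
      refine ⟨by positivity, ?_⟩
      have e : (((k + 1) * q : ℕ) : ℝ) * y - ((((k + 1 : ℕ) : ℤ) * p : ℤ) : ℝ) = 0 := by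
        push_cast
        linear_combination ((k : ℝ) + 1) * hpq
      dsimp only
      rw [e, abs_zero]
      have : (0 : ℝ) < (((k + 1) * q : ℕ) : ℝ) := by exact_mod_cast Nat.mul_pos (by omega) hq
      exact Real.rpow_pos_of_pos this _
  · push Not at hex
    intro hfin
    have hne : {pq : ℤ × ℕ | 0 < pq.2 ∧ |(pq.2 : ℝ) * y - (pq.1 : ℝ)| < psiv v pq.2}.Nonempty := by
      obtain ⟨n, -, p, q, h1, h2, -⟩ := h 0
      exact ⟨(p, q), h1, h2⟩
    obtain ⟨⟨p₀, q₀⟩, ⟨h1, -⟩, hmin⟩ := exists_min_image _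
      (fun pq : ℤ × ℕ => |(pq.2 : ℝ) * y - (pq.1 : ℝ)|) hfin hne
    have hpos : 0 < |(q₀ : ℝ) * y - (p₀ : ℝ)| := abs_pos.mpr (hex _ _ h1)
    obtain ⟨n₀, hn₀⟩ := pow_unbounded_of_one_lt (D / |(q₀ : ℝ) * y - (p₀ : ℝ)|)
      (show (1 : ℝ) < 2 by norm_num)
    obtain ⟨n, hn, p, q, h2, h3, h4⟩ := h n₀
    have h5 := hmin (p, q) ⟨h2, h3⟩
    have h6 : (2 : ℝ) ^ n₀ ≤ 2 ^ n := pow_le_pow_right₀ (by norm_num) hn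
    have h7 := (h5.trans h4)
    dsimp only at h7
    rw [← div_eq_mul_inv, le_div_iff₀ (by positivity)] at h7
    rw [div_lt_iff₀ hpos] at hn₀
    nlinarith

/-- A lower bound for the dimension of a set coded by digit sequences with separation. -/
theorem le_dimH_range_of_separated {M : ℕ} (hM : 1 < M) {κ ρ : ℝ} (hκ : 0 < κ) (hρ : 0 < ρ)
    {d : NNReal} (hd : 0 < d) (hMd : κ ^ (-(d : ℝ)) ≤ M) (π : (ℕ → Fin M) → ℝ)
    (hπ : ∀ s s' : ℕ → Fin M, ∀ m, (∀ i < m, s i = s' i) → s m ≠ s' m →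
      ρ * κ ^ m ≤ |π s - π s'|) : (d : ENNReal) ≤ dimH (range π) := by
  haveI : NeZero M := ⟨by omega⟩
  have hexm : ∀ s s' : ℕ → Fin M, s ≠ s' → ∃ m, (∀ i < m, s i = s' i) ∧ s m ≠ s' m := by
    intro s s' hne
    have hex : ∃ m, s m ≠ s' m := Function.ne_iff.mp hne
    classical
    exact ⟨Nat.find hex, fun i hi => not_not.mp (Nat.find_min hex hi), Nat.find_spec hex⟩
  have hinj : Function.Injective π := by
    intro s s' hss
    by_contra hne
    obtain ⟨m, h1, h2⟩ := hexm s s' hne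
    have := hπ s s' m h1 h2
    rw [hss, sub_self, abs_zero] at this
    have : 0 < ρ * κ ^ m := by positivity
    linarith
  set φ : ℝ → ℝ := fun x => Real.ofDigits (Function.invFun π x) with hφ
  have hφπ : ∀ s, φ (π s) = Real.ofDigits s := fun s => by
    rw [hφ]; dsimp only; rw [Function.leftInverse_invFun hinj]
  have hholder : HolderOnWith (Real.toNNReal (ρ ^ (-(d : ℝ)))) d φ (range π) := by
    rintro _ ⟨s, rfl⟩ _ ⟨s', rfl⟩
    rcases eq_or_ne s s' with rfl | hne
    · simp
    obtain ⟨m, h1, h2⟩ := hexm s s' hne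
    have h3 := hπ s s' m h1 h2
    have h4 : |φ (π s) - φ (π s')| ≤ ρ ^ (-(d : ℝ)) * |π s - π s'| ^ (d : ℝ) := by
      rw [hφπ, hφπ]
      calc _ ≤ ((M : ℝ) ^ m)⁻¹ := Real.abs_ofDigits_sub_ofDigits_le h1
        _ ≤ ((κ ^ (-(d : ℝ))) ^ m)⁻¹ := by
          have : 0 < κ ^ (-(d : ℝ)) := Real.rpow_pos_of_pos hκ _
          gcongr
        _ = (κ ^ m) ^ (d : ℝ) := by
          rw [Real.rpow_neg hκ.le, inv_pow, inv_inv, ← Real.rpow_natCast, ← Real.rpow_natCast,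
            ← Real.rpow_mul hκ.le, ← Real.rpow_mul hκ.le, mul_comm]
        _ = ρ ^ (-(d : ℝ)) * (ρ * κ ^ m) ^ (d : ℝ) := by
          rw [Real.mul_rpow hρ.le (by positivity), ← mul_assoc, ← Real.rpow_add hρ, neg_add_cancel,
            Real.rpow_zero, one_mul]
        _ ≤ _ := by
          have : 0 < ρ ^ (-(d : ℝ)) := Real.rpow_pos_of_pos hρ _
          have h5 : 0 < ρ * κ ^ m := by positivity
          gcongr
    rw [edist_dist, edist_dist, Real.dist_eq, Real.dist_eq,
      ENNReal.ofReal_rpow_of_nonneg (abs_nonneg _) d.coe_nonneg]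
    change _ ≤ ENNReal.ofReal _ * _
    rw [← ENNReal.ofReal_mul (Real.rpow_nonneg hρ.le _)]
    exact ENNReal.ofReal_le_ofReal h4
  have h1 := hholder.dimH_image_le hd
  have h2 : Icc (0 : ℝ) 1 ⊆ φ '' range π := by
    intro y hy
    obtain ⟨s, -, hs⟩ := Real.ofDigits_SurjOn hM hy
    exact ⟨π s, ⟨s, rfl⟩, by rw [hφπ, hs]⟩
  have h3 : dimH (Icc (0 : ℝ) 1) = 1 := by
    rw [Real.dimH_of_nonempty_interior (by rw [interior_Icc]; exact nonempty_Ioo.mpr one_pos)]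
    simp
  have h4 : 1 ≤ dimH (range π) / d := by
    rw [← h3]; exact (dimH_mono h2).trans h1
  have hd0 : (d : ENNReal) ≠ 0 := by exact_mod_cast hd.ne'
  rwa [ENNReal.le_div_iff_mul_le (Or.inl hd0) (Or.inl ENNReal.coe_ne_top), one_mul] at h4

/-- Concatenation of the maps `u (s 0), u (s 1), …`, with an extra map inserted at dyadic times. -/
noncomputable def dyadicComp {M : ℕ} (u : Fin M → ℝ × ℝ) (ext : ℕ → ℝ × ℝ → ℝ × ℝ)
    (s : ℕ → Fin M) : ℕ → ℝ × ℝ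
  | 0 => (1, 0)
  | m + 1 =>
    if Nat.log 2 m < Nat.log 2 (m + 1) then
      affComp (affComp (dyadicComp u ext s m) (u (s m)))
        (ext (m + 1) (affComp (dyadicComp u ext s m) (u (s m))))
    else affComp (dyadicComp u ext s m) (u (s m))

section
variable {M : ℕ} {u : Fin M → ℝ × ℝ} {ext : ℕ → ℝ × ℝ → ℝ × ℝ}

theorem dyadicComp_congr {s s' : ℕ → Fin M} {m : ℕ} (h : ∀ i < m, s i = s' i) :
    dyadicComp u ext s m = dyadicComp u ext s' m := by
  induction m with
  | zero => rfl
  | succ m ih =>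
    simp only [dyadicComp, ih fun i hi => h i (by omega), h m (by omega)]

theorem AffMaps.dyadicComp {K : Set ℝ} (hu : ∀ i, AffMaps K (u i))
    (hext : ∀ n h, AffMaps K (ext n h)) (s : ℕ → Fin M) (m : ℕ) :
    AffMaps K (dyadicComp u ext s m) := by
  induction m with
  | zero => exact AffMaps.id K
  | succ m ih =>
    rw [_root_.dyadicComp]
    split_ifs
    · exact (ih.comp (hu _)).comp (hext _ _)
    · exact ih.comp (hu _)

/-- The image of the next stage lies in the image of the current cylinder. -/
theorem exists_dyadicComp_succ_eq {K : Set ℝ} (hext : ∀ n h, AffMaps K (ext n h))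
    (s : ℕ → Fin M) (m : ℕ) {x : ℝ} (hx : x ∈ K) :
    ∃ y ∈ K, affEval (dyadicComp u ext s (m + 1)) x =
      affEval (dyadicComp u ext s m) (affEval (u (s m)) y) := by
  rw [dyadicComp]
  split_ifs
  · exact ⟨_, (hext _ _).mem x hx, by rw [affEval_comp, affEval_comp]⟩
  · exact ⟨x, hx, by rw [affEval_comp]⟩

theorem le_dyadicComp_fst {K : Set ℝ} {ρ θ : ℝ} (hρ : 0 < ρ) (hθ : 0 < θ) (hθ1 : θ ≤ 1)
    (hu : ∀ i, AffMaps K (u i)) (huρ : ∀ i, ρ ≤ (u i).1) (hext : ∀ n h, AffMaps K (ext n h))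
    (hextθ : ∀ n h, θ ^ n ≤ (ext n h).1) (s : ℕ → Fin M) (m : ℕ) :
    ρ ^ m * θ ^ (2 ^ (Nat.log 2 m + 1)) ≤ (dyadicComp u ext s m).1 := by
  induction m with
  | zero => rw [pow_zero, one_mul]; exact pow_le_one₀ hθ.le hθ1
  | succ m ih =>
    have h1 : ρ ^ (m + 1) * θ ^ (2 ^ (Nat.log 2 m + 1)) ≤
        (affComp (dyadicComp u ext s m) (u (s m))).1 := by
      rw [pow_succ, mul_right_comm]
      exact mul_le_mul ih (huρ _) hρ.le (AffMaps.dyadicComp hu hext s m).pos.le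
    rw [dyadicComp]
    split_ifs with h2
    · have h3 : m + 1 = 2 ^ (Nat.log 2 m + 1) := by
        have h4 : m < 2 ^ (Nat.log 2 m + 1) := Nat.lt_pow_succ_log_self (by norm_num) m
        have h5 : 2 ^ (Nat.log 2 m + 1) ≤ m + 1 :=
          (Nat.pow_le_pow_right (by norm_num) h2).trans (Nat.pow_log_le_self 2 (by omega))
        omega
      have h6 : Nat.log 2 (m + 1) = Nat.log 2 m + 1 := by
        conv_lhs => rw [h3]
        exact Nat.log_pow (by norm_num) _
      have h7 : 2 ^ (Nat.log 2 (m + 1) + 1) = 2 ^ (Nat.log 2 m + 1) + (m + 1) := by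
        rw [h6, pow_succ, ← h3]; ring
      rw [h7, pow_add θ, ← mul_assoc]
      exact mul_le_mul h1 (hextθ _ _) (by positivity)
        ((AffMaps.dyadicComp hu hext s m).comp (hu _)).pos.le
    · have h3 : Nat.log 2 (m + 1) = Nat.log 2 m :=
        le_antisymm (not_lt.mp h2) (Nat.log_mono_right (Nat.le_succ m))
      rwa [h3]

end

/-- Very well approximable points of the attractor fill up its dimension. -/
theorem IFS.IsAttractor.le_dimH_VWA {F : IFS} {K : Set ℝ} (hK : F.IsAttractor K) {d : NNReal}
    (hd0 : 0 < d) (hd : d < dimH K) : (d : ENNReal) ≤ dimH (VWA ∩ K) := by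
  obtain ⟨θ, hθ0, hθ1, hθ⟩ := hK.exists_approx_extension (zero_le.trans_lt hd)
  obtain ⟨ρ, hρ0, hρ1, M, u, hu, huρ, husep, hM⟩ :=
    hK.exists_separated_cylinders hd (pow_pos hθ0 2)
  set κ := ρ * θ ^ 2 with hκ
  have hκ0 : 0 < κ := by positivity
  have hκ1 : κ < 1 := mul_lt_one_of_nonneg_of_lt_one_left hρ0.le hρ1 (pow_le_one₀ hθ0.le hθ1.le)
  have hM1 : 1 < M := by
    have : 1 < κ ^ (-(d : ℝ)) :=
      Real.one_lt_rpow_of_pos_of_lt_one_of_neg hκ0 hκ1 (neg_neg_of_pos (by exact_mod_cast hd0))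
    exact_mod_cast this.trans_le hM
  obtain ⟨v, hv, m₁, D, hext⟩ := hθ κ hκ0 hκ1
  have hext' : ∀ n h, ∃ e, AffMaps K e ∧ θ ^ n ≤ e.1 ∧ (m₁ ≤ n → AffMaps K h → κ ^ n ≤ h.1 →
      ∃ (p : ℤ) (q : ℕ), 0 < q ∧ ∀ x ∈ K,
          |(q : ℝ) * affEval (affComp h e) x - p| < (q : ℝ) ^ (-v) ∧
          |(q : ℝ) * affEval (affComp h e) x - p| ≤ D * (2 ^ n)⁻¹) := by
    intro n h
    by_cases hc : m₁ ≤ n ∧ AffMaps K h ∧ κ ^ n ≤ h.1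
    · obtain ⟨e, h1, h2, h3⟩ := hext n hc.1 h hc.2.1 hc.2.2
      exact ⟨e, h1, h2, fun _ _ _ => h3⟩
    · exact ⟨(1, 0), AffMaps.id K, pow_le_one₀ hθ0.le hθ1.le,
        fun h1 h2 h3 => absurd ⟨h1, h2, h3⟩ hc⟩
  choose ext he1 he2 he3 using hext'
  have hmaps := AffMaps.dyadicComp hu he1
  have hratio := le_dyadicComp_fst hρ0 hθ0 hθ1.le hu huρ he1 he2
  have hcont : ∀ h : ℝ × ℝ, Continuous (affEval h) := fun h => by
    unfold affEval; fun_prop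
  have hex : ∀ s, (⋂ m, affEval (dyadicComp u ext s m) '' K).Nonempty := by
    intro s
    refine IsCompact.nonempty_iInter_of_sequence_nonempty_isCompact_isClosed _ ?_
      (fun m => hK.1.image _) (hK.2.1.image (hcont _)) (fun m => (hK.2.1.image (hcont _)).isClosed)
    rintro m _ ⟨x, hx, rfl⟩
    obtain ⟨y, hy, hxy⟩ := exists_dyadicComp_succ_eq (u := u) he1 s m hx
    exact ⟨_, (hu _).mem y hy, hxy.symm⟩
  choose π hπ using hex
  simp only [mem_iInter] at hπ
  have hπsucc : ∀ s m, ∃ y ∈ K,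
      π s = affEval (dyadicComp u ext s m) (affEval (u (s m)) y) := by
    intro s m
    obtain ⟨x, hx, hxs⟩ := hπ s (m + 1)
    obtain ⟨y, hy, hxy⟩ := exists_dyadicComp_succ_eq (u := u) he1 s m hx
    exact ⟨y, hy, by rw [← hxs, hxy]⟩
  refine (le_dimH_range_of_separated hM1 hκ0 hρ0 hd0 hM π ?_).trans (dimH_mono ?_)
  · intro s s' m hs hsm
    obtain ⟨y, hy, hys⟩ := hπsucc s m
    obtain ⟨y', hy', hys'⟩ := hπsucc s' m
    rw [hys, hys', dyadicComp_congr hs, affEval_sub, abs_mul, abs_of_pos (hmaps _ _).pos, mul_comm]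
    refine mul_le_mul ?_ (husep _ _ hsm _ hy _ hy') hρ0.le (hmaps _ _).pos.le
    rcases Nat.eq_zero_or_pos m with rfl | hm
    · simp [dyadicComp]
    · refine le_trans ?_ (hratio _ _)
      rw [hκ, mul_pow, ← pow_mul]
      refine mul_le_mul_of_nonneg_left (pow_le_pow_of_le_one hθ0.le hθ1.le ?_) (by positivity)
      have := Nat.pow_log_le_self 2 hm.ne'
      rw [pow_succ]; omega
  · rintro _ ⟨s, rfl⟩
    refine ⟨mem_VWA_of_approx (D := D) hv fun n₀ => ?_, ?_⟩
    · set j := n₀ + m₁ with hj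
      have hj2 : j < 2 ^ j := Nat.lt_two_pow_self
      obtain ⟨m, hm⟩ : ∃ m, 2 ^ (j + 1) = m + 1 := ⟨2 ^ (j + 1) - 1, by
        have : 0 < 2 ^ (j + 1) := by positivity
        omega⟩
      have hlog : Nat.log 2 (m + 1) = j + 1 := by rw [← hm]; exact Nat.log_pow (by norm_num) _
      have hlog' : Nat.log 2 m < j + 1 := Nat.log_lt_of_lt_pow' (by omega) (by omega)
      have hmj : 2 * 2 ^ j = m + 1 := by rw [← hm, pow_succ, mul_comm]
      obtain ⟨x, hx, hxs⟩ := hπ s (m + 1)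
      rw [dyadicComp, if_pos (by rw [hlog]; exact hlog')] at hxs
      have hrat : κ ^ (m + 1) ≤ (affComp (dyadicComp u ext s m) (u (s m))).1 := by
        refine le_trans ?_ (mul_le_mul (hratio s m) (huρ (s m)) hρ0.le (hmaps _ _).pos.le)
        rw [mul_right_comm, ← pow_succ, hκ, mul_pow, ← pow_mul]
        refine mul_le_mul_of_nonneg_left (pow_le_pow_of_le_one hθ0.le hθ1.le ?_) (by positivity)
        have := Nat.pow_log_le_self 2 (show m ≠ 0 by omega)
        rw [pow_succ]; omega
      obtain ⟨p, q, hq, hpq⟩ := he3 (m + 1) _ (by omega) ((hmaps s m).comp (hu _)) hrat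
      have := hpq x hx
      rw [hxs] at this
      exact ⟨m + 1, by omega, p, q, hq, this⟩
    · obtain ⟨x, hx, hxs⟩ := hπ s 0
      rw [← hxs]
      exact (hmaps s 0).mem x hx

/-- For any self-similar set `K ⊆ ℝ` (no separation condition),
`dim_H (VWA ∩ K) = dim_H K`. -/
theorem stmt4 (F : IFS) (K : Set ℝ) (hK : F.IsAttractor K) :
    dimH (VWA ∩ K) = dimH K := by
  refine le_antisymm (dimH_mono inter_subset_right) (le_of_forall_lt fun c hc => ?_)
  obtain ⟨d, hcd, hdK⟩ := ENNReal.lt_iff_exists_nnreal_btwn.mp hc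
  exact hcd.trans_le (hK.le_dimH_VWA (by exact_mod_cast zero_le.trans_lt hcd) hdK)
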